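/- Suppose the transmitters form a non-stationary planar Poisson process with mean measure density f(x) = λ/‖x‖² for ‖x‖ ≥ r and 0 otherwise (r > 0), so that the induced distance density is p(t) = (2π/t)·1{t ≥ r}. Then for every x ∈ ℝ, |P((I − E[I])/√Var(I) ≤ x) − Φ(x)| ≤ c(x)/√λ, where c(x) = (1/√(2π)) · (m_{H³}/(m_{H²})^{3/2}) · (∫_r^∞ G³(t)·(1/t) dt / (∫_r^∞ G²(t)·(1/t) dt)^{3/2}) · min(0.4785, 31.935/(1+|x|³)). -/

import Mathlib

open MeasureTheory ProbabilityTheory Filter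
open scoped Topology ENNReal

theorem sub_mul_cos_bounds {x : ℝ} (h0 : 0 ≤ x) (h1 : x ≤ Real.pi) :
    x ^ 2 * Real.sin x / 3 ≤ Real.sin x - x * Real.cos x ∧
      Real.sin x - x * Real.cos x ≤ x ^ 3 / 3 ∧ 0 ≤ Real.sin x - x * Real.cos x := by
  have key : ∀ (F F' : ℝ → ℝ), F 0 = 0 → (∀ y, HasDerivAt F (F' y) y) →
      (∀ y ∈ Set.Icc 0 Real.pi, 0 ≤ F' y) → ∀ y ∈ Set.Icc 0 Real.pi, 0 ≤ F y := by
    intro F F' hF0 hF hF' y hy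
    have hm : MonotoneOn F (Set.Icc 0 Real.pi) := by
      apply monotoneOn_of_deriv_nonneg (convex_Icc _ _)
      · exact fun y _ => (hF y).continuousAt.continuousWithinAt
      · exact fun y _ => (hF y).differentiableAt.differentiableWithinAt
      · intro y hy
        rw [interior_Icc] at hy
        rw [(hF y).deriv]
        exact hF' y ⟨hy.1.le, hy.2.le⟩
    rw [← hF0]
    exact hm ⟨le_rfl, Real.pi_pos.le⟩ hy hy.1
  have hd : ∀ y : ℝ, HasDerivAt (fun x => Real.sin x - x * Real.cos x) (y * Real.sin y) y := by
    intro y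
    exact ((Real.hasDerivAt_sin y).sub
      ((hasDerivAt_id y).mul (Real.hasDerivAt_cos y))).congr_deriv (by simp)
  have hpos : ∀ y ∈ Set.Icc 0 Real.pi, 0 ≤ Real.sin y - y * Real.cos y := by
    apply key _ _ (by simp) hd
    intro y hy
    exact mul_nonneg hy.1 (Real.sin_nonneg_of_nonneg_of_le_pi hy.1 hy.2)
  refine ⟨?_, ?_, hpos x ⟨h0, h1⟩⟩
  · have := key (fun y => (Real.sin y - y * Real.cos y) - y ^ 2 * Real.sin y / 3)
      (fun y => y * Real.sin y - (2 * y * Real.sin y + y ^ 2 * Real.cos y) / 3) (by simp)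
      (fun y => by
        exact ((hd y).sub (((hasDerivAt_pow 2 y).mul
          (Real.hasDerivAt_sin y)).div_const 3)).congr_deriv (by simp)) (fun y hy => by
        have := mul_nonneg hy.1 (hpos y hy)
        nlinarith) x ⟨h0, h1⟩
    linarith
  · have := key (fun y => y ^ 3 / 3 - (Real.sin y - y * Real.cos y))
      (fun y => y ^ 2 - y * Real.sin y) (by simp)
      (fun y => by
        exact (((hasDerivAt_pow 3 y).div_const 3).sub (hd y)).congr_deriv (by simp)) (fun y hy => by
        have := mul_le_mul_of_nonneg_left (Real.sin_le hy.1) hy.1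
        nlinarith) x ⟨h0, h1⟩
    linarith

theorem sub_cube_div_six_le_sin {x : ℝ} (h0 : 0 ≤ x) : x - x ^ 3 / 6 ≤ Real.sin x := by
  have hm : MonotoneOn (fun x => Real.sin x - (x - x ^ 3 / 6)) (Set.Ici 0) := by
    have hd : ∀ y : ℝ, HasDerivAt (fun x => Real.sin x - (x - x ^ 3 / 6))
        (Real.cos y - (1 - y ^ 2 / 2)) y := by
      intro y
      exact ((Real.hasDerivAt_sin y).sub
        ((hasDerivAt_id y).sub ((hasDerivAt_pow 3 y).div_const 6))).congr_deriv (by simp; ring)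
    apply monotoneOn_of_deriv_nonneg (convex_Ici _)
    · exact fun y _ => (hd y).continuousAt.continuousWithinAt
    · exact fun y _ => (hd y).differentiableAt.differentiableWithinAt
    · intro y hy
      rw [(hd y).deriv]
      have := Real.one_sub_sq_div_two_le_cos (x := y)
      linarith
  have := hm (Set.mem_Ici.2 le_rfl) (Set.mem_Ici.2 h0) h0
  simp at this
  linarith

theorem pi_mul_one_sub_le_sin {u : ℝ} (h0 : 0 ≤ u) (h1 : u ≤ 1) :
    Real.pi * u * (1 - u) ≤ Real.sin (Real.pi * u) := by
  have key : ∀ u : ℝ, 0 ≤ u → u ≤ 1 / 2 →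
      Real.pi * u * (1 - u) ≤ Real.sin (Real.pi * u) := by
    intro u h0 h1
    have h := sub_cube_div_six_le_sin (x := Real.pi * u) (by positivity)
    have hp := Real.pi_lt_d4
    have hp0 := Real.pi_pos
    have : Real.pi ^ 2 ≤ 12 := by nlinarith
    have : Real.pi ^ 2 * u ≤ 6 := by nlinarith
    have h2 : 0 ≤ Real.pi * u ^ 2 * (6 - Real.pi ^ 2 * u) :=
      mul_nonneg (by positivity) (by linarith)
    nlinarith
  rcases le_total u (1 / 2) with h | h
  · exact key u h0 h
  · have := key (1 - u) (by linarith) (by linarith)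
    rw [show Real.pi * (1 - u) = Real.pi - Real.pi * u by ring, Real.sin_pi_sub] at this
    nlinarith

/-- The sine coefficient in the Fourier transform of Vaaler's approximation to the sign. -/
noncomputable def vaalerCoeff (u : ℝ) : ℝ :=
  (1 - u) * (Real.cos (Real.pi * u) / Real.sin (Real.pi * u)) + 1 / Real.pi

theorem vaalerCoeff_bounds {u : ℝ} (h0 : 0 < u) (h1 : u < 1) :
    0 ≤ vaalerCoeff u ∧ (1 - u) * (Real.pi * u) / 3 ≤ 1 / (Real.pi * u) - vaalerCoeff u ∧
      1 / (Real.pi * u) - vaalerCoeff u ≤ Real.pi * u / 3 := by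
  have hp := Real.pi_pos
  set x := Real.pi * u with hx
  have hx0 : 0 < x := by positivity
  have hx1 : x < Real.pi := by nlinarith
  have hs : 0 < Real.sin x := Real.sin_pos_of_pos_of_lt_pi hx0 hx1
  obtain ⟨hA, hB, -⟩ := sub_mul_cos_bounds hx0.le hx1.le
  obtain ⟨-, -, hC⟩ := sub_mul_cos_bounds (x := Real.pi - x) (by linarith) (by linarith)
  rw [Real.sin_pi_sub, Real.cos_pi_sub] at hC
  have hD := pi_mul_one_sub_le_sin h0.le h1.le
  have he : 1 / x - vaalerCoeff u =
      (1 - u) * (Real.sin x - x * Real.cos x) / (x * Real.sin x) := by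
    rw [vaalerCoeff, ← hx]
    have : Real.pi = x / u := by rw [hx]; field_simp
    rw [this]
    field_simp
    ring
  refine ⟨?_, ?_, ?_⟩
  · have : vaalerCoeff u = (Real.sin x + (Real.pi - x) * Real.cos x) / (Real.pi * Real.sin x) := by
      rw [vaalerCoeff, ← hx]
      have : Real.pi - x = Real.pi * (1 - u) := by rw [hx]; ring
      rw [this]
      field_simp
      ring
    rw [this]
    apply div_nonneg _ (by positivity)
    nlinarith
  · rw [he, le_div_iff₀ (by positivity)]
    have := mul_le_mul_of_nonneg_left hA (by linarith : (0:ℝ) ≤ 1 - u)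
    nlinarith
  · rw [he, div_le_iff₀ (by positivity)]
    have h2 := mul_le_mul_of_nonneg_left hB (by linarith : (0:ℝ) ≤ 1 - u)
    have h3 : x ^ 2 * (x * (1 - u)) ≤ x ^ 2 * Real.sin x :=
      mul_le_mul_of_nonneg_left hD (by positivity)
    nlinarith

theorem sqrt_vaaler_error_le {u : ℝ} (h0 : 0 < u) (h1 : u < 1) :
    Real.sqrt ((1 - u) ^ 2 + (vaalerCoeff u - 1 / (Real.pi * u)) ^ 2) ≤
      1 - u + 1.05 * u ^ 2 := by
  obtain ⟨-, hA, hB⟩ := vaalerCoeff_bounds h0 h1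
  have hp := Real.pi_pos
  have hp2 := Real.pi_lt_d4
  have h0' : 0 ≤ 1 / (Real.pi * u) - vaalerCoeff u :=
    le_trans (by have : 0 < 1 - u := by linarith
                 positivity) hA
  apply Real.sqrt_le_iff.2 ⟨by nlinarith, ?_⟩
  have h2 : (vaalerCoeff u - 1 / (Real.pi * u)) ^ 2 ≤ (Real.pi * u / 3) ^ 2 := by
    rw [← neg_sq, neg_sub]
    exact pow_le_pow_left₀ h0' hB 2
  have h3 : (Real.pi * u / 3) ^ 2 ≤ 1.1 * u ^ 2 := by
    have : Real.pi ^ 2 ≤ 9.9 := by nlinarith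
    nlinarith [sq_nonneg u]
  nlinarith [mul_nonneg (sq_nonneg u) (sq_nonneg (1.05 * u - 1))]

theorem vaaler_poly_le {u : ℝ} (h0 : 0 < u) (h1 : u ≤ 0.5) :
    u ^ 2 * (1 - u) * (1 / 3 - u + 1.1 * (u ^ 2 * (1 - u))) ≤ 0.00719 := by
  have e1 : u ^ 2 * (1 - u) ≤ u * (0.0841 + 0.42 * u) := by
    nlinarith [mul_nonneg h0.le (sq_nonneg (u - 0.29))]
  have e2 : 1 / 3 - u + 1.1 * (u ^ 2 * (1 - u)) ≤ 1 / 3 - 0.9074 * u + 0.462 * u ^ 2 := by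
    linarith
  have e3 : 0 ≤ u ^ 2 * (1 - u) := mul_nonneg (by positivity) (by linarith)
  have e4 := mul_le_mul_of_nonneg_left e2 e3
  have e5 : (1 - u) * (1 / 3 - 0.9074 * u + 0.462 * u ^ 2) ≤
      0.356 - 1.357 * u + 1.3695 * u ^ 2 := by
    linarith [mul_nonneg (by linarith : 0 ≤ u + 0.58) (sq_nonneg (u - 0.29)), sq_nonneg u]
  have e6 := mul_le_mul_of_nonneg_left e5 (sq_nonneg u)
  have e7 : 0 ≤ 0.0775 + 0.5345 * u - 1.3695 * u ^ 2 := by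
    nlinarith [mul_nonneg h0.le (sub_nonneg.2 h1)]
  have e8 := mul_nonneg (sq_nonneg (u - 0.29)) e7
  have e9 : u ^ 2 * (0.356 - 1.357 * u + 1.3695 * u ^ 2) ≤ 0.00719 := by
    linarith [sq_nonneg (u - 0.29), mul_nonneg h0.le (sq_nonneg (u - 0.29))]
  linarith

theorem sqrt_vaaler_le {u : ℝ} (h0 : 0 < u) (h1 : u < 1) :
    Real.sqrt ((1 - u) ^ 2 + (vaalerCoeff u) ^ 2) ≤ 1.035 / (Real.pi * u) := by
  obtain ⟨hb, hA, -⟩ := vaalerCoeff_bounds h0 h1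
  have hp := Real.pi_pos
  have hp1 := Real.pi_gt_d4
  have hp2 := Real.pi_lt_d4
  have hx : 0 < Real.pi * u := by positivity
  apply Real.sqrt_le_iff.2 ⟨by positivity, ?_⟩
  rw [div_pow, le_div_iff₀ (by positivity)]
  have h2 : Real.pi * u * vaalerCoeff u ≤ 1 - (1 - u) * (Real.pi * u) ^ 2 / 3 := by
    have h := mul_le_mul_of_nonneg_left hA hx.le
    have : Real.pi * u * (1 / (Real.pi * u)) = 1 := by field_simp
    nlinarith
  have h3 : (Real.pi * u * vaalerCoeff u) ^ 2 ≤ (1 - (1 - u) * (Real.pi * u) ^ 2 / 3) ^ 2 :=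
    pow_le_pow_left₀ (by positivity) h2 2
  have hpp : Real.pi ^ 2 ≤ 9.9 := by nlinarith
  have hpp' : 9.8 ≤ Real.pi ^ 2 := by nlinarith
  set p := Real.pi ^ 2 with hpdef
  have h4 : (1 - u) ^ 2 * (p * u ^ 2) + (1 - (1 - u) * (p * u ^ 2) / 3) ^ 2 ≤ 1.071225 := by
    have e : (1 - u) ^ 2 * (p * u ^ 2) + (1 - (1 - u) * (p * u ^ 2) / 3) ^ 2 =
      1 + p * u ^ 2 * (1 - u) * (1 / 3 - u + p * (u ^ 2 * (1 - u)) / 9) := by ring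
    rw [e]
    have h5 : p * (u ^ 2 * (1 - u)) / 9 ≤ 1.1 * (u ^ 2 * (1 - u)) := by
      have : 0 ≤ u ^ 2 * (1 - u) := mul_nonneg (by positivity) (by linarith)
      nlinarith
    have h6 : p * u ^ 2 * (1 - u) * (1 / 3 - u + p * (u ^ 2 * (1 - u)) / 9) ≤
        p * u ^ 2 * (1 - u) * (1 / 3 - u + 1.1 * (u ^ 2 * (1 - u))) := by
      apply mul_le_mul_of_nonneg_left (by linarith)
      exact mul_nonneg (by positivity) (by linarith)
    rcases le_total (1 / 3 - u + 1.1 * (u ^ 2 * (1 - u))) 0 with h7 | h7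
    · have := mul_nonpos_of_nonneg_of_nonpos
        (mul_nonneg (by positivity : 0 ≤ p * u ^ 2) (by linarith : 0 ≤ 1 - u)) h7
      nlinarith
    · have h8 : p * u ^ 2 * (1 - u) * (1 / 3 - u + 1.1 * (u ^ 2 * (1 - u))) ≤
        9.9 * (u ^ 2 * (1 - u) * (1 / 3 - u + 1.1 * (u ^ 2 * (1 - u)))) := by
        have : 0 ≤ u ^ 2 * (1 - u) * (1 / 3 - u + 1.1 * (u ^ 2 * (1 - u))) :=
          mul_nonneg (mul_nonneg (by positivity) (by linarith)) h7
        nlinarith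
      have hu2 : u ≤ 0.5 := by
        by_contra hcon
        push Not at hcon
        have := mul_nonneg h0.le (sq_nonneg (u - 0.5))
        clear h2 h3 h6 hA
        nlinarith
      have h9 := vaaler_poly_le h0 hu2
      linarith
  calc _ = (1 - u) ^ 2 * (p * u ^ 2) + (Real.pi * u * vaalerCoeff u) ^ 2 := by rw [hpdef]; ring
    _ ≤ (1 - u) ^ 2 * (p * u ^ 2) + (1 - (1 - u) * (p * u ^ 2) / 3) ^ 2 := by
      have : (Real.pi * u) ^ 2 = p * u ^ 2 := by rw [hpdef]; ring
      rw [this] at h3; linarith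
    _ ≤ _ := by norm_num at h4 ⊢; linarith

theorem sinc_sq_eq_integral (z : ℝ) :
    Real.sinc (Real.pi * z) ^ 2 =
      2 * ∫ u in (0:ℝ)..1, (1 - u) * Real.cos (2 * Real.pi * u * z) := by
  rcases eq_or_ne z 0 with rfl | hz
  · have := intervalIntegral.integral_comp_sub_left (a := 0) (b := 1) (fun x : ℝ => x) 1
    simp at this ⊢
    rw [this]; norm_num
  have hp := Real.pi_pos
  set w := 2 * Real.pi * z with hw
  have hw0 : w ≠ 0 := by positivity
  have h : ∫ u in (0:ℝ)..1, (1 - u) * Real.cos (2 * Real.pi * u * z) =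
      ((1 - 1) * Real.sin (w * 1) / w - Real.cos (w * 1) / w ^ 2) -
      ((1 - 0) * Real.sin (w * 0) / w - Real.cos (w * 0) / w ^ 2) := by
    apply intervalIntegral.integral_eq_sub_of_hasDerivAt
      (f := fun u => (1 - u) * Real.sin (w * u) / w - Real.cos (w * u) / w ^ 2)
    · intro u _
      have h1 : HasDerivAt (fun u => w * u) w u := by
        simpa using (hasDerivAt_id u).const_mul w
      have h2 := ((((hasDerivAt_id u).const_sub 1).mul h1.sin).div_const w).sub
        (h1.cos.div_const (w ^ 2))
      refine h2.congr_deriv ?_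
      have : 2 * Real.pi * u * z = w * u := by rw [hw]; ring
      rw [this]
      field_simp
      simp
      ring
    · apply Continuous.intervalIntegrable
      fun_prop
  rw [h, Real.sinc_of_ne_zero (by positivity)]
  have h2 : Real.cos w = 1 - 2 * Real.sin (Real.pi * z) ^ 2 := by
    rw [hw, mul_assoc, Real.cos_two_mul, Real.cos_sq']; ring
  simp
  rw [h2, hw]
  field_simp
  ring

theorem hasSum_sinc_sq (z : ℝ) :
    HasSum (fun n : ℤ => Real.sinc (Real.pi * (z - n)) ^ 2) 1 := by
  have hab : (-(1/2) : ℝ) < 1/2 := by norm_num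
  have hcont : Continuous (fun u : ℝ => Complex.exp (2 * Real.pi * Complex.I * z * u)) := by
    fun_prop
  have hnorm : ∀ u : ℝ, ‖Complex.exp (2 * Real.pi * Complex.I * z * u)‖ = 1 := by
    intro u
    rw [show (2 * Real.pi * Complex.I * z * u : ℂ) =
      ((2 * Real.pi * z * u : ℝ) : ℂ) * Complex.I by push_cast; ring]
    exact Complex.norm_exp_ofReal_mul_I _
  have h := hasSum_sq_fourierCoeffOn (f := fun u : ℝ =>
    Complex.exp (2 * Real.pi * Complex.I * z * u)) hab (by
      apply MemLp.of_bound hcont.aestronglyMeasurable 1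
      exact ae_of_all _ fun u => (hnorm u).le)
  simp only [hnorm] at h
  convert h using 1
  · funext n
    rw [fourierCoeffOn_eq_integral]
    have e : ∀ u : ℝ, (fourier (-n)) (u : AddCircle ((1/2 : ℝ) - -(1/2))) •
        Complex.exp (2 * Real.pi * Complex.I * z * u) =
        Complex.exp ((2 * Real.pi * (z - n) * Complex.I) * u) := by
      intro u
      rw [fourier_coe_apply, smul_eq_mul, ← Complex.exp_add]
      congr 1
      push_cast
      norm_num
      ring
    simp only [e]
    rcases eq_or_ne (z - n) 0 with h0 | h0
    · have : (z : ℂ) - n = 0 := by exact_mod_cast h0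
      simp [this, h0]
      norm_num
    · have hc : (2 * Real.pi * (z - n) * Complex.I : ℂ) ≠ 0 := by
        have h1 : (z : ℂ) - n ≠ 0 := by exact_mod_cast h0
        have h2 : (Real.pi : ℂ) ≠ 0 := by exact_mod_cast Real.pi_ne_zero
        simp [h1, h2]
      rw [integral_exp_mul_complex hc, Real.sinc_of_ne_zero (by
        have := Real.pi_ne_zero; positivity)]
      have e2 : (Complex.exp (2 * Real.pi * (z - n) * Complex.I * (1/2 : ℝ)) -
        Complex.exp (2 * Real.pi * (z - n) * Complex.I * (-(1/2) : ℝ))) /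
          (2 * Real.pi * (z - n) * Complex.I) =
          ((Real.sin (Real.pi * (z - n)) / (Real.pi * (z - n)) : ℝ) : ℂ) := by
        push_cast
        rw [Complex.sin, show (2 * Real.pi * (z - n) * Complex.I * (1/2) : ℂ) =
          Real.pi * (z - n) * Complex.I by ring,
          show (2 * Real.pi * (z - n) * Complex.I * (-(1/2)) : ℂ) =
          -(Real.pi * (z - n)) * Complex.I by ring]
        rw [div_eq_div_iff hc (by
          intro h; apply hc; linear_combination 2 * Complex.I * h)]
        linear_combination (-(Real.pi : ℂ) * (z - n) *
          (Complex.exp (-(Real.pi * (z - n)) * Complex.I) -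
          Complex.exp (Real.pi * (z - n) * Complex.I))) * Complex.I_sq
      rw [e2, norm_smul, Complex.norm_real, Real.norm_eq_abs, Real.norm_eq_abs, mul_pow, sq_abs,
        sq_abs]
      norm_num
  · norm_num

theorem dirichlet_sin_sum (x : ℝ) (N : ℕ) :
    2 * Real.sin x * ∑ n ∈ Finset.range N, Real.sin (2 * n * x) =
      Real.cos x - Real.cos ((2 * N - 1) * x) := by
  induction N with
  | zero =>
    have : (2 * ((0 : ℕ) : ℝ) - 1) * x = -x := by push_cast; ring
    rw [this, Real.cos_neg]
    simp
  | succ N ih =>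
    rw [Finset.sum_range_succ, mul_add, ih]
    have h1 : Real.cos ((2 * N - 1) * x) = Real.cos (2 * N * x - x) := by ring_nf
    have h2 : Real.cos ((2 * (N + 1 : ℕ) - 1) * x) = Real.cos (2 * N * x + x) := by
      push_cast; ring_nf
    rw [h1, h2, Real.cos_add, Real.cos_sub]
    ring

theorem tendsto_integral_mul_cos_odd {g : ℝ → ℝ} (hg : IntegrableOn g (Set.Ioc 0 1)) :
    Tendsto (fun N : ℕ => ∫ u in Set.Ioc (0:ℝ) 1, g u * Real.cos ((2 * N - 1) * (Real.pi * u)))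
      atTop (𝓝 0) := by
  have h := Real.tendsto_integral_exp_smul_cocompact
    (fun u => ((Set.Ioc (0:ℝ) 1).indicator (fun u => (g u : ℂ)) u))
  have h2 : Tendsto (fun N : ℕ => (2 * (N:ℝ) - 1) / 2) atTop (cocompact ℝ) := by
    refine Tendsto.mono_right ?_ atTop_le_cocompact
    apply Tendsto.atTop_div_const (by norm_num)
    apply tendsto_atTop_add_const_right
    exact (tendsto_natCast_atTop_atTop).const_mul_atTop (by norm_num)
  have h3 := (Complex.continuous_re.tendsto _).comp (h.comp h2)
  simp only [Complex.zero_re] at h3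
  refine h3.congr fun N => ?_
  simp only [Function.comp_apply]
  set w : ℝ := (2 * (N:ℝ) - 1) / 2 with hw
  have e : (fun v => Real.fourierChar (-(v * w)) •
      (Set.Ioc (0:ℝ) 1).indicator (fun u => (g u : ℂ)) v) =
      (Set.Ioc (0:ℝ) 1).indicator (fun v => Real.fourierChar (-(v * w)) • (g v : ℂ)) := by
    funext v
    by_cases hv : v ∈ Set.Ioc (0:ℝ) 1 <;> simp [hv]
  rw [e, integral_indicator measurableSet_Ioc]
  have hint : Integrable (fun v => Real.fourierChar (-(v * w)) • (g v : ℂ))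
      (volume.restrict (Set.Ioc 0 1)) := by
    have h4 : Integrable (fun v => (g v : ℂ)) (volume.restrict (Set.Ioc 0 1)) := hg.ofReal
    simp only [Circle.smul_def]
    apply h4.bdd_mul (c := 1)
    · apply Continuous.aestronglyMeasurable
      fun_prop
    · exact ae_of_all _ fun v => (Circle.norm_coe _).le
  have h5 := integral_re hint
  simp only [RCLike.re_to_complex] at h5
  rw [← h5]
  apply integral_congr_ae
  refine ae_of_all _ fun v => ?_
  simp only [Circle.smul_def, Real.fourierChar_apply, smul_eq_mul, Complex.re_mul_ofReal,
    Complex.exp_ofReal_mul_I_re]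
  rw [mul_comm, ← Real.cos_neg]
  congr 2
  rw [hw]; ring

/-- Vaaler's entire function of exponential type approximating the sign. -/
noncomputable def vaalerSign (z : ℝ) : ℝ :=
  2 * ∫ u in Set.Ioc (0:ℝ) 1, vaalerCoeff u * Real.sin (2 * Real.pi * u * z)

theorem measurable_vaalerCoeff : Measurable vaalerCoeff := by
  unfold vaalerCoeff
  fun_prop

theorem abs_vaalerCoeff_le {u : ℝ} (h0 : 0 < u) (h1 : u ≤ 1) :
    |vaalerCoeff u| ≤ 1 / (Real.pi * u) := by
  have hp := Real.pi_pos
  rcases h1.lt_or_eq with h | rfl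
  · obtain ⟨hA, hB, -⟩ := vaalerCoeff_bounds h0 h
    rw [abs_of_nonneg hA]
    have : 0 ≤ (1 - u) * (Real.pi * u) / 3 := by
      have : 0 < 1 - u := by linarith
      positivity
    linarith
  · simp [vaalerCoeff, abs_of_pos hp]

theorem abs_vaalerCoeff_mul_sin_le {u : ℝ} (h0 : 0 < u) (h1 : u ≤ 1) (z : ℝ) :
    |vaalerCoeff u * Real.sin (2 * Real.pi * u * z)| ≤ 2 * |z| := by
  have hp := Real.pi_pos
  have hs : |Real.sin (2 * Real.pi * u * z)| ≤ 2 * Real.pi * u * |z| := by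
    refine (Real.abs_sin_le_abs).trans ?_
    rw [abs_mul, abs_of_pos (by positivity : 0 < 2 * Real.pi * u)]
  rw [abs_mul]
  calc _ ≤ 1 / (Real.pi * u) * (2 * Real.pi * u * |z|) :=
        mul_le_mul (abs_vaalerCoeff_le h0 h1) hs (abs_nonneg _) (by positivity)
    _ = 2 * |z| := by field_simp

theorem integrableOn_Ioc_of_bound {f : ℝ → ℝ} (hf : Measurable f) {C a b : ℝ}
    (h : ∀ u ∈ Set.Ioc a b, |f u| ≤ C) : IntegrableOn f (Set.Ioc a b) := by
  apply Measure.integrableOn_of_bounded (M := C) (by simp) hf.aestronglyMeasurable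
  exact (ae_restrict_iff' measurableSet_Ioc).2 (ae_of_all _ h)

theorem vaalerSign_neg (z : ℝ) : vaalerSign (-z) = -vaalerSign z := by
  simp only [vaalerSign, mul_neg, Real.sin_neg, integral_neg]

theorem mul_sinc_sq_eq (z : ℝ) : 2 * z * Real.sinc (Real.pi * z) ^ 2 =
    ∫ u in Set.Ioc (0:ℝ) 1, 2 / Real.pi * Real.sin (2 * Real.pi * u * z) := by
  have hp := Real.pi_pos
  rcases eq_or_ne z 0 with rfl | hz
  · simp
  set w := 2 * Real.pi * z with hw
  have hw0 : w ≠ 0 := by positivity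
  rw [integral_const_mul, ← intervalIntegral.integral_of_le zero_le_one]
  have : ∀ u : ℝ, 2 * Real.pi * u * z = u * w := by intro u; rw [hw]; ring
  simp only [this]
  rw [intervalIntegral.integral_comp_mul_right _ hw0, integral_sin,
    Real.sinc_of_ne_zero (by positivity)]
  have h2 : Real.cos w = 1 - 2 * Real.sin (Real.pi * z) ^ 2 := by
    rw [hw, mul_assoc, Real.cos_two_mul, Real.cos_sq']; ring
  simp
  rw [h2, hw]
  field_simp
  ring

theorem tendsto_vaalerSign (z : ℝ) :
    Tendsto (fun N : ℕ => (∑ n ∈ Finset.range N, (Real.sinc (Real.pi * (z - n)) ^ 2 -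
      Real.sinc (Real.pi * (z + n)) ^ 2)) + 2 * z * Real.sinc (Real.pi * z) ^ 2)
      atTop (𝓝 (vaalerSign z)) := by
  have hp := Real.pi_pos
  set g : ℝ → ℝ := fun u => (1 - u) * (2 * Real.sin (2 * Real.pi * u * z)) / Real.sin (Real.pi * u)
    with hgdef
  have hg : IntegrableOn g (Set.Ioc 0 1) := by
    apply integrableOn_Ioc_of_bound (by fun_prop) (C := 4 * |z|)
    intro u hu
    have hs : |Real.sin (2 * Real.pi * u * z)| ≤ 2 * Real.pi * u * |z| := by
      refine (Real.abs_sin_le_abs).trans ?_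
      have := hu.1
      rw [abs_mul, abs_of_pos (by positivity : 0 < 2 * Real.pi * u)]
    rcases hu.2.lt_or_eq with h | rfl
    · have h1 := pi_mul_one_sub_le_sin hu.1.le hu.2
      have h2 : 0 < Real.pi * u * (1 - u) := by
        have := hu.1
        have : 0 < 1 - u := by linarith
        positivity
      rw [hgdef, abs_div, abs_of_pos (h2.trans_le h1), div_le_iff₀ (h2.trans_le h1), abs_mul,
        abs_mul, abs_of_pos (by linarith : 0 < 1 - u), abs_two]
      calc _ ≤ (1 - u) * (2 * (2 * Real.pi * u * |z|)) := by
            have : 0 < 1 - u := by linarith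
            gcongr
        _ = 4 * |z| * (Real.pi * u * (1 - u)) := by ring
        _ ≤ _ := by gcongr
    · simp [hgdef]
  have key : ∀ N : ℕ, (∑ n ∈ Finset.range N, (Real.sinc (Real.pi * (z - n)) ^ 2 -
      Real.sinc (Real.pi * (z + n)) ^ 2)) + 2 * z * Real.sinc (Real.pi * z) ^ 2 =
      vaalerSign z - ∫ u in Set.Ioc (0:ℝ) 1, g u * Real.cos ((2 * N - 1) * (Real.pi * u)) := by
    intro N
    have hint1 : ∀ n : ℕ, Real.sinc (Real.pi * (z - n)) ^ 2 - Real.sinc (Real.pi * (z + n)) ^ 2 =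
        ∫ u in Set.Ioc (0:ℝ) 1, 4 * (1 - u) * Real.sin (2 * Real.pi * u * z) *
          Real.sin (2 * n * (Real.pi * u)) := by
      intro n
      rw [sinc_sq_eq_integral, sinc_sq_eq_integral, ← mul_sub,
        ← intervalIntegral.integral_sub (Continuous.intervalIntegrable (by fun_prop) _ _)
          (Continuous.intervalIntegrable (by fun_prop) _ _), ← intervalIntegral.integral_const_mul,
        intervalIntegral.integral_of_le zero_le_one]
      congr 1
      funext u
      rw [mul_sub (2 * Real.pi * u) z, mul_add (2 * Real.pi * u) z, Real.cos_sub, Real.cos_add,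
        show 2 * n * (Real.pi * u) = 2 * Real.pi * u * n by ring]
      ring
    simp only [hint1]
    rw [← integral_finsetSum _ (fun n _ => (Continuous.integrableOn_Ioc (by fun_prop))),
      mul_sinc_sq_eq]
    have h0 : vaalerSign z = ∫ u in Set.Ioc (0:ℝ) 1, (g u * Real.cos (Real.pi * u) +
        2 / Real.pi * Real.sin (2 * Real.pi * u * z)) := by
      rw [vaalerSign, ← integral_const_mul]
      congr 1
      funext u
      rw [vaalerCoeff, hgdef]
      ring
    have hb : ∀ w : ℝ, IntegrableOn (fun u => g u * Real.cos (w * (Real.pi * u)))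
        (Set.Ioc 0 1) := by
      intro w
      apply Integrable.mul_bdd (c := 1) hg
      · exact Continuous.aestronglyMeasurable (by fun_prop)
      · exact ae_of_all _ fun u => Real.abs_cos_le_one _
    have hb1 := hb 1
    simp only [one_mul] at hb1
    rw [h0, integral_add hb1 (Continuous.integrableOn_Ioc (by fun_prop)), add_sub_right_comm,
      ← integral_sub hb1 (hb _)]
    congr 1
    apply setIntegral_congr_fun measurableSet_Ioc
    intro u hu
    simp only
    rw [← Finset.mul_sum, ← mul_sub, ← dirichlet_sin_sum, hgdef]
    rcases hu.2.lt_or_eq with h | rfl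
    · have hs : Real.sin (Real.pi * u) ≠ 0 := by
        apply (Real.sin_pos_of_pos_of_lt_pi (mul_pos hp hu.1) _).ne'
        nlinarith
      generalize ∑ n ∈ Finset.range N, Real.sin (2 * n * (Real.pi * u)) = T
      beta_reduce
      generalize Real.sin (Real.pi * u) = s at hs ⊢
      field_simp
      ring
    · simp
  simp only [key]
  simpa using (tendsto_integral_mul_cos_odd hg).const_sub (vaalerSign z)

theorem abs_one_sub_vaalerSign_le {z : ℝ} (hz : 0 < z) :
    |1 - vaalerSign z| ≤ Real.sinc (Real.pi * z) ^ 2 := by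
  have hp := Real.pi_pos
  set S := Real.sin (Real.pi * z) ^ 2 / Real.pi ^ 2 with hS
  have hS0 : 0 ≤ S := by positivity
  have hF : ∀ n : ℕ, Real.sinc (Real.pi * (z + n)) ^ 2 = S * (1 / (z + n) ^ 2) := by
    intro n
    have : z + n ≠ 0 := by positivity
    rw [Real.sinc_of_ne_zero (by positivity), mul_add, mul_comm Real.pi (n:ℝ),
      Real.sin_add_nat_mul_pi, hS, div_pow, mul_pow, ← pow_mul, mul_comm n 2, pow_mul]
    have : Real.pi * z + n * Real.pi = Real.pi * (z + n) := by ring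
    rw [this]
    field_simp
    simp
  have h1 := (hasSum_sinc_sq z).nat_add_neg.tendsto_sum_nat
  have h2 := h1.sub (tendsto_vaalerSign z)
  have hb : ∀ N : ℕ, 1 / z ^ 2 + 1 / (z + 1) - 1 / (z + (N + 1 : ℕ)) ≤
      ∑ n ∈ Finset.range (N + 1), 1 / (z + n) ^ 2 ∧
      ∑ n ∈ Finset.range (N + 1), 1 / (z + n) ^ 2 ≤ 1 / z ^ 2 + 1 / z - 1 / (z + N) := by
    intro N
    induction N with
    | zero => simp
    | succ N ih =>
      rw [Finset.sum_range_succ]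
      have a1 : 0 < z + N := by positivity
      have e1 : 1 / (z + (N + 1 : ℕ)) ^ 2 ≤ 1 / (z + N) - 1 / (z + (N + 1 : ℕ)) := by
        push_cast
        rw [div_sub_div _ _ (by positivity) (by positivity), div_le_div_iff₀ (by positivity)
          (by positivity)]
        nlinarith
      have e2 : 1 / (z + (N + 1 : ℕ)) - 1 / (z + (N + 1 + 1 : ℕ)) ≤ 1 / (z + (N + 1 : ℕ)) ^ 2 := by
        push_cast
        rw [div_sub_div _ _ (by positivity) (by positivity), div_le_div_iff₀ (by positivity)
          (by positivity)]
        nlinarith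
      constructor <;> linarith [ih.1, ih.2]
  have hlim0 : Tendsto (fun N : ℕ => 1 / (z + (N : ℝ))) atTop (𝓝 0) := by
    simp only [one_div]
    exact (tendsto_atTop_add_const_left _ _ tendsto_natCast_atTop_atTop).inv_tendsto_atTop
  have hFz : Real.sinc (Real.pi * z) ^ 2 = S * (1 / z ^ 2) := by simpa using hF 0
  have hpart : ∀ N : ℕ, ((∑ n ∈ Finset.range N, (Real.sinc (Real.pi * (z - (n:ℤ))) ^ 2 +
      Real.sinc (Real.pi * (z - (-(n:ℤ) : ℤ))) ^ 2)) -
      ((∑ n ∈ Finset.range N, (Real.sinc (Real.pi * (z - n)) ^ 2 -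
      Real.sinc (Real.pi * (z + n)) ^ 2)) + 2 * z * Real.sinc (Real.pi * z) ^ 2)) =
      2 * S * (∑ n ∈ Finset.range N, 1 / (z + n) ^ 2) - 2 * S / z := by
    intro N
    rw [← sub_sub, ← Finset.sum_sub_distrib, Finset.mul_sum, hFz]
    congr 1
    · apply Finset.sum_congr rfl
      intro n _
      rw [mul_assoc 2 S, ← hF n]
      push_cast
      rw [sub_neg_eq_add]
      ring
    · field_simp
  have h3 := h2.congr hpart
  have h4 := (tendsto_add_atTop_iff_nat 1).2 h3
  simp only [Int.cast_zero, sub_zero] at h4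
  have hup : 1 + Real.sinc (Real.pi * z) ^ 2 - vaalerSign z ≤
      2 * S * (1 / z ^ 2 + 1 / z) - 2 * S / z := by
    refine le_of_tendsto h4 (Eventually.of_forall fun N => ?_)
    have : 0 ≤ 1 / (z + N) := by positivity
    have := (hb N).2
    gcongr
    linarith
  have hlo : 2 * S * (1 / z ^ 2 + 1 / (z + 1) - 0) - 2 * S / z ≤
      1 + Real.sinc (Real.pi * z) ^ 2 - vaalerSign z := by
    refine le_of_tendsto_of_tendsto' (((hlim0.comp (tendsto_add_atTop_nat 1)).const_sub
      (1 / z ^ 2 + 1 / (z + 1))).const_mul (2 * S) |>.sub_const (2 * S / z)) h4 fun N => ?_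
    simp only [Function.comp_apply]
    have := (hb N).1
    gcongr
  have e3 : 1 / z - 1 / (z + 1) ≤ 1 / z ^ 2 := by
    rw [div_sub_div _ _ (by positivity) (by positivity), div_le_div_iff₀ (by positivity)
      (by positivity)]
    nlinarith [pow_pos hz 3]
  have e4 := mul_le_mul_of_nonneg_left e3 hS0
  rw [hFz] at hup hlo ⊢
  have e5 : 2 * S / z = 2 * (S * (1 / z)) := by ring
  rw [e5] at hup hlo
  rw [abs_le]
  constructor <;> nlinarith

/-- Beurling's majorant and minorant property. -/
theorem abs_sign_sub_vaalerSign_le {z : ℝ} (hz : z ≠ 0) :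
    |SignType.sign z - vaalerSign z| ≤ Real.sinc (Real.pi * z) ^ 2 := by
  rcases hz.lt_or_gt with h | h
  · have := abs_one_sub_vaalerSign_le (neg_pos.2 h)
    rw [vaalerSign_neg, mul_neg, Real.sinc_neg] at this
    rw [sign_neg h]
    simp
    rw [← abs_neg]
    convert this using 2
    ring
  · simpa [sign_pos h] using abs_one_sub_vaalerSign_le h

theorem indicator_le_vaaler (z : ℝ) : (if 0 ≤ z then (1:ℝ) else 0) ≤
    (1 + vaalerSign z + Real.sinc (Real.pi * z) ^ 2) / 2 := by
  rcases lt_trichotomy z 0 with h | rfl | h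
  · have := abs_le.1 (abs_sign_sub_vaalerSign_le h.ne)
    simp [sign_neg h, not_le.2 h] at this ⊢
    linarith
  · simp [vaalerSign]
  · have := abs_le.1 (abs_sign_sub_vaalerSign_le h.ne')
    simp [sign_pos h, h.le] at this ⊢
    linarith

theorem vaaler_le_indicator (z : ℝ) :
    (1 + vaalerSign z - Real.sinc (Real.pi * z) ^ 2) / 2 ≤ (if 0 ≤ z then (1:ℝ) else 0) := by
  rcases lt_trichotomy z 0 with h | rfl | h
  · have := abs_le.1 (abs_sign_sub_vaalerSign_le h.ne)
    simp [sign_neg h, not_le.2 h] at this ⊢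
    linarith
  · simp [vaalerSign]
  · have := abs_le.1 (abs_sign_sub_vaalerSign_le h.ne')
    simp [sign_pos h, h.le] at this ⊢
    linarith

/-- The standard normal distribution function. -/
noncomputable def normalCdf (x : ℝ) : ℝ :=
  (∫ t in Set.Iic x, Real.exp (-t ^ 2 / 2)) / Real.sqrt (2 * Real.pi)

theorem exp_neg_sq_div_two_eq (t : ℝ) :
    Real.exp (-t ^ 2 / 2) = Real.exp (-(1 / 2) * t ^ 2) := by ring_nf

theorem integrable_exp_neg_sq_div_two : Integrable (fun t : ℝ => Real.exp (-t ^ 2 / 2)) := by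
  simp only [exp_neg_sq_div_two_eq]
  exact integrable_exp_neg_mul_sq (by norm_num)

theorem integral_exp_neg_sq_div_two_Ioi :
    ∫ t in Set.Ioi (0:ℝ), Real.exp (-t ^ 2 / 2) = Real.sqrt (2 * Real.pi) / 2 := by
  simp only [exp_neg_sq_div_two_eq]
  rw [integral_gaussian_Ioi]
  congr 2
  ring

theorem normalCdf_zero : normalCdf 0 = 1 / 2 := by
  have h := integral_comp_neg_Iic 0 (fun t : ℝ => Real.exp (-t ^ 2 / 2))
  simp only [neg_sq, neg_zero] at h
  rw [normalCdf, h, integral_exp_neg_sq_div_two_Ioi]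
  have : 0 < Real.sqrt (2 * Real.pi) := by positivity
  field_simp

theorem hasDerivAt_normalCdf (x : ℝ) :
    HasDerivAt normalCdf (Real.exp (-x ^ 2 / 2) / Real.sqrt (2 * Real.pi)) x := by
  have hi := integrable_exp_neg_sq_div_two
  have e : ∀ y, normalCdf y = ((∫ t in (0:ℝ)..y, Real.exp (-t ^ 2 / 2)) +
      ∫ t in Set.Iic (0:ℝ), Real.exp (-t ^ 2 / 2)) / Real.sqrt (2 * Real.pi) := by
    intro y
    rw [normalCdf, ← intervalIntegral.integral_Iic_sub_Iic hi.integrableOn hi.integrableOn]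
    ring
  rw [funext e]
  have hc : Continuous (fun t : ℝ => Real.exp (-t ^ 2 / 2)) := by fun_prop
  exact ((hc.integral_hasStrictDerivAt 0 x).hasDerivAt.add_const _).div_const _

theorem integral_cos_mul_exp_neg_sq (x : ℝ) :
    ∫ v in Set.Ioi (0:ℝ), Real.cos (v * x) * Real.exp (-v ^ 2 / 2) =
      Real.sqrt (2 * Real.pi) / 2 * Real.exp (-x ^ 2 / 2) := by
  have h1 := integral_comp_abs (f := fun v => Real.cos (v * x) * Real.exp (-v ^ 2 / 2))
  have e1 : ∀ v : ℝ, Real.cos (|v| * x) * Real.exp (-|v| ^ 2 / 2) =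
      (Complex.exp (Complex.I * (x : ℂ) * v) * Complex.exp (-(1 / 2 : ℂ) * v ^ 2)).re := by
    intro v
    rw [show Complex.I * (x : ℂ) * v = ((v * x : ℝ) : ℂ) * Complex.I by push_cast; ring,
      show -(1 / 2 : ℂ) * v ^ 2 = ((-v ^ 2 / 2 : ℝ) : ℂ) by push_cast; ring, ← Complex.ofReal_exp,
      Complex.re_mul_ofReal, Complex.exp_ofReal_mul_I_re, sq_abs]
    rcases abs_choice v with h | h <;> simp [h]
  simp only [e1] at h1
  have hint : Integrable (fun v : ℝ => Complex.exp (Complex.I * (x : ℂ) * v) *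
      Complex.exp (-(1 / 2 : ℂ) * v ^ 2)) := by
    have h2 : Integrable (fun v : ℝ => Complex.exp (-(1 / 2 : ℂ) * v ^ 2)) := by
      have := (integrable_exp_neg_sq_div_two).ofReal (𝕜 := ℂ)
      refine this.congr (ae_of_all _ fun v => ?_)
      simp
      ring_nf
    apply h2.bdd_mul (c := 1)
    · exact Continuous.aestronglyMeasurable (by fun_prop)
    · refine ae_of_all _ fun v => ?_
      rw [show Complex.I * (x : ℂ) * v = ((v * x : ℝ) : ℂ) * Complex.I by push_cast; ring,
        Complex.norm_exp_ofReal_mul_I]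
  have h3 := integral_re hint
  simp only [RCLike.re_to_complex] at h3
  rw [h3, fourierIntegral_gaussian (by norm_num)] at h1
  have e2 : ((Real.pi : ℂ) / (1 / 2)) ^ (1 / 2 : ℂ) * Complex.exp (-(x : ℂ) ^ 2 / (4 * (1 / 2))) =
      ((Real.sqrt (2 * Real.pi) * Real.exp (-x ^ 2 / 2) : ℝ) : ℂ) := by
    rw [Real.sqrt_eq_rpow, Complex.ofReal_mul, Complex.ofReal_cpow (by positivity)]
    push_cast
    congr 2 <;> ring
  rw [e2, Complex.ofReal_re] at h1
  linarith

theorem abs_sin_mul_div_le (x v : ℝ) : |Real.sin (v * x) / v| ≤ |x| := by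
  rcases eq_or_ne v 0 with rfl | hv
  · simp
  · rw [abs_div, div_le_iff₀ (abs_pos.2 hv), mul_comm, ← abs_mul]
    exact Real.abs_sin_le_abs

theorem integrableOn_sin_div_mul_exp (x : ℝ) :
    Integrable (fun v => Real.sin (v * x) / v * Real.exp (-v ^ 2 / 2)) := by
  apply integrable_exp_neg_sq_div_two.bdd_mul (c := |x|)
  · exact Measurable.aestronglyMeasurable (by fun_prop)
  · exact ae_of_all _ fun v => abs_sin_mul_div_le x v

theorem normalCdf_eq_integral (x : ℝ) :
    normalCdf x = 1 / 2 + 1 / Real.pi *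
      ∫ v in Set.Ioi (0:ℝ), Real.sin (v * x) / v * Real.exp (-v ^ 2 / 2) := by
  have hd : ∀ x : ℝ, HasDerivAt (fun x => ∫ v in Set.Ioi (0:ℝ),
      Real.sin (v * x) / v * Real.exp (-v ^ 2 / 2))
      (Real.sqrt (2 * Real.pi) / 2 * Real.exp (-x ^ 2 / 2)) x := by
    intro x
    rw [← integral_cos_mul_exp_neg_sq]
    refine (hasDerivAt_integral_of_dominated_loc_of_deriv_le (s := Set.univ) (x₀ := x)
      (F := fun x v => Real.sin (v * x) / v * Real.exp (-v ^ 2 / 2))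
      (F' := fun x v => Real.cos (v * x) * Real.exp (-v ^ 2 / 2))
      (μ := volume.restrict (Set.Ioi 0)) (bound := fun v => Real.exp (-v ^ 2 / 2)) Filter.univ_mem ?_ ?_ ?_ ?_ ?_ ?_).2
    · exact Eventually.of_forall fun y => (integrableOn_sin_div_mul_exp y).integrableOn.1
    · exact (integrableOn_sin_div_mul_exp x).integrableOn
    · exact Continuous.aestronglyMeasurable (by fun_prop)
    · refine ae_of_all _ fun v y _ => ?_
      rw [norm_mul, Real.norm_eq_abs, Real.norm_eq_abs, Real.abs_exp]
      exact mul_le_of_le_one_left (Real.exp_pos _).le (Real.abs_cos_le_one _)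
    · exact integrable_exp_neg_sq_div_two.integrableOn
    · refine (ae_restrict_iff' measurableSet_Ioi).2 (ae_of_all _ fun v hv y _ => ?_)
      have hv' : v ≠ 0 := ne_of_gt hv
      have h1 : HasDerivAt (fun y => v * y) v y := by
        simpa using (hasDerivAt_id y).const_mul v
      refine ((h1.sin.div_const v).mul_const _).congr_deriv ?_
      field_simp
  have hD : ∀ x : ℝ, HasDerivAt (fun x => normalCdf x - 1 / Real.pi * ∫ v in Set.Ioi (0:ℝ),
      Real.sin (v * x) / v * Real.exp (-v ^ 2 / 2)) 0 x := by
    intro x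
    refine ((hasDerivAt_normalCdf x).sub ((hd x).const_mul _)).congr_deriv ?_
    have hp := Real.pi_pos
    have h2 : Real.sqrt (2 * Real.pi) ^ 2 = 2 * Real.pi := Real.sq_sqrt (by positivity)
    have h3 : 0 < Real.sqrt (2 * Real.pi) := by positivity
    field_simp
    rw [h2]; ring
  have := is_const_of_deriv_eq_zero (fun x => (hD x).differentiableAt) (fun x => (hD x).deriv) x 0
  simp [normalCdf_zero] at this
  rw [← one_div, ← one_div] at this
  linarith

theorem abs_add_mul_le_sqrt (a b p q : ℝ) :
    |b * q + a * p| ≤ Real.sqrt (a ^ 2 + b ^ 2) * Real.sqrt (p ^ 2 + q ^ 2) := by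
  rw [← Real.sqrt_mul (by positivity)]
  apply Real.abs_le_sqrt
  nlinarith [sq_nonneg (a * q - b * p)]

theorem integral_sinc_sq_comp (ρ : Measure ℝ) [IsProbabilityMeasure ρ] (x T : ℝ) :
    IntegrableOn (fun u => (1 - u) * ∫ y, Real.cos (u * T * (x - y)) ∂ρ) (Set.Ioc 0 1) ∧
    ∫ y, Real.sinc (Real.pi * ((x - y) * T / (2 * Real.pi))) ^ 2 ∂ρ =
      2 * ∫ u in Set.Ioc (0:ℝ) 1, (1 - u) * ∫ y, Real.cos (u * T * (x - y)) ∂ρ := by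
  have hp := Real.pi_pos
  have e : ∀ y u : ℝ, 2 * Real.pi * u * ((x - y) * T / (2 * Real.pi)) = u * T * (x - y) := by
    intro y u; field_simp
  have hint : Integrable (Function.uncurry fun y u : ℝ => (1 - u) * Real.cos (u * T * (x - y)))
      (ρ.prod (volume.restrict (Set.Ioc 0 1))) := by
    apply Integrable.of_bound (C := 1)
    · exact Continuous.aestronglyMeasurable (by fun_prop)
    · have : ∀ᵐ z : ℝ × ℝ ∂(ρ.prod (volume.restrict (Set.Ioc 0 1))), z.2 ∈ Set.Ioc (0:ℝ) 1 :=
        Measure.quasiMeasurePreserving_snd.ae (ae_restrict_mem measurableSet_Ioc)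
      filter_upwards [this] with z hz
      simp only [Function.uncurry, norm_mul, Real.norm_eq_abs]
      rw [abs_of_nonneg (by linarith [hz.2])]
      exact mul_le_one₀ (by linarith [hz.1]) (abs_nonneg _) (Real.abs_cos_le_one _)
  constructor
  · have := hint.integral_prod_right
    simpa only [Function.uncurry, integral_const_mul] using! this
  · simp only [sinc_sq_eq_integral, e, intervalIntegral.integral_of_le zero_le_one]
    rw [integral_const_mul, integral_integral_swap hint]
    simp only [integral_const_mul]

theorem integral_vaalerSign_comp (ρ : Measure ℝ) [IsProbabilityMeasure ρ]
    (hρ : Integrable (fun y => y) ρ) (x T : ℝ) :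
    IntegrableOn (fun u => vaalerCoeff u * ∫ y, Real.sin (u * T * (x - y)) ∂ρ) (Set.Ioc 0 1) ∧
    Integrable (fun y => vaalerSign ((x - y) * T / (2 * Real.pi))) ρ ∧
    ∫ y, vaalerSign ((x - y) * T / (2 * Real.pi)) ∂ρ =
      2 * ∫ u in Set.Ioc (0:ℝ) 1, vaalerCoeff u * ∫ y, Real.sin (u * T * (x - y)) ∂ρ := by
  have hp := Real.pi_pos
  have e : ∀ y u : ℝ, 2 * Real.pi * u * ((x - y) * T / (2 * Real.pi)) = u * T * (x - y) := by
    intro y u; field_simp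
  have hint : Integrable (Function.uncurry fun y u : ℝ =>
      vaalerCoeff u * Real.sin (u * T * (x - y)))
      (ρ.prod (volume.restrict (Set.Ioc 0 1))) := by
    have hg : Integrable (fun y => 2 * |(x - y) * T / (2 * Real.pi)|) ρ :=
      ((((integrable_const x).sub hρ).mul_const T).div_const _).abs.const_mul 2
    refine (hg.comp_fst (volume.restrict (Set.Ioc 0 1))).mono' ?_ ?_
    · exact ((measurable_vaalerCoeff.comp measurable_snd).mul
        (by fun_prop)).aestronglyMeasurable
    · have : ∀ᵐ z : ℝ × ℝ ∂(ρ.prod (volume.restrict (Set.Ioc 0 1))), z.2 ∈ Set.Ioc (0:ℝ) 1 :=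
        Measure.quasiMeasurePreserving_snd.ae (ae_restrict_mem measurableSet_Ioc)
      filter_upwards [this] with z hz
      have := abs_vaalerCoeff_mul_sin_le hz.1 hz.2 ((x - z.1) * T / (2 * Real.pi))
      rw [e] at this
      exact this
  refine ⟨?_, ?_, ?_⟩
  · have := hint.integral_prod_right
    simpa only [Function.uncurry, integral_const_mul] using! this
  · simp only [vaalerSign, e]
    exact hint.integral_prod_left.const_mul 2
  · simp only [vaalerSign, e]
    rw [integral_const_mul, integral_integral_swap hint]
    simp only [integral_const_mul]

theorem abs_cdf_sub_half_le (ρ : Measure ℝ) [IsProbabilityMeasure ρ]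
    (hρ : Integrable (fun y => y) ρ) (x : ℝ) {T : ℝ} (hT : 0 < T) :
    |ρ.real (Set.Iic x) - 1 / 2 -
      ∫ u in Set.Ioc (0:ℝ) 1, vaalerCoeff u * ∫ y, Real.sin (u * T * (x - y)) ∂ρ| ≤
      ∫ u in Set.Ioc (0:ℝ) 1, (1 - u) * ∫ y, Real.cos (u * T * (x - y)) ∂ρ := by
  have hp := Real.pi_pos
  obtain ⟨-, h1⟩ := integral_sinc_sq_comp ρ x T
  obtain ⟨-, hi, h2⟩ := integral_vaalerSign_comp ρ hρ x T
  have hs : Integrable (fun y => Real.sinc (Real.pi * ((x - y) * T / (2 * Real.pi))) ^ 2) ρ := by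
    apply Integrable.of_bound (C := 1)
    · exact Continuous.aestronglyMeasurable
        ((Real.continuous_sinc.comp (by fun_prop)).pow 2)
    · refine ae_of_all _ fun y => ?_
      rw [Real.norm_eq_abs, abs_pow]
      exact pow_le_one₀ (abs_nonneg _) (Real.abs_sinc_le_one _)
  have hF : ρ.real (Set.Iic x) =
      ∫ y, (if 0 ≤ (x - y) * T / (2 * Real.pi) then (1:ℝ) else 0) ∂ρ := by
    rw [← integral_indicator_one measurableSet_Iic]
    congr 1
    funext y
    have : 0 ≤ (x - y) * T / (2 * Real.pi) ↔ y ∈ Set.Iic x := by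
      rw [mul_div_assoc, mul_nonneg_iff_of_pos_right (by positivity), sub_nonneg, Set.mem_Iic]
    simp only [this, Set.indicator_apply, Pi.one_apply]
  have hii : Integrable (fun y => (if 0 ≤ (x - y) * T / (2 * Real.pi) then (1:ℝ) else 0)) ρ := by
    apply Integrable.of_bound (C := 1)
    · apply Measurable.aestronglyMeasurable
      apply Measurable.ite _ measurable_const measurable_const
      exact measurableSet_le measurable_const (by fun_prop)
    · refine ae_of_all _ fun y => ?_
      split_ifs <;> simp
  have h1i : Integrable (fun y => 1 + vaalerSign ((x - y) * T / (2 * Real.pi))) ρ :=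
    (integrable_const 1).add hi
  have hup := integral_mono hii (g := fun y => (1 + vaalerSign ((x - y) * T / (2 * Real.pi)) +
    Real.sinc (Real.pi * ((x - y) * T / (2 * Real.pi))) ^ 2) / 2) ((h1i.add hs).div_const 2)
    (fun y => indicator_le_vaaler _)
  have hlo := integral_mono (f := fun y => (1 + vaalerSign ((x - y) * T / (2 * Real.pi)) -
    Real.sinc (Real.pi * ((x - y) * T / (2 * Real.pi))) ^ 2) / 2) ((h1i.sub hs).div_const 2) hii
    (fun y => vaaler_le_indicator _)
  rw [← hF, integral_div, integral_add h1i hs, integral_add (integrable_const 1) hi, h1, h2] at hup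
  rw [← hF, integral_div, integral_sub h1i hs, integral_add (integrable_const 1) hi, h1, h2] at hlo
  simp at hup hlo
  rw [abs_le]
  constructor <;> linarith

theorem norm_charFun_sub_eq (ρ : Measure ℝ) [IsProbabilityMeasure ρ] (x T u g : ℝ) :
    Real.sqrt ((∫ y, Real.cos (u * T * (x - y)) ∂ρ - Real.cos (u * T * x) * g) ^ 2 +
      (∫ y, Real.sin (u * T * (x - y)) ∂ρ - Real.sin (u * T * x) * g) ^ 2) =
      ‖charFun ρ (T * u) - g‖ := by
  have hint : Integrable (fun y : ℝ => Complex.exp ((u * T * (x - y) : ℝ) * Complex.I)) ρ := by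
    apply Integrable.of_bound (C := 1)
    · exact Continuous.aestronglyMeasurable (by fun_prop)
    · exact ae_of_all _ fun y => (Complex.norm_exp_ofReal_mul_I _).le
  have hre := integral_re hint
  have him := integral_im hint
  simp only [RCLike.re_to_complex, RCLike.im_to_complex, Complex.exp_ofReal_mul_I_re,
    Complex.exp_ofReal_mul_I_im] at hre him
  have e : ∫ y : ℝ, Complex.exp ((u * T * (x - y) : ℝ) * Complex.I) ∂ρ =
      Complex.exp ((u * T * x : ℝ) * Complex.I) * (starRingEnd ℂ) (charFun ρ (T * u)) := by
    rw [← charFun_neg, charFun_apply_real, ← integral_const_mul]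
    congr 1
    funext y
    rw [← Complex.exp_add]
    congr 1
    push_cast
    ring
  have e2 : ‖charFun ρ (T * u) - g‖ = ‖Complex.exp ((u * T * x : ℝ) * Complex.I) *
      ((starRingEnd ℂ) (charFun ρ (T * u)) - g)‖ := by
    rw [norm_mul, Complex.norm_exp_ofReal_mul_I, one_mul, ← Complex.norm_conj]
    simp
  rw [e2, mul_sub, ← e, Complex.norm_eq_sqrt_sq_add_sq, hre, him]
  simp only [Complex.sub_re, Complex.sub_im, Complex.re_mul_ofReal, Complex.im_mul_ofReal,
    Complex.exp_ofReal_mul_I_re, Complex.exp_ofReal_mul_I_im]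

theorem normalCdf_split (x : ℝ) {T : ℝ} (hT : 0 < T) :
    IntegrableOn (fun u => Real.sin (u * T * x) * Real.exp (-(T * u) ^ 2 / 2) / (Real.pi * u))
      (Set.Ioc 0 1) ∧
    |normalCdf x - 1 / 2 - ∫ u in Set.Ioc (0:ℝ) 1,
      Real.sin (u * T * x) * Real.exp (-(T * u) ^ 2 / 2) / (Real.pi * u)| ≤
      1 / Real.pi * ∫ v in Set.Ioi T, Real.exp (-v ^ 2 / 2) / v := by
  have hp := Real.pi_pos
  have hi := integrableOn_sin_div_mul_exp x
  have hcomp := (hi.intervalIntegrable (a := 0) (b := T)).comp_mul_left (c := T)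
  have e : ∀ u : ℝ, Real.sin (u * T * x) * Real.exp (-(T * u) ^ 2 / 2) / (Real.pi * u) =
      T / Real.pi * (Real.sin (T * u * x) / (T * u) * Real.exp (-(T * u) ^ 2 / 2)) := by
    intro u
    rcases eq_or_ne u 0 with rfl | hu
    · simp
    rw [show u * T * x = T * u * x by ring]
    field_simp
  constructor
  · rw [zero_div, div_self hT.ne'] at hcomp
    have := (hcomp.const_mul (T / Real.pi)).1
    refine this.congr (ae_of_all _ fun u => (e u).symm)
  · simp only [e]
    rw [integral_const_mul, ← intervalIntegral.integral_of_le zero_le_one,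
      intervalIntegral.integral_comp_mul_left
        (fun u => Real.sin (u * x) / u * Real.exp (-u ^ 2 / 2)) hT.ne', normalCdf_eq_integral,
      ← intervalIntegral.integral_interval_add_Ioi (b := T) hi.integrableOn hi.integrableOn]
    simp only [mul_zero, mul_one, smul_eq_mul]
    have e2 : ∀ A B : ℝ, 1 / 2 + 1 / Real.pi * (A + B) - 1 / 2 - T / Real.pi * (T⁻¹ * A) =
        1 / Real.pi * B := by intro A B; field_simp; ring
    rw [e2, abs_mul, abs_of_pos (by positivity)]
    apply mul_le_mul_of_nonneg_left _ (by positivity)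
    rw [← Real.norm_eq_abs]
    apply norm_integral_le_of_norm_le
    · have hT1 : IntegrableOn (fun v => T⁻¹ * Real.exp (-v ^ 2 / 2)) (Set.Ioi T) :=
        (integrable_exp_neg_sq_div_two.const_mul _).integrableOn
      refine hT1.mono' (Measurable.aestronglyMeasurable (by fun_prop)) ?_
      refine (ae_restrict_iff' measurableSet_Ioi).2 (ae_of_all _ fun v hv => ?_)
      have hv0 : 0 < v := hT.trans hv
      rw [Real.norm_eq_abs, abs_of_pos (by positivity), div_eq_inv_mul]
      have : v⁻¹ ≤ T⁻¹ := by gcongr; exact le_of_lt hv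
      gcongr
    · refine (ae_restrict_iff' measurableSet_Ioi).2 (ae_of_all _ fun v hv => ?_)
      have hv0 : 0 < v := hT.trans hv
      rw [Real.norm_eq_abs, abs_mul, abs_div, abs_of_pos hv0, Real.abs_exp, div_mul_eq_mul_div]
      gcongr
      exact mul_le_of_le_one_left (Real.exp_pos _).le (Real.abs_sin_le_one _)

/-- Prawitz's smoothing inequality, with explicit bounds for its kernels. -/
theorem prawitz_smoothing (ρ : Measure ℝ) [IsProbabilityMeasure ρ]
    (hρ : Integrable (fun y => y) ρ) (x : ℝ) {T : ℝ} (hT : 0 < T) {D : ℝ → ℝ}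
    (hD : ∀ u ∈ Set.Ioc (0:ℝ) 1, ‖charFun ρ (T * u) - (Real.exp (-(T * u) ^ 2 / 2) : ℝ)‖ ≤ D u)
    (hDi : IntegrableOn (fun u => D u / u) (Set.Ioc 0 1)) :
    |ρ.real (Set.Iic x) - normalCdf x| ≤
      (1.035 / Real.pi * ∫ u in Set.Ioc (0:ℝ) 1, D u / u) +
      (∫ u in Set.Ioc (0:ℝ) 1, (1 - u + 1.05 * u ^ 2) * Real.exp (-(T * u) ^ 2 / 2)) +
      1 / Real.pi * ∫ v in Set.Ioi T, Real.exp (-v ^ 2 / 2) / v := by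
  have hp := Real.pi_pos
  obtain ⟨hCi, -⟩ := integral_sinc_sq_comp ρ x T
  obtain ⟨hSi, -, -⟩ := integral_vaalerSign_comp ρ hρ x T
  obtain ⟨hsi, hN⟩ := normalCdf_split x hT
  have hF := abs_cdf_sub_half_le ρ hρ x hT
  set C : ℝ → ℝ := fun u => ∫ y, Real.cos (u * T * (x - y)) ∂ρ with hC
  set S : ℝ → ℝ := fun u => ∫ y, Real.sin (u * T * (x - y)) ∂ρ with hS
  set g : ℝ → ℝ := fun u => Real.exp (-(T * u) ^ 2 / 2) with hg
  have hgi : IntegrableOn (fun u => (1 - u + 1.05 * u ^ 2) * g u) (Set.Ioc 0 1) :=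
    Continuous.integrableOn_Ioc (by fun_prop)
  have key : ∀ ε : ℝ, ε ^ 2 = 1 →
      |(∫ u in Set.Ioc (0:ℝ) 1, vaalerCoeff u * S u) -
        (∫ u in Set.Ioc (0:ℝ) 1, Real.sin (u * T * x) * g u / (Real.pi * u)) +
        ε * ∫ u in Set.Ioc (0:ℝ) 1, (1 - u) * C u| ≤
      (1.035 / Real.pi * ∫ u in Set.Ioc (0:ℝ) 1, D u / u) +
      (∫ u in Set.Ioc (0:ℝ) 1, (1 - u + 1.05 * u ^ 2) * g u) := by
    intro ε hε
    have hSs : IntegrableOn (fun u => vaalerCoeff u * S u -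
        Real.sin (u * T * x) * g u / (Real.pi * u)) (Set.Ioc 0 1) := hSi.sub hsi
    have hCe : IntegrableOn (fun u => ε * ((1 - u) * C u)) (Set.Ioc 0 1) := hCi.const_mul ε
    rw [← integral_sub hSi hsi, ← integral_const_mul, ← integral_add hSs hCe,
      ← integral_const_mul, ← integral_add (hDi.const_mul _) hgi,
      ← Real.norm_eq_abs]
    apply norm_integral_le_of_norm_le ((hDi.const_mul _).add hgi)
    refine (ae_restrict_iff' measurableSet_Ioc).2 (ae_of_all _ fun u hu => ?_)
    have hu0 := hu.1
    have hg0 : 0 < g u := Real.exp_pos _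
    rw [Real.norm_eq_abs]
    have e : vaalerCoeff u * S u - Real.sin (u * T * x) * g u / (Real.pi * u) +
        ε * ((1 - u) * C u) =
        (vaalerCoeff u * (S u - Real.sin (u * T * x) * g u) +
          (ε * (1 - u)) * (C u - Real.cos (u * T * x) * g u)) +
        ((vaalerCoeff u - 1 / (Real.pi * u)) * (Real.sin (u * T * x) * g u) +
          (ε * (1 - u)) * (Real.cos (u * T * x) * g u)) := by
      field_simp
      ring
    rw [e]
    refine (abs_add_le _ _).trans (add_le_add ?_ ?_)
    · refine (abs_add_mul_le_sqrt _ _ _ _).trans ?_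
      rw [norm_charFun_sub_eq, mul_pow, hε, one_mul]
      have h1 : Real.sqrt ((1 - u) ^ 2 + (vaalerCoeff u) ^ 2) ≤ 1.035 / (Real.pi * u) := by
        rcases hu.2.lt_or_eq with h | rfl
        · exact sqrt_vaaler_le hu0 h
        · simp [vaalerCoeff, Real.sqrt_sq, hp.le]
          rw [← one_div]
          gcongr
          norm_num
      calc _ ≤ 1.035 / (Real.pi * u) * D u :=
            mul_le_mul h1 (hD u hu) (norm_nonneg _) (by positivity)
        _ = _ := by ring
    · refine (abs_add_mul_le_sqrt _ _ _ _).trans ?_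
      have h2 : Real.sqrt ((Real.cos (u * T * x) * g u) ^ 2 + (Real.sin (u * T * x) * g u) ^ 2) =
          g u := by
        rw [mul_pow, mul_pow, ← add_mul, Real.cos_sq_add_sin_sq, one_mul, Real.sqrt_sq hg0.le]
      rw [h2, mul_pow, hε, one_mul]
      apply mul_le_mul_of_nonneg_right _ hg0.le
      rcases hu.2.lt_or_eq with h | rfl
      · exact sqrt_vaaler_error_le hu0 h
      · simp [vaalerCoeff]
        norm_num
  have k1 := abs_le.1 (key 1 (by norm_num))
  have k2 := abs_le.1 (key (-1) (by norm_num))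
  have hN' := abs_le.1 hN
  have hF' := abs_le.1 hF
  rw [abs_le]
  constructor <;> linarith

/-- `ρ` is a centred law of unit variance satisfying the Mecke-type identity
`∫ y g(y) dρ = ∫∫ (g (y + x) - g y) dρ(y) dη(x)` with respect to a finite measure `η` on the
nonnegative half line with moments `1` and `L`. -/
structure IsCenteredShot (η ρ : Measure ℝ) (L : ℝ) : Prop where
  nonneg : ∀ᵐ x ∂η, 0 ≤ x
  integrable_id : Integrable (fun x => x) η
  integrable_sq : Integrable (fun x => x ^ 2) η
  integral_id : ∫ x, x ∂η = 1
  integral_sq : ∫ x, x ^ 2 ∂η = L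
  integrable_sq_law : Integrable (fun y => y ^ 2) ρ
  integral_sq_law : ∫ y, y ^ 2 ∂ρ = 1
  mecke : ∀ g : ℝ → ℝ, Measurable g → (∃ C, ∀ y, |g y| ≤ C) →
    ∫ y, y * g y ∂ρ = ∫ x, ∫ y, (g (y + x) - g y) ∂ρ ∂η

namespace IsCenteredShot

variable {η ρ : Measure ℝ} [IsFiniteMeasure η] [IsProbabilityMeasure ρ] {L : ℝ}

theorem integrable_law (h : IsCenteredShot η ρ L) : Integrable (fun y => y) ρ := by
  refine Integrable.mono' (h.integrable_sq_law.add (integrable_const 1)) (by fun_prop) ?_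
  filter_upwards with y
  simp only [Pi.add_apply, Real.norm_eq_abs]
  rcases abs_cases y with ⟨h1, _⟩ | ⟨h1, _⟩ <;> rw [h1] <;> nlinarith [sq_nonneg (y-1), sq_nonneg (y+1)]

theorem integral_law (h : IsCenteredShot η ρ L) : ∫ y, y ∂ρ = 0 := by
  have := h.mecke (fun _ => 1) measurable_const ⟨1, by simp⟩
  simpa using this

theorem pos (h : IsCenteredShot η ρ L) : 0 < L := by
  rw [← h.integral_sq]
  refine lt_of_le_of_ne (integral_nonneg fun x => sq_nonneg x) fun h0 => ?_
  have h1 := (integral_eq_zero_iff_of_nonneg (fun x => sq_nonneg x) h.integrable_sq).1 h0.symm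
  have h2 : ∫ x, x ∂η = ∫ x, (0:ℝ) ∂η := integral_congr_ae (by
    filter_upwards [h1] with x hx
    simpa using hx)
  rw [h.integral_id] at h2
  simp at h2

theorem mecke_cexp (h : IsCenteredShot η ρ L) (u : ℝ) :
    ∫ y, (y : ℂ) * Complex.exp (u * y * Complex.I) ∂ρ =
      charFun ρ u * ∫ x, (Complex.exp (u * x * Complex.I) - 1) ∂η := by
  have hi := h.integrable_law
  have hc := h.mecke (fun y => Real.cos (u * y)) (by fun_prop) ⟨1, fun y => Real.abs_cos_le_one _⟩
  have hs := h.mecke (fun y => Real.sin (u * y)) (by fun_prop) ⟨1, fun y => Real.abs_sin_le_one _⟩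
  have ie : ∀ (ξ : Measure ℝ) [IsFiniteMeasure ξ], Integrable (fun y : ℝ => Complex.exp (u * y * Complex.I)) ξ := by
    intro ξ _
    refine Integrable.of_bound (by fun_prop) 1 (ae_of_all _ fun y => ?_)
    rw [← Complex.ofReal_mul, Complex.norm_exp_ofReal_mul_I]
  have iy : Integrable (fun y : ℝ => (y : ℂ) * Complex.exp (u * y * Complex.I)) ρ := by
    refine Integrable.mono (g := fun y : ℝ => y) hi (by fun_prop) (ae_of_all _ fun y => ?_)
    rw [norm_mul, ← Complex.ofReal_mul, Complex.norm_exp_ofReal_mul_I]; simp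
  have hx : ∀ x : ℝ, ∫ y : ℝ, (Complex.exp (u * (y + x : ℝ) * Complex.I) - Complex.exp (u * y * Complex.I)) ∂ρ
      = charFun ρ u * (Complex.exp (u * x * Complex.I) - 1) := by
    intro x
    rw [charFun_apply_real, ← integral_mul_const]
    congr 1; ext y
    rw [mul_sub, ← Complex.exp_add]; push_cast; ring_nf
  have id : ∀ x : ℝ, Integrable (fun y : ℝ => Complex.exp (u * (y + x : ℝ) * Complex.I) - Complex.exp (u * y * Complex.I)) ρ := by
    intro x
    refine Integrable.sub ?_ (ie ρ)
    refine Integrable.of_bound (by fun_prop) 1 (ae_of_all _ fun y => ?_)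
    rw [← Complex.ofReal_mul, Complex.norm_exp_ofReal_mul_I]
  have id2 : Integrable (fun x : ℝ => ∫ y : ℝ, (Complex.exp (u * (y + x : ℝ) * Complex.I) - Complex.exp (u * y * Complex.I)) ∂ρ) η := by
    simp_rw [hx]
    exact ((ie η).sub (integrable_const 1)).const_mul _
  have key : ∫ y, (y : ℂ) * Complex.exp (u * y * Complex.I) ∂ρ =
      ∫ x, ∫ y : ℝ, (Complex.exp (u * (y + x : ℝ) * Complex.I) - Complex.exp (u * y * Complex.I)) ∂ρ ∂η := by
    have hre : ∀ z : ℝ, (Complex.exp (u * z * Complex.I)).re = Real.cos (u * z) := by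
      intro z; rw [← Complex.ofReal_mul, Complex.exp_ofReal_mul_I_re]
    have him : ∀ z : ℝ, (Complex.exp (u * z * Complex.I)).im = Real.sin (u * z) := by
      intro z; rw [← Complex.ofReal_mul, Complex.exp_ofReal_mul_I_im]
    apply Complex.ext
    · have e1 := integral_re iy
      have e2 := integral_re id2
      simp only [RCLike.re_eq_complex_re] at e1 e2
      rw [← e1, ← e2]
      simp only [Complex.re_ofReal_mul, hre]
      rw [hc]
      congr 1; ext x
      have e3 := integral_re (id x)
      simp only [RCLike.re_eq_complex_re] at e3
      rw [← e3]
      simp only [Complex.sub_re, hre]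
    · have e1 := integral_im iy
      have e2 := integral_im id2
      simp only [RCLike.im_eq_complex_im] at e1 e2
      rw [← e1, ← e2]
      simp only [Complex.im_ofReal_mul, him]
      rw [hs]
      congr 1; ext x
      have e3 := integral_im (id x)
      simp only [RCLike.im_eq_complex_im] at e3
      rw [← e3]
      simp only [Complex.sub_im, him]
  rw [key]
  simp_rw [hx]
  rw [integral_const_mul]

end IsCenteredShot

theorem cos_le_one_sub_add_pow_four {t : ℝ} (ht : 0 ≤ t) :
    Real.cos t ≤ 1 - t ^ 2 / 2 + t ^ 4 / 24 := by
  have hd : ∀ s : ℝ, HasDerivAt (fun s => 1 - s ^ 2 / 2 + s ^ 4 / 24 - Real.cos s)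
      (-s + s ^ 3 / 6 + Real.sin s) s := fun s =>
    ((((hasDerivAt_pow 2 s).div_const 2).const_sub 1).add ((hasDerivAt_pow 4 s).div_const 24)
      |>.sub (Real.hasDerivAt_cos s)).congr_deriv (by norm_num; ring)
  have hm : MonotoneOn (fun s => 1 - s ^ 2 / 2 + s ^ 4 / 24 - Real.cos s) (Set.Ici 0) := by
    refine monotoneOn_of_deriv_nonneg (convex_Ici 0)
      (fun s _ => (hd s).continuousAt.continuousWithinAt)
      (fun s _ => (hd s).differentiableAt.differentiableWithinAt) fun s hs => ?_
    rw [interior_Ici, Set.mem_Ioi] at hs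
    rw [(hd s).deriv]
    linarith [Real.sin_ge_sub_cube hs.le]
  have := hm Set.self_mem_Ici ht ht
  simp at this
  linarith

theorem cos_sub_one_add_sq_le {t : ℝ} (ht : 0 ≤ t) :
    Real.cos t - 1 + t ^ 2 / 2 ≤ t ^ 3 / 10 := by
  rcases le_total t 2.4 with h | h
  · have := cos_le_one_sub_add_pow_four ht
    nlinarith [pow_nonneg ht 3]
  · have h1 := Real.one_sub_sq_div_two_le_cos (x := t - Real.pi)
    rw [Real.cos_sub_pi] at h1
    have h2 := Real.pi_gt_d4
    have h3 := Real.pi_lt_d4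
    have h4 : Real.pi ^ 2 ≤ 3.1416 ^ 2 := by gcongr
    have h5 : 0 ≤ (t - 1.734) * (t - 4.133) ^ 2 := by
      have : 0 ≤ t - 1.734 := by linarith
      positivity
    nlinarith [mul_le_mul_of_nonneg_right h2.le ht]

theorem norm_cexp_ofReal_mul_I_sub_one_sub (t : ℝ) :
    ‖Complex.exp (t * Complex.I) - 1 - t * Complex.I‖ ≤ t ^ 2 / 2 := by
  have key : ∀ s : ℝ, 0 ≤ s → ∀ e : ℝ, |e| = 1 →
      ‖Complex.exp ((e * s : ℝ) * Complex.I) - 1 - (e * s : ℝ) * Complex.I‖ ≤ s ^ 2 / 2 := by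
    intro s hs e he
    have hd : ∀ x : ℝ, HasDerivAt
        (fun x : ℝ => Complex.exp ((e * x : ℝ) * Complex.I) - 1 - (e * x : ℝ) * Complex.I)
        (e * Complex.I * (Complex.exp ((e * x : ℝ) * Complex.I) - 1)) x := by
      intro x
      have h1 : HasDerivAt (fun x : ℝ => ((e * x : ℝ) : ℂ) * Complex.I) (e * Complex.I) x := by
        have := (((hasDerivAt_id x).const_mul e).ofReal_comp).mul_const Complex.I
        simpa using this
      exact ((h1.cexp.sub_const 1).sub h1).congr_deriv (by ring)
    refine image_norm_le_of_norm_deriv_right_le_deriv_boundary (a := 0) (b := s)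
      (fun x _ => (hd x).continuousAt.continuousWithinAt)
      (fun x _ => (hd x).hasDerivWithinAt) (B := fun x => x ^ 2 / 2) (B' := fun x => x) (by simp)
      (fun x => ((hasDerivAt_pow 2 x).div_const 2).congr_deriv (by simp)) (fun x hx => ?_) ⟨hs, le_rfl⟩
    rw [norm_mul, norm_mul, Complex.norm_real, Complex.norm_I, Real.norm_eq_abs, he, mul_comm _ Complex.I]
    have := Real.norm_exp_I_mul_ofReal_sub_one_le (x := e * x)
    rw [Real.norm_eq_abs, abs_mul, he, abs_of_nonneg hx.1] at this
    linarith
  rcases le_total 0 t with h | h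
  · simpa using key t h 1 (by simp)
  · simpa using key (-t) (by linarith) (-1) (by simp)

theorem hasDerivAt_charFun_real {ρ : Measure ℝ} [IsProbabilityMeasure ρ]
    (h : Integrable (fun y => y) ρ) (u : ℝ) :
    HasDerivAt (charFun ρ) (Complex.I * ∫ y, (y : ℂ) * Complex.exp (u * y * Complex.I) ∂ρ) u := by
  have e : charFun ρ = fun u : ℝ => ∫ y : ℝ, Complex.exp (u * y * Complex.I) ∂ρ := by
    ext u; rw [charFun_apply_real]
  rw [e, ← integral_const_mul]
  refine (hasDerivAt_integral_of_dominated_loc_of_deriv_le (μ := ρ)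
    (F := fun (u : ℝ) (y : ℝ) => Complex.exp (u * y * Complex.I))
    (F' := fun u y => Complex.I * ((y : ℂ) * Complex.exp (u * y * Complex.I))) (x₀ := u)
    (bound := fun y => |y|) (s := Set.univ) univ_mem
    (Eventually.of_forall fun u => by fun_prop) ?_ (by fun_prop) (ae_of_all _ fun y u _ => ?_)
    h.abs (ae_of_all _ fun y u _ => ?_)).2
  · refine Integrable.of_bound (by fun_prop) 1 (ae_of_all _ fun y => ?_)
    rw [← Complex.ofReal_mul, Complex.norm_exp_ofReal_mul_I]
  · rw [norm_mul, norm_mul, ← Complex.ofReal_mul, Complex.norm_exp_ofReal_mul_I]; simp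
  · have h1 : HasDerivAt (fun x : ℝ => (x : ℂ) * y * Complex.I) (y * Complex.I) u := by
      have := (((hasDerivAt_id u).ofReal_comp).mul_const (y:ℂ)).mul_const Complex.I
      simpa using this
    exact h1.cexp.congr_deriv (by ring)

namespace IsCenteredShot

variable {η ρ : Measure ℝ} [IsFiniteMeasure η] [IsProbabilityMeasure ρ] {L : ℝ}

theorem charFun_eq (h : IsCenteredShot η ρ L) (u : ℝ) :
    charFun ρ u = Complex.exp (-(u : ℂ) ^ 2 / 2 +
      ∫ v in (0:ℝ)..u, Complex.I * ∫ x, (Complex.exp (v * x * Complex.I) - 1 - v * x * Complex.I) ∂η) := by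
  have ie : ∀ v : ℝ, Integrable (fun y : ℝ => Complex.exp (v * y * Complex.I)) η := by
    intro v
    refine Integrable.of_bound (by fun_prop) 1 (ae_of_all _ fun y => ?_)
    rw [← Complex.ofReal_mul, Complex.norm_exp_ofReal_mul_I]
  have ix : Integrable (fun x : ℝ => (x : ℂ)) η := h.integrable_id.ofReal
  set w : ℝ → ℂ := fun v => Complex.I * ∫ x, (Complex.exp (v * x * Complex.I) - 1 - v * x * Complex.I) ∂η
    with hw
  have hw1 : ∀ v : ℝ, w v = v + Complex.I * ∫ x, (Complex.exp (v * x * Complex.I) - 1) ∂η := by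
    intro v
    have i1 : Integrable (fun x : ℝ => Complex.exp (v * x * Complex.I) - 1) η := (ie v).sub (integrable_const 1)
    have i2 : Integrable (fun x : ℝ => (v:ℂ) * x * Complex.I) η := (ix.const_mul _).mul_const _
    rw [hw]; beta_reduce
    rw [integral_sub i1 i2, integral_mul_const, integral_const_mul, integral_complex_ofReal, h.integral_id]
    push_cast
    linear_combination (-(v : ℂ)) * Complex.I_sq
  have hc : Continuous w := by
    have : w = fun v : ℝ => v + Complex.I * (charFun η v - η.real Set.univ) := by
      ext v
      rw [hw1, integral_sub (ie v) (integrable_const 1), charFun_apply_real]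
      simp
    rw [this]
    fun_prop
  have hd : ∀ v : ℝ, HasDerivAt (fun v : ℝ => charFun ρ v * Complex.exp ((v : ℂ) ^ 2 / 2 -
      ∫ s in (0:ℝ)..v, w s)) 0 v := by
    intro v
    have h1 := hasDerivAt_charFun_real h.integrable_law v
    rw [h.mecke_cexp] at h1
    have h2 : HasDerivAt (fun v : ℝ => ∫ s in (0:ℝ)..v, w s) (w v) v :=
      intervalIntegral.integral_hasDerivAt_right (hc.intervalIntegrable _ _)
        (hc.stronglyMeasurableAtFilter _ _) hc.continuousAt
    have h3 : HasDerivAt (fun v : ℝ => (v : ℂ) ^ 2 / 2) (v : ℂ) v := by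
      have := (((hasDerivAt_id v).ofReal_comp).pow 2).div_const 2
      exact this.congr_deriv (by simp)
    refine (h1.mul (h3.sub h2).cexp).congr_deriv ?_
    simp only [Pi.sub_apply]
    rw [hw1]
    ring
  have hconst := is_const_of_deriv_eq_zero (fun v => (hd v).differentiableAt) (fun v => (hd v).deriv) u 0
  simp only [charFun_zero, Complex.ofReal_zero] at hconst
  simp at hconst
  have e : Complex.exp (-(u : ℂ) ^ 2 / 2 + ∫ v in (0:ℝ)..u, w v) =
      (Complex.exp ((u : ℂ) ^ 2 / 2 - ∫ s in (0:ℝ)..u, w s))⁻¹ := by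
    rw [← Complex.exp_neg]; congr 1; ring
  rw [e, ← one_div, eq_div_iff (Complex.exp_ne_zero _)]
  exact hconst

end IsCenteredShot

theorem exp_mul_sub_one_le {a y : ℝ} (ha : 0 ≤ a) (ha1 : a ≤ 1) :
    Real.exp (a * y) - 1 ≤ a * (Real.exp y - 1) := by
  have := convexOn_exp.2 (Set.mem_univ (0:ℝ)) (Set.mem_univ y) (sub_nonneg.2 ha1) ha (by ring)
  simp at this
  linarith

theorem exp_mul_le {a y : ℝ} (ha : 0 ≤ a) (ha1 : a ≤ 1) (hy : 0 ≤ y) :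
    Real.exp (a * y) ≤ 1 + a * y + a ^ 2 * (Real.exp y - 1 - y) := by
  have hd : ∀ s : ℝ, HasDerivAt
      (fun s => 1 + a * s + a ^ 2 * (Real.exp s - 1 - s) - Real.exp (a * s))
      (a * (a * (Real.exp s - 1) - (Real.exp (a * s) - 1))) s := fun s => by
    have h1 : HasDerivAt (fun s => a * s) a s := by simpa using (hasDerivAt_id s).const_mul a
    have h2 : HasDerivAt (fun s => Real.exp s - 1 - s) (Real.exp s - 1) s :=
      ((Real.hasDerivAt_exp s).sub_const 1).sub (hasDerivAt_id s)
    exact (((h1.const_add 1).add (h2.const_mul (a ^ 2))).sub h1.exp).congr_deriv (by ring)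
  have hm : MonotoneOn (fun s => 1 + a * s + a ^ 2 * (Real.exp s - 1 - s) - Real.exp (a * s))
      (Set.Ici 0) := by
    refine monotoneOn_of_deriv_nonneg (convex_Ici 0)
      (fun s _ => (hd s).continuousAt.continuousWithinAt)
      (fun s _ => (hd s).differentiableAt.differentiableWithinAt) fun s _ => ?_
    rw [(hd s).deriv]
    exact mul_nonneg ha (sub_nonneg.2 (exp_mul_sub_one_le ha ha1))
  have := hm Set.self_mem_Ici hy hy
  simp at this
  linarith

theorem norm_cexp_sub_one_le {z : ℂ} {a y : ℝ} (ha : 0 ≤ a) (ha1 : a ≤ 1) (hy : 0 ≤ y)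
    (hz : z.re ≤ a * y) :
    ‖Complex.exp z - 1‖ ≤ ‖z‖ * (1 + a * y / 2 + a ^ 2 * (Real.exp y - 1 - y) / 3) := by
  have hd : ∀ s : ℝ, HasDerivAt (fun s : ℝ => Complex.exp (s * z) - 1) (z * Complex.exp (s * z)) s := by
    intro s
    have h1 : HasDerivAt (fun s : ℝ => (s : ℂ) * z) z s := by
      simpa using ((hasDerivAt_id s).ofReal_comp).mul_const z
    exact (h1.cexp.sub_const 1).congr_deriv (by ring)
  have hB : ∀ s : ℝ, HasDerivAt
      (fun s : ℝ => ‖z‖ * (s + a * y * s ^ 2 / 2 + a ^ 2 * (Real.exp y - 1 - y) * s ^ 3 / 3))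
      (‖z‖ * (1 + a * y * s + a ^ 2 * (Real.exp y - 1 - y) * s ^ 2)) s := fun s =>
    (((hasDerivAt_id s).add (((hasDerivAt_pow 2 s).const_mul (a * y)).div_const 2)).add
      (((hasDerivAt_pow 3 s).const_mul (a ^ 2 * (Real.exp y - 1 - y))).div_const 3)
      |>.const_mul ‖z‖).congr_deriv (by norm_num; left; ring)
  have := image_norm_le_of_norm_deriv_right_le_deriv_boundary (a := 0) (b := 1)
      (fun x _ => (hd x).continuousAt.continuousWithinAt)
      (fun x _ => (hd x).hasDerivWithinAt) (by simp) hB (fun s hs => ?_) (Set.right_mem_Icc.2 zero_le_one)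
  · simpa using this
  · rw [norm_mul, Complex.norm_exp, Complex.re_ofReal_mul]
    have h0 := hs.1
    have h1 := hs.2.le
    have hw : 0 ≤ Real.exp y - 1 - y := by linarith [Real.add_one_le_exp y]
    have h2 : Real.exp (s * z.re) ≤ Real.exp ((s * a) * y) :=
      Real.exp_le_exp.2 (by nlinarith)
    have h3 := exp_mul_le (a := s * a) (y := y) (by positivity) (by nlinarith) hy
    gcongr
    nlinarith

namespace IsCenteredShot

variable {η ρ : Measure ℝ} [IsFiniteMeasure η] [IsProbabilityMeasure ρ] {L : ℝ}

theorem norm_charFun_sub_le (h : IsCenteredShot η ρ L) {T u : ℝ} (hT : 0 < T)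
    (hL : L = 10 / (3 * T)) (hu0 : 0 ≤ u) (hu1 : u ≤ 1) :
    ‖charFun ρ (T * u) - (Real.exp (-(T * u) ^ 2 / 2) : ℝ)‖ ≤
      Real.exp (-(T * u) ^ 2 / 2) * (L * (T * u) ^ 3 / 6 *
        (1 + u * ((T * u) ^ 2 / 3) / 2 +
          u ^ 2 * (Real.exp ((T * u) ^ 2 / 3) - 1 - (T * u) ^ 2 / 3) / 3)) := by
  set v := T * u with hv
  have hv0 : 0 ≤ v := by positivity
  have hLp := h.pos
  have ie : ∀ v : ℝ, Integrable (fun y : ℝ => Complex.exp (v * y * Complex.I)) η := by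
    intro v
    refine Integrable.of_bound (by fun_prop) 1 (ae_of_all _ fun y => ?_)
    rw [← Complex.ofReal_mul, Complex.norm_exp_ofReal_mul_I]
  have ix : Integrable (fun x : ℝ => (x : ℂ)) η := h.integrable_id.ofReal
  have ir : ∀ s : ℝ, Integrable
      (fun x : ℝ => Complex.exp (s * x * Complex.I) - 1 - s * x * Complex.I) η := fun s =>
    ((ie s).sub (integrable_const 1)).sub ((ix.const_mul (s:ℂ)).mul_const _)
  set r : ℝ → ℂ := fun s => Complex.I *
    ∫ x, (Complex.exp (s * x * Complex.I) - 1 - s * x * Complex.I) ∂η with hr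
  set R : ℂ := ∫ s in (0:ℝ)..v, r s with hR
  have hrn : ∀ s, ‖r s‖ ≤ L * s ^ 2 / 2 := by
    intro s
    rw [hr]; beta_reduce
    rw [norm_mul, Complex.norm_I, one_mul]
    refine (norm_integral_le_of_norm_le (g := fun x => s ^ 2 / 2 * x ^ 2)
      (h.integrable_sq.const_mul _) (ae_of_all _ fun x => ?_)).trans (le_of_eq ?_)
    · have := norm_cexp_ofReal_mul_I_sub_one_sub (s * x)
      push_cast at this
      refine this.trans (le_of_eq (by ring))
    · rw [integral_const_mul, h.integral_sq]; ring
  have hRn : ‖R‖ ≤ L * v ^ 3 / 6 := by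
    refine (intervalIntegral.norm_integral_le_of_norm_le hv0 (ae_of_all _ fun s _ => hrn s)
      (Continuous.intervalIntegrable (by fun_prop) _ _)).trans (le_of_eq ?_)
    rw [intervalIntegral.integral_div, intervalIntegral.integral_const_mul, integral_pow]
    norm_num; ring
  have hrre : ∀ s, (r s).re = ∫ x, (s * x - Real.sin (s * x)) ∂η := by
    intro s
    have e := integral_im (ir s)
    simp only [RCLike.im_eq_complex_im] at e
    rw [hr]; beta_reduce
    rw [Complex.I_mul_re, ← e, ← integral_neg]
    congr 1; ext x
    simp only [← Complex.ofReal_mul, Complex.sub_im, Complex.exp_ofReal_mul_I_im, Complex.one_im,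
      Complex.im_ofReal_mul, Complex.I_im]
    ring
  have hri : IntervalIntegrable r volume 0 v := by
    rw [intervalIntegrable_iff_integrableOn_Ioc_of_le hv0]
    refine Measure.integrableOn_of_bounded (M := L * v ^ 2 / 2) (by simp) ?_ ?_
    · have : StronglyMeasurable (Function.uncurry fun s x : ℝ =>
          Complex.exp (s * x * Complex.I) - 1 - s * x * Complex.I) :=
        (by fun_prop : Continuous _).stronglyMeasurable
      exact (this.integral_prod_right.const_mul _).aestronglyMeasurable
    · refine (ae_restrict_iff' measurableSet_Ioc).2 (ae_of_all _ fun s hs => (hrn s).trans ?_)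
      have := hs.1.le
      have := hs.2
      gcongr
  have hRre : R.re ≤ L * v ^ 3 / 10 := by
    have e1 : R.re = ∫ s in (0:ℝ)..v, (r s).re := by
      have := Complex.reCLM.intervalIntegral_comp_comm hri
      simpa using this.symm
    rw [e1]
    simp_rw [hrre]
    have hsw : ∫ s in (0:ℝ)..v, ∫ x, (s * x - Real.sin (s * x)) ∂η =
        ∫ x, (∫ s in (0:ℝ)..v, (s * x - Real.sin (s * x))) ∂η := by
      refine intervalIntegral_integral_swap ?_
      rw [Set.uIoc_of_le hv0]
      have i1 : Integrable (fun p : ℝ × ℝ => (v + v) * |p.2|)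
          ((volume.restrict (Set.Ioc 0 v)).prod η) :=
        (h.integrable_id.abs.comp_snd _).const_mul _
      refine i1.mono' (by unfold Function.uncurry; fun_prop) ?_
      have : ∀ᵐ p ∂((volume.restrict (Set.Ioc 0 v)).prod η), p.1 ∈ Set.Ioc 0 v := by
        exact (Measure.quasiMeasurePreserving_fst).ae (p := fun s => s ∈ Set.Ioc 0 v) (ae_restrict_mem measurableSet_Ioc)
      filter_upwards [this] with p hp
      have h1 : |p.1 * p.2| ≤ v * |p.2| := by
        rw [abs_mul, abs_of_pos hp.1]; gcongr; exact hp.2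
      have h2 := Real.abs_sin_le_abs (x := p.1 * p.2)
      simp only [Function.uncurry, Real.norm_eq_abs]
      refine (abs_sub _ _).trans ?_
      linarith
    rw [hsw]
    have hle : ∀ᵐ x ∂η, (∫ s in (0:ℝ)..v, (s * x - Real.sin (s * x))) ≤ v ^ 3 / 10 * x ^ 2 := by
      filter_upwards [h.nonneg] with x hx
      rcases hx.eq_or_lt with rfl | hx
      · simp
      have e : ∫ s in (0:ℝ)..v, (s * x - Real.sin (s * x)) =
          (Real.cos (v * x) - 1 + (v * x) ^ 2 / 2) / x := by
        have hd : ∀ s ∈ Set.uIcc 0 v, HasDerivAt (fun s => (Real.cos (s * x) - 1 + (s * x) ^ 2 / 2) / x)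
            (s * x - Real.sin (s * x)) s := fun s _ => by
          have h1 : HasDerivAt (fun s => s * x) x s := by simpa using (hasDerivAt_id s).mul_const x
          exact (((h1.cos.sub_const 1).add ((h1.pow 2).div_const 2)).div_const x).congr_deriv
            (by field_simp; ring)
        rw [intervalIntegral.integral_eq_sub_of_hasDerivAt hd
          (Continuous.intervalIntegrable (by fun_prop) _ _)]
        simp
      rw [e, div_le_iff₀ hx]
      exact (cos_sub_one_add_sq_le (by positivity)).trans (le_of_eq (by ring))
    have hge : ∀ᵐ x ∂η, 0 ≤ ∫ s in (0:ℝ)..v, (s * x - Real.sin (s * x)) := by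
      filter_upwards [h.nonneg] with x hx
      exact intervalIntegral.integral_nonneg hv0 fun s hs =>
        sub_nonneg.2 (Real.sin_le (mul_nonneg hs.1 hx))
    refine (integral_mono_of_nonneg hge (h.integrable_sq.const_mul _) hle).trans (le_of_eq ?_)
    rw [integral_const_mul, h.integral_sq]; ring
  have hcf : charFun ρ v - (Real.exp (-v ^ 2 / 2) : ℝ) =
      (Real.exp (-v ^ 2 / 2) : ℝ) * (Complex.exp R - 1) := by
    rw [h.charFun_eq, Complex.exp_add, mul_sub, mul_one]
    push_cast
    rfl
  rw [hcf, norm_mul, Complex.norm_real, Real.norm_eq_abs, abs_of_pos (Real.exp_pos _)]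
  have hA : R.re ≤ u * (v ^ 2 / 3) := hRre.trans (le_of_eq (by rw [hL, hv]; field_simp))
  have hy : 0 ≤ v ^ 2 / 3 := by positivity
  have hw : 0 ≤ Real.exp (v ^ 2 / 3) - 1 - v ^ 2 / 3 := by linarith [Real.add_one_le_exp (v ^ 2 / 3)]
  refine mul_le_mul_of_nonneg_left ((norm_cexp_sub_one_le hu0 hu1 hy hA).trans ?_) (Real.exp_pos _).le
  gcongr

end IsCenteredShot

theorem pow_mul_exp_neg_mul_sq_Ioi (n : ℕ) {b : ℝ} (hb : 0 < b) :
    IntegrableOn (fun v : ℝ => v ^ n * Real.exp (-b * v ^ 2)) (Set.Ioi 0) ∧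
    ∫ v in Set.Ioi (0:ℝ), v ^ n * Real.exp (-b * v ^ 2) =
      b ^ (-((n : ℝ) + 1) / 2) * (1 / 2) * Real.Gamma (((n : ℝ) + 1) / 2) := by
  have hn : (-1 : ℝ) < n := by linarith [Nat.cast_nonneg (α := ℝ) n]
  refine ⟨by simpa using integrableOn_rpow_mul_exp_neg_mul_sq hb hn, ?_⟩
  have := integral_rpow_mul_exp_neg_mul_rpow (p := 2) (q := n) two_pos hn hb
  simpa using this

theorem integral_comp_mul_Ioc_le {f : ℝ → ℝ} (hf : IntegrableOn f (Set.Ioi 0)) (h0 : ∀ v, 0 < v → 0 ≤ f v)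
    {T : ℝ} (hT : 0 < T) :
    IntegrableOn (fun u => f (T * u)) (Set.Ioc 0 1) ∧
      ∫ u in Set.Ioc (0:ℝ) 1, f (T * u) ≤ T⁻¹ * ∫ v in Set.Ioi (0:ℝ), f v := by
  have hi : IntegrableOn (fun u => f (T * u)) (Set.Ioi 0) := by
    rw [integrableOn_Ioi_comp_mul_left_iff _ _ hT]; simpa using hf
  refine ⟨hi.mono_set Set.Ioc_subset_Ioi_self, ?_⟩
  have := integral_comp_mul_left_Ioi f 0 hT
  rw [mul_zero, smul_eq_mul] at this
  rw [← this]
  refine setIntegral_mono_set hi ?_ Set.Ioc_subset_Ioi_self.eventuallyLE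
  exact (ae_restrict_iff' measurableSet_Ioi).2 (ae_of_all _ fun u hu => h0 _ (mul_pos hT hu))

theorem integral_sq_mul_exp_neg_sq_div_two_Ioi :
    ∫ v in Set.Ioi (0:ℝ), v ^ 2 * Real.exp (-(1 / 2) * v ^ 2) = Real.sqrt (2 * Real.pi) / 2 := by
  rw [(pow_mul_exp_neg_mul_sq_Ioi 2 (by norm_num : (0:ℝ) < 1 / 2)).2]
  have h1 : Real.Gamma (((2:ℕ) + 1 : ℝ) / 2) = Real.sqrt Real.pi / 2 := by
    rw [show (((2:ℕ) + 1 : ℝ) / 2) = 1 / 2 + 1 by norm_num, Real.Gamma_add_one (by norm_num),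
      Real.Gamma_one_half_eq]; ring
  have h2 : (1 / 2 : ℝ) ^ (-(((2:ℕ) : ℝ) + 1) / 2) = 2 * Real.sqrt 2 := by
    rw [one_div, Real.inv_rpow (by norm_num), ← Real.rpow_neg (by norm_num), Real.sqrt_eq_rpow,
      show -(-(((2:ℕ) : ℝ) + 1) / 2) = 1 + 1 / 2 by norm_num, Real.rpow_add (by norm_num), Real.rpow_one]
  rw [h1, h2, Real.sqrt_mul (by norm_num)]
  ring

theorem integral_pow_five_mul_exp_neg {b : ℝ} (hb : 0 < b) :
    ∫ v in Set.Ioi (0:ℝ), v ^ 5 * Real.exp (-b * v ^ 2) = (b ^ 3)⁻¹ := by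
  rw [(pow_mul_exp_neg_mul_sq_Ioi 5 hb).2]
  have h1 : Real.Gamma (((5:ℕ) + 1 : ℝ) / 2) = 2 := by
    rw [show (((5:ℕ) + 1 : ℝ) / 2) = (2 : ℕ) + 1 by norm_num, Real.Gamma_nat_eq_factorial]; norm_num
  have h2 : b ^ (-(((5:ℕ) : ℝ) + 1) / 2) = (b ^ 3)⁻¹ := by
    rw [show (-(((5:ℕ) : ℝ) + 1) / 2) = -((3:ℕ) : ℝ) by norm_num, Real.rpow_neg hb.le, Real.rpow_natCast]
  rw [h1, h2]; ring

theorem integral_pow_three_mul_exp_neg {b : ℝ} (hb : 0 < b) :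
    ∫ v in Set.Ioi (0:ℝ), v ^ 3 * Real.exp (-b * v ^ 2) = (2 * b ^ 2)⁻¹ := by
  rw [(pow_mul_exp_neg_mul_sq_Ioi 3 hb).2]
  have h1 : Real.Gamma (((3:ℕ) + 1 : ℝ) / 2) = 1 := by
    rw [show (((3:ℕ) + 1 : ℝ) / 2) = (1 : ℕ) + 1 by norm_num, Real.Gamma_nat_eq_factorial]; norm_num
  have h2 : b ^ (-(((3:ℕ) : ℝ) + 1) / 2) = (b ^ 2)⁻¹ := by
    rw [show (-(((3:ℕ) : ℝ) + 1) / 2) = -((2:ℕ) : ℝ) by norm_num, Real.rpow_neg hb.le, Real.rpow_natCast]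
  rw [h1, h2, mul_inv]; ring

theorem integral_exp_neg_sq_div_le {T : ℝ} (hT : 0 < T) :
    ∫ v in Set.Ioi T, Real.exp (-v ^ 2 / 2) / v ≤ Real.exp (-T ^ 2 / 2) / T ^ 2 := by
  have hi : Integrable (fun v : ℝ => v * Real.exp (-v ^ 2 / 2)) := by
    simpa [neg_div, div_eq_inv_mul] using integrable_mul_exp_neg_mul_sq (b := 1 / 2) (by norm_num)
  have e : ∫ v in Set.Ioi T, v * Real.exp (-v ^ 2 / 2) = Real.exp (-T ^ 2 / 2) := by
    have hd : ∀ v ∈ Set.Ici T, HasDerivAt (fun v : ℝ => -Real.exp (-v ^ 2 / 2)) (v * Real.exp (-v ^ 2 / 2)) v :=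
      fun v _ => ((((hasDerivAt_pow 2 v).neg).div_const 2).exp.neg).congr_deriv (by norm_num; ring)
    rw [integral_Ioi_of_hasDerivAt_of_tendsto' (m := 0) hd hi.integrableOn]
    · simp
    · have : Tendsto (fun v : ℝ => -v ^ 2 / 2) atTop atBot := by
        have h1 : Tendsto (fun v : ℝ => v ^ 2 / 2) atTop atTop :=
          (tendsto_pow_atTop two_ne_zero).atTop_div_const two_pos
        exact (tendsto_neg_atTop_atBot.comp h1).congr fun v => by simp [neg_div]
      simpa using (Real.tendsto_exp_atBot.comp this).neg
  rw [le_div_iff₀ (by positivity), ← e, ← integral_mul_const]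
  refine setIntegral_mono_on ?_ hi.integrableOn measurableSet_Ioi fun v hv => ?_
  · refine Integrable.mono' (hi.integrableOn (s := Set.Ioi T))
      (by fun_prop : Measurable _).aestronglyMeasurable ?_
    refine (ae_restrict_iff' measurableSet_Ioi).2 (ae_of_all _ fun v hv => ?_)
    have hv' : 0 < v := hT.trans hv
    rw [Real.norm_eq_abs, abs_of_nonneg (by positivity), div_mul_eq_mul_div, div_le_iff₀ hv']
    have : T ^ 2 ≤ v ^ 2 := by have := (Set.mem_Ioi.1 hv).le; gcongr
    nlinarith [Real.exp_pos (-v ^ 2 / 2)]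
  · have hv' : 0 < v := hT.trans hv
    rw [div_mul_eq_mul_div, div_le_iff₀ hv']
    have : T ^ 2 ≤ v ^ 2 := by have := (Set.mem_Ioi.1 hv).le; gcongr
    nlinarith [Real.exp_pos (-v ^ 2 / 2)]

theorem exp_half_sq_le {T : ℝ} (hT : 2.777 ≤ T) : Real.exp (-T ^ 2 / 2) ≤ 0.0213 := by
  have h1 : Real.exp (-T ^ 2 / 2) ≤ Real.exp (-(3.855)) := Real.exp_le_exp.2 (by nlinarith)
  refine h1.trans ?_
  rw [Real.exp_neg, inv_le_comm₀ (Real.exp_pos _) (by norm_num)]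
  have h2 : Real.exp 3.855 = Real.exp 1 ^ 3 * Real.exp 0.855 := by
    rw [← Real.exp_nat_mul, ← Real.exp_add]; norm_num
  have h3 : (1 : ℝ) + 0.855 + 0.855 ^ 2 / 2 + 0.855 ^ 3 / 6 + 0.855 ^ 4 / 24 ≤ Real.exp 0.855 := by
    have := Real.sum_le_exp_of_nonneg (x := 0.855) (by norm_num) 5
    norm_num [Finset.sum_range_succ, Nat.factorial] at this ⊢
    linarith
  have h4 := Real.exp_one_gt_d9
  have h5 : (2.718 : ℝ) ^ 3 ≤ Real.exp 1 ^ 3 := by gcongr; linarith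
  rw [h2]
  nlinarith [pow_pos (Real.exp_pos 1) 3]

theorem cube_mul_exp_le {v : ℝ} (hv : 0 ≤ v) : v ^ 3 * Real.exp (-(1 / 6) * v ^ 2) ≤ 6.03 := by
  have h1 : v * Real.exp (-(1 / 18) * v ^ 2) ≤ 3 * Real.exp (-(1 / 2)) := by
    have h := Real.add_one_le_exp (v ^ 2 / 18 - 1 / 2)
    have h2 : Real.exp (v ^ 2 / 18 - 1 / 2) = Real.exp (-(1 / 2)) * Real.exp (v ^ 2 / 18) := by
      rw [← Real.exp_add]; ring_nf
    have h3 : Real.exp (-(1 / 18) * v ^ 2) = (Real.exp (v ^ 2 / 18))⁻¹ := by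
      rw [← Real.exp_neg]; ring_nf
    rw [h3, ← div_eq_mul_inv, div_le_iff₀ (Real.exp_pos _), mul_assoc, ← h2]
    nlinarith [sq_nonneg (v - 3)]
  have h2 : v ^ 3 * Real.exp (-(1 / 6) * v ^ 2) = (v * Real.exp (-(1 / 18) * v ^ 2)) ^ 3 := by
    rw [mul_pow, ← Real.exp_nat_mul]; congr 2; push_cast; ring
  have h3 : (3 * Real.exp (-(1 / 2))) ^ 3 ≤ 6.03 := by
    rw [mul_pow, ← Real.exp_nat_mul, show ((3 : ℕ) : ℝ) * -(1 / 2) = -(1 + 1 / 2) by norm_num,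
      Real.exp_neg, Real.exp_add]
    have h4 := Real.exp_one_gt_d9
    have h5 : (1.6487 : ℝ) ≤ Real.exp (1 / 2) := by
      refine le_of_sq_le_sq ?_ (Real.exp_pos _).le
      rw [← Real.exp_nat_mul]; norm_num
      linarith
    have h6 : (4.4807 : ℝ) ≤ Real.exp 1 * Real.exp (1 / 2) := by nlinarith
    rw [← div_eq_mul_inv, div_le_iff₀ (by positivity)]
    linarith
  rw [h2]
  exact (pow_le_pow_left₀ (by positivity) h1 3).trans h3

theorem uniform_numeric {t c e th s : ℝ} (ht0 : 0 < t) (ht : t ≤ 0.36013) (hc0 : 0 ≤ c) (hc : c ≤ 0.18304)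
    (he : e ≤ 0.0213)
    (hth : th ≤ 1.005) (hth2 : t ≤ 0.2 → th ≤ 21 * t ^ 2) (hs : s ≤ 1.2534) :
    c * (s + 8 / 6 * t + th) + (s - t * (1 - e) + 1.05 * s * t ^ 2) + 0.32 * e * t ≤ 1.595 := by
  have hA : s + 1.05 * s * t ^ 2 ≤ 1.2534 + 1.05 * 1.2534 * t ^ 2 := by nlinarith [sq_nonneg t]
  rcases le_total t 0.2 with h | h
  · have h1 := hth2 h
    have : c * (s + 8 / 6 * t + th) ≤ 0.18304 * (1.2534 + 8 / 6 * t + 21 * t ^ 2) := by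
      have h0 : (0:ℝ) ≤ 1.2534 + 8 / 6 * t + 21 * t ^ 2 := by positivity
      calc _ ≤ c * (1.2534 + 8 / 6 * t + 21 * t ^ 2) := by gcongr
        _ ≤ _ := by gcongr
    nlinarith
  · have : c * (s + 8 / 6 * t + th) ≤ 0.18304 * (1.2534 + 8 / 6 * t + 1.005) := by
      have h0 : (0:ℝ) ≤ 1.2534 + 8 / 6 * t + 1.005 := by positivity
      calc _ ≤ c * (1.2534 + 8 / 6 * t + 1.005) := by gcongr
        _ ≤ _ := by gcongr
    nlinarith

theorem pow_four_mul_exp_Ioc_le {T : ℝ} (hT : 0 < T) :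
    IntegrableOn (fun u => (T * u) ^ 4 * Real.exp (-(1 / 6) * (T * u) ^ 2)) (Set.Ioc 0 1) ∧
    ∫ u in Set.Ioc (0:ℝ) 1, (T * u) ^ 4 * Real.exp (-(1 / 6) * (T * u) ^ 2) ≤ T⁻¹ * 63 := by
  have hb : (0:ℝ) < 1 / 6 := by norm_num
  have h4 := integral_comp_mul_Ioc_le (pow_mul_exp_neg_mul_sq_Ioi 4 hb).1 (fun v _ => by positivity) hT
  refine ⟨h4.1, h4.2.trans ?_⟩
  gcongr
  have i3 := (pow_mul_exp_neg_mul_sq_Ioi 3 hb).1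
  have i5 := (pow_mul_exp_neg_mul_sq_Ioi 5 hb).1
  have hi : IntegrableOn (fun v : ℝ => 1 / 7 * (v ^ 5 * Real.exp (-(1 / 6) * v ^ 2)) +
      7 / 4 * (v ^ 3 * Real.exp (-(1 / 6) * v ^ 2))) (Set.Ioi 0) := (i5.const_mul _).add (i3.const_mul _)
  refine (setIntegral_mono_on (pow_mul_exp_neg_mul_sq_Ioi 4 hb).1 hi measurableSet_Ioi
    fun v hv => ?_).trans ?_
  · have hv' : 0 < v := hv
    have : v ^ 4 ≤ 1 / 7 * v ^ 5 + 7 / 4 * v ^ 3 := by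
      nlinarith [mul_nonneg (pow_pos hv' 3).le (sq_nonneg (v - 3.5))]
    calc _ ≤ (1 / 7 * v ^ 5 + 7 / 4 * v ^ 3) * Real.exp (-(1 / 6) * v ^ 2) := by gcongr
      _ = _ := by ring
  · rw [integral_add (i5.const_mul _) (i3.const_mul _), integral_const_mul, integral_const_mul,
      integral_pow_five_mul_exp_neg hb, integral_pow_three_mul_exp_neg hb]
    norm_num

theorem sqrt_two_pi_bounds : 2.5065 ≤ Real.sqrt (2 * Real.pi) ∧ Real.sqrt (2 * Real.pi) ≤ 2.5067 := by
  have h2 := Real.pi_gt_d4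
  have h3 := Real.pi_lt_d4
  exact ⟨Real.le_sqrt_of_sq_le (by norm_num; linarith), Real.sqrt_le_iff.2 ⟨by norm_num, by norm_num; linarith⟩⟩

/-- The three pieces of the integral of the characteristic-function discrepancy. -/
theorem integral_discrepancy_le {T : ℝ} (hT : 0 < T) :
    IntegrableOn (fun u => Real.exp (-(T * u) ^ 2 / 2) * (T * u) ^ 2 *
      (1 + u * ((T * u) ^ 2 / 3) / 2 +
        u ^ 2 * (Real.exp ((T * u) ^ 2 / 3) - 1 - (T * u) ^ 2 / 3) / 3)) (Set.Ioc 0 1) ∧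
    ∃ th ≤ min 1.005 (21 * (T⁻¹) ^ 2),
    ∫ u in Set.Ioc (0:ℝ) 1, Real.exp (-(T * u) ^ 2 / 2) * (T * u) ^ 2 *
      (1 + u * ((T * u) ^ 2 / 3) / 2 +
        u ^ 2 * (Real.exp ((T * u) ^ 2 / 3) - 1 - (T * u) ^ 2 / 3) / 3) ≤
      T⁻¹ * (Real.sqrt (2 * Real.pi) / 2 + 8 / 6 * T⁻¹ + th) := by
  have hb : (0:ℝ) < 1 / 2 := by norm_num
  have i2 := integral_comp_mul_Ioc_le (pow_mul_exp_neg_mul_sq_Ioi 2 hb).1 (fun v _ => by positivity) hT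
  have i5 := integral_comp_mul_Ioc_le (pow_mul_exp_neg_mul_sq_Ioi 5 hb).1 (fun v _ => by positivity) hT
  rw [integral_sq_mul_exp_neg_sq_div_two_Ioi] at i2
  rw [integral_pow_five_mul_exp_neg hb] at i5
  have hw : ∀ y : ℝ, 0 ≤ Real.exp y - 1 - y := fun y => by linarith [Real.add_one_le_exp y]
  set f3 : ℝ → ℝ := fun u => Real.exp (-(T * u) ^ 2 / 2) * (T * u) ^ 2 *
    (u ^ 2 * (Real.exp ((T * u) ^ 2 / 3) - 1 - (T * u) ^ 2 / 3) / 3) with hf3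
  have i3 : IntegrableOn f3 (Set.Ioc 0 1) :=
    (Continuous.integrableOn_Icc (by fun_prop)).mono_set Set.Ioc_subset_Icc_self
  have hf3le : ∀ u, 0 < u → f3 u ≤ u ^ 2 / 3 * ((T * u) ^ 2 * Real.exp (-(1 / 6) * (T * u) ^ 2)) := by
    intro u hu
    have e : Real.exp (-(1 / 6) * (T * u) ^ 2) = Real.exp (-(T * u) ^ 2 / 2) * Real.exp ((T * u) ^ 2 / 3) := by
      rw [← Real.exp_add]; ring_nf
    rw [e, hf3]; beta_reduce
    have h1 : Real.exp ((T * u) ^ 2 / 3) - 1 - (T * u) ^ 2 / 3 ≤ Real.exp ((T * u) ^ 2 / 3) := by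
      have : 0 ≤ (T * u) ^ 2 / 3 := by positivity
      linarith
    calc _ ≤ Real.exp (-(T * u) ^ 2 / 2) * (T * u) ^ 2 *
          (u ^ 2 * Real.exp ((T * u) ^ 2 / 3) / 3) := by gcongr
      _ = _ := by ring
  have hth1 : ∫ u in Set.Ioc (0:ℝ) 1, f3 u ≤ T⁻¹ * 1.005 := by
    have ilin : IntegrableOn (fun u : ℝ => T⁻¹ * 2.01 * u) (Set.Ioc 0 1) :=
      (Continuous.integrableOn_Icc (by fun_prop)).mono_set Set.Ioc_subset_Icc_self
    refine (setIntegral_mono_on i3 ilin measurableSet_Ioc fun u hu => ?_).trans (le_of_eq ?_)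
    · refine (hf3le u hu.1).trans ?_
      have h1 := cube_mul_exp_le (v := T * u) (by have := hu.1; positivity)
      calc _ = T⁻¹ * u / 3 * ((T * u) ^ 3 * Real.exp (-(1 / 6) * (T * u) ^ 2)) := by field_simp
        _ ≤ T⁻¹ * u / 3 * 6.03 := by have := hu.1; gcongr
        _ = _ := by ring
    · rw [integral_const_mul, ← intervalIntegral.integral_of_le zero_le_one, integral_id]; norm_num; ring
  have hth2 : ∫ u in Set.Ioc (0:ℝ) 1, f3 u ≤ T⁻¹ * (21 * T⁻¹ ^ 2) := by
    have h4 := pow_four_mul_exp_Ioc_le hT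
    have i4 : IntegrableOn (fun u => T⁻¹ ^ 2 / 3 * ((T * u) ^ 4 * Real.exp (-(1 / 6) * (T * u) ^ 2)))
      (Set.Ioc 0 1) := h4.1.const_mul _
    refine (setIntegral_mono_on i3 i4 measurableSet_Ioc fun u hu => ?_).trans ?_
    · refine (hf3le u hu.1).trans (le_of_eq ?_)
      field_simp
    · rw [integral_const_mul]
      calc _ ≤ T⁻¹ ^ 2 / 3 * (T⁻¹ * 63) := by gcongr; exact h4.2
        _ = _ := by ring
  have i1' : IntegrableOn (fun u => (T * u) ^ 2 * Real.exp (-(1 / 2) * (T * u) ^ 2) +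
      T⁻¹ / 6 * ((T * u) ^ 5 * Real.exp (-(1 / 2) * (T * u) ^ 2))) (Set.Ioc 0 1) :=
    i2.1.add (i5.1.const_mul _)
  have e : ∀ u, Real.exp (-(T * u) ^ 2 / 2) * (T * u) ^ 2 *
      (1 + u * ((T * u) ^ 2 / 3) / 2 +
        u ^ 2 * (Real.exp ((T * u) ^ 2 / 3) - 1 - (T * u) ^ 2 / 3) / 3) =
      ((T * u) ^ 2 * Real.exp (-(1 / 2) * (T * u) ^ 2) +
      T⁻¹ / 6 * ((T * u) ^ 5 * Real.exp (-(1 / 2) * (T * u) ^ 2))) + f3 u := by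
    intro u
    have e1 : -(1 / 2) * (T * u) ^ 2 = -(T * u) ^ 2 / 2 := by ring
    rw [e1, hf3]; beta_reduce
    field_simp
    ring
  simp_rw [e]
  refine ⟨i1'.add i3, T * ∫ u in Set.Ioc (0:ℝ) 1, f3 u, ?_, ?_⟩
  · rw [le_min_iff]
    constructor
    · calc _ ≤ T * (T⁻¹ * 1.005) := by gcongr
        _ = _ := by field_simp
    · calc _ ≤ T * (T⁻¹ * (21 * T⁻¹ ^ 2)) := by gcongr
        _ = _ := by field_simp
  · rw [integral_add i1' i3, integral_add i2.1 (i5.1.const_mul _), integral_const_mul]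
    have h2 := i2.2
    have h5 : T⁻¹ / 6 * ∫ u in Set.Ioc (0:ℝ) 1, (T * u) ^ 5 * Real.exp (-(1 / 2) * (T * u) ^ 2) ≤
        T⁻¹ / 6 * (T⁻¹ * ((1 / 2) ^ 3)⁻¹) := by gcongr; exact i5.2
    have h3 : T⁻¹ * (T * ∫ u in Set.Ioc (0:ℝ) 1, f3 u) = ∫ u in Set.Ioc (0:ℝ) 1, f3 u := by
      field_simp
    rw [mul_add, h3, mul_add]
    have h6 : T⁻¹ / 6 * (T⁻¹ * ((1 / 2) ^ 3)⁻¹) = T⁻¹ * (8 / 6 * T⁻¹) := by norm_num; ring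
    linarith

theorem integral_gaussian_weight_le {T : ℝ} (hT : 0 < T) :
    ∫ u in Set.Ioc (0:ℝ) 1, (1 - u + 1.05 * u ^ 2) * Real.exp (-(T * u) ^ 2 / 2) ≤
      T⁻¹ * (Real.sqrt (2 * Real.pi) / 2 - T⁻¹ * (1 - Real.exp (-T ^ 2 / 2)) +
        1.05 * (Real.sqrt (2 * Real.pi) / 2) * T⁻¹ ^ 2) := by
  have hb : (0:ℝ) < 1 / 2 := by norm_num
  have i2 := integral_comp_mul_Ioc_le (pow_mul_exp_neg_mul_sq_Ioi 2 hb).1 (fun v _ => by positivity) hT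
  have i0 := integral_comp_mul_Ioc_le (f := fun v => Real.exp (-v ^ 2 / 2))
    integrable_exp_neg_sq_div_two.integrableOn (fun v _ => by positivity) hT
  rw [integral_sq_mul_exp_neg_sq_div_two_Ioi] at i2
  rw [integral_exp_neg_sq_div_two_Ioi] at i0
  have i1 : IntegrableOn (fun u => u * Real.exp (-(T * u) ^ 2 / 2)) (Set.Ioc 0 1) :=
    (Continuous.integrableOn_Icc (by fun_prop)).mono_set Set.Ioc_subset_Icc_self
  have e1 : ∫ u in Set.Ioc (0:ℝ) 1, u * Real.exp (-(T * u) ^ 2 / 2) =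
      T⁻¹ ^ 2 * (1 - Real.exp (-T ^ 2 / 2)) := by
    rw [← intervalIntegral.integral_of_le zero_le_one]
    have hd : ∀ u ∈ Set.uIcc (0:ℝ) 1, HasDerivAt (fun u : ℝ => -(T⁻¹ ^ 2) * Real.exp (-(T * u) ^ 2 / 2))
        (u * Real.exp (-(T * u) ^ 2 / 2)) u := fun u _ => by
      have h1 : HasDerivAt (fun u => T * u) T u := by simpa using (hasDerivAt_id u).const_mul T
      exact ((((h1.pow 2).neg).div_const 2).exp.const_mul (-(T⁻¹ ^ 2))).congr_deriv
        (by simp only [Pi.neg_apply, Pi.pow_apply]; field_simp; ring)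
    rw [intervalIntegral.integral_eq_sub_of_hasDerivAt hd
      (Continuous.intervalIntegrable (by fun_prop) _ _)]
    simp; ring
  have ia : IntegrableOn (fun u => Real.exp (-(T * u) ^ 2 / 2) - u * Real.exp (-(T * u) ^ 2 / 2))
    (Set.Ioc 0 1) := i0.1.sub i1
  have e : ∀ u, (1 - u + 1.05 * u ^ 2) * Real.exp (-(T * u) ^ 2 / 2) =
      (Real.exp (-(T * u) ^ 2 / 2) - u * Real.exp (-(T * u) ^ 2 / 2)) +
        1.05 * T⁻¹ ^ 2 * ((T * u) ^ 2 * Real.exp (-(1 / 2) * (T * u) ^ 2)) := by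
    intro u
    have e1 : -(1 / 2) * (T * u) ^ 2 = -(T * u) ^ 2 / 2 := by ring
    rw [e1]
    field_simp
  simp_rw [e]
  rw [integral_add ia (i2.1.const_mul _), integral_sub i0.1 i1, integral_const_mul, e1]
  have h0 := i0.2
  have h2 : 1.05 * T⁻¹ ^ 2 * ∫ u in Set.Ioc (0:ℝ) 1, (T * u) ^ 2 * Real.exp (-(1 / 2) * (T * u) ^ 2) ≤
      1.05 * T⁻¹ ^ 2 * (T⁻¹ * (Real.sqrt (2 * Real.pi) / 2)) := by gcongr; exact i2.2
  calc _ ≤ T⁻¹ * (Real.sqrt (2 * Real.pi) / 2) - T⁻¹ ^ 2 * (1 - Real.exp (-T ^ 2 / 2)) +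
      1.05 * T⁻¹ ^ 2 * (T⁻¹ * (Real.sqrt (2 * Real.pi) / 2)) := by gcongr
    _ = _ := by ring

theorem monotone_normalCdf : Monotone normalCdf :=
  monotone_of_deriv_nonneg (fun x => (hasDerivAt_normalCdf x).differentiableAt)
    fun x => by rw [(hasDerivAt_normalCdf x).deriv]; positivity

theorem normalCdf_neg (x : ℝ) : normalCdf (-x) = 1 - normalCdf x := by
  have hd : ∀ x, HasDerivAt (fun x => normalCdf (-x) + normalCdf x) 0 x := fun x => by
    have h1 := (hasDerivAt_normalCdf (-x)).scomp x (hasDerivAt_neg x)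
    exact (h1.add (hasDerivAt_normalCdf x)).congr_deriv (by simp)
  have := is_const_of_deriv_eq_zero (fun x => (hd x).differentiableAt) (fun x => (hd x).deriv) x 0
  simp only [neg_zero, normalCdf_zero] at this
  linarith

theorem normalCdf_nonneg (x : ℝ) : 0 ≤ normalCdf x :=
  div_nonneg (setIntegral_nonneg measurableSet_Iic fun _ _ => (Real.exp_pos _).le) (Real.sqrt_nonneg _)

theorem normalCdf_le_one (x : ℝ) : normalCdf x ≤ 1 := by
  have := normalCdf_nonneg (-x)
  rw [normalCdf_neg] at this
  linarith

theorem normalCdf_le_half_add {x : ℝ} (hx : 0 ≤ x) : normalCdf x ≤ 1 / 2 + 0.4 * x := by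
  have hs := sqrt_two_pi_bounds.1
  have hd : ∀ s, HasDerivAt (fun s => 1 / 2 + 0.4 * s - normalCdf s)
      (0.4 - Real.exp (-s ^ 2 / 2) / Real.sqrt (2 * Real.pi)) s := fun s =>
    ((((hasDerivAt_id s).const_mul 0.4).const_add (1/2)).sub (hasDerivAt_normalCdf s)).congr_deriv
      (by simp)
  have hm : Monotone (fun s => 1 / 2 + 0.4 * s - normalCdf s) := by
    refine monotone_of_deriv_nonneg (fun s => (hd s).differentiableAt) fun s => ?_
    rw [(hd s).deriv, sub_nonneg, div_le_iff₀ (by positivity)]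
    have : Real.exp (-s ^ 2 / 2) ≤ 1 := Real.exp_le_one_iff.2 (by nlinarith [sq_nonneg s])
    linarith
  have := hm hx
  simp [normalCdf_zero] at this
  linarith

/-- Cantelli's inequality for a centred law of unit variance. -/
theorem measureReal_ge_le_cantelli {ρ : Measure ℝ} [IsProbabilityMeasure ρ]
    (h1 : Integrable (fun y => y) ρ) (h2 : Integrable (fun y => y ^ 2) ρ)
    (e1 : ∫ y, y ∂ρ = 0) (e2 : ∫ y, y ^ 2 ∂ρ = 1) {x : ℝ} (hx : 0 < x) :
    ρ.real (Set.Ici x) ≤ 1 / (1 + x ^ 2) ∧ ρ.real (Set.Iic (-x)) ≤ 1 / (1 + x ^ 2) := by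
  have key : ∀ (e : ℝ) (S : Set ℝ), MeasurableSet S → (∀ y ∈ S, x ≤ e * y) → e ^ 2 = 1 →
      ρ.real S ≤ 1 / (1 + x ^ 2) := by
    intro e S hS hSe he
    have i0 : Integrable (fun y => (e * x * y + 1) ^ 2) ρ := by
      have : (fun y => (e * x * y + 1) ^ 2) = fun y => x ^ 2 * y ^ 2 + 2 * e * x * y + 1 := by
        ext y; linear_combination x ^ 2 * y ^ 2 * he
      rw [this]
      exact ((h2.const_mul _).add (h1.const_mul _)).add (integrable_const 1)
    have hle : (1 + x ^ 2) ^ 2 * ρ.real S ≤ ∫ y, (e * x * y + 1) ^ 2 ∂ρ := by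
      have : (1 + x ^ 2) ^ 2 * ρ.real S = ∫ y, S.indicator (fun _ => (1 + x ^ 2) ^ 2) y ∂ρ := by
        rw [integral_indicator_const _ hS, smul_eq_mul, mul_comm]
      rw [this]
      refine integral_mono ((integrable_const _).indicator hS) i0 fun y => ?_
      by_cases hy : y ∈ S
      · rw [Set.indicator_of_mem hy]
        have := hSe y hy
        have h3 : 1 + x ^ 2 ≤ e * x * y + 1 := by nlinarith
        exact pow_le_pow_left₀ (by positivity) h3 2
      · rw [Set.indicator_of_notMem hy]; positivity
    have hev : ∫ y, (e * x * y + 1) ^ 2 ∂ρ = 1 + x ^ 2 := by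
      have : (fun y => (e * x * y + 1) ^ 2) = fun y => x ^ 2 * y ^ 2 + (2 * e * x * y + 1) := by
        ext y; linear_combination x ^ 2 * y ^ 2 * he
      rw [this]
      have i1 : Integrable (fun y => 2 * e * x * y + 1) ρ := (h1.const_mul _).add (integrable_const 1)
      rw [integral_add (h2.const_mul _) i1, integral_add (h1.const_mul _) (integrable_const 1),
        integral_const_mul, integral_const_mul, e1, e2]
      simp; ring
    rw [hev] at hle
    rw [le_div_iff₀ (by positivity)]
    have hp : 0 < 1 + x ^ 2 := by positivity
    nlinarith
  exact ⟨key 1 _ measurableSet_Ici (fun y hy => by simpa using hy) (by norm_num),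
    key (-1) _ measurableSet_Iic (fun y hy => by simpa using le_neg.1 hy) (by norm_num)⟩

namespace IsCenteredShot

variable {η ρ : Measure ℝ} [IsFiniteMeasure η] [IsProbabilityMeasure ρ] {L : ℝ}

theorem abs_sub_normalCdf_le_of_small (h : IsCenteredShot η ρ L) (hL : L ≤ 1.2) (x : ℝ) :
    |ρ.real (Set.Iic x) - normalCdf x| ≤ 0.4785 * L := by
  have hLp := h.pos
  set T : ℝ := 10 / (3 * L) with hTdef
  have hT : 0 < T := by positivity
  have hLT : L = 10 / (3 * T) := by rw [hTdef]; field_simp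
  have hT3 : 2.777 ≤ T := by rw [hTdef, le_div_iff₀ (by positivity)]; linarith
  have hdisc := integral_discrepancy_le hT
  obtain ⟨hint, th, hth, hdisc⟩ := hdisc
  set W : ℝ → ℝ := fun u => Real.exp (-(T * u) ^ 2 / 2) * (T * u) ^ 2 *
      (1 + u * ((T * u) ^ 2 / 3) / 2 +
        u ^ 2 * (Real.exp ((T * u) ^ 2 / 3) - 1 - (T * u) ^ 2 / 3) / 3) with hW
  have hcong : ∀ u ∈ Set.Ioc (0:ℝ) 1, Real.exp (-(T * u) ^ 2 / 2) * (L * (T * u) ^ 3 / 6 *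
        (1 + u * ((T * u) ^ 2 / 3) / 2 +
          u ^ 2 * (Real.exp ((T * u) ^ 2 / 3) - 1 - (T * u) ^ 2 / 3) / 3)) / u = 5 / 9 * W u := by
    intro u hu
    have := hu.1.ne'
    rw [hW, hLT]; beta_reduce
    field_simp
    ring
  have hs := prawitz_smoothing ρ h.integrable_law x hT
    (fun u hu => h.norm_charFun_sub_le hT hLT hu.1.le hu.2)
    ((integrableOn_congr_fun hcong measurableSet_Ioc).2 (hint.const_mul _))
  rw [setIntegral_congr_fun measurableSet_Ioc hcong, integral_const_mul] at hs
  refine hs.trans ?_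
  have hg := integral_gaussian_weight_le hT
  have hm := integral_exp_neg_sq_div_le hT
  have hpi := Real.pi_gt_d4
  have hsq := sqrt_two_pi_bounds
  set s := Real.sqrt (2 * Real.pi) / 2 with hsdef
  set e := Real.exp (-T ^ 2 / 2) with hedef
  have he : e ≤ 0.0213 := exp_half_sq_le hT3
  have he0 : 0 < e := Real.exp_pos _
  have hti : T⁻¹ = 0.3 * L := by rw [hTdef]; field_simp; norm_num
  have hnum := uniform_numeric (t := T⁻¹) (c := 1.035 / Real.pi * (5 / 9)) (e := e) (th := th) (s := s)
    (by positivity) (by rw [hti]; linarith) (by positivity)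
    (by rw [div_mul_eq_mul_div, div_le_iff₀ (by positivity)]; linarith) he
    (hth.trans (min_le_left _ _)) (fun _ => hth.trans (min_le_right _ _)) (by rw [hsdef]; linarith [hsq.2])
  have h3 : 1 / Real.pi * ∫ v in Set.Ioi T, Real.exp (-v ^ 2 / 2) / v ≤ T⁻¹ * (0.32 * e * T⁻¹) := by
    calc _ ≤ 1 / Real.pi * (e / T ^ 2) := by gcongr
      _ ≤ 0.32 * (e / T ^ 2) := by
          gcongr
          rw [div_le_iff₀ (by positivity)]; linarith
      _ = _ := by field_simp
  have h1 : 1.035 / Real.pi * (5 / 9 * ∫ u in Set.Ioc (0:ℝ) 1, W u) ≤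
      T⁻¹ * (1.035 / Real.pi * (5 / 9) * (s + 8 / 6 * T⁻¹ + th)) := by
    calc _ ≤ 1.035 / Real.pi * (5 / 9 * (T⁻¹ * (s + 8 / 6 * T⁻¹ + th))) := by gcongr
      _ = _ := by ring
  calc _ ≤ T⁻¹ * (1.035 / Real.pi * (5 / 9) * (s + 8 / 6 * T⁻¹ + th)) +
        T⁻¹ * (s - T⁻¹ * (1 - e) + 1.05 * s * T⁻¹ ^ 2) + T⁻¹ * (0.32 * e * T⁻¹) := by gcongr
    _ = T⁻¹ * (1.035 / Real.pi * (5 / 9) * (s + 8 / 6 * T⁻¹ + th) +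
        (s - T⁻¹ * (1 - e) + 1.05 * s * T⁻¹ ^ 2) + 0.32 * e * T⁻¹) := by ring
    _ ≤ T⁻¹ * 1.595 := by gcongr
    _ = 0.4785 * L := by rw [hti]; ring

theorem abs_sub_normalCdf_le_const (h : IsCenteredShot η ρ L) (x : ℝ) :
    |ρ.real (Set.Iic x) - normalCdf x| ≤ 0.5742 := by
  have hc := fun {x : ℝ} (hx : 0 < x) => measureReal_ge_le_cantelli h.integrable_law
    h.integrable_sq_law h.integral_law h.integral_sq_law hx
  have key : ∀ x : ℝ, 0 ≤ x → normalCdf x ≤ 0.5742 + (1 - 1 / (1 + x ^ 2)) := by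
    intro x hx
    rcases le_total x 1 with h1 | h1
    · have h2 : 1 / (1 + x ^ 2) ≤ 1.0742 - 0.4 * x := by
        rw [div_le_iff₀ (by positivity)]
        nlinarith [sq_nonneg (x - 0.29), mul_nonneg (sq_nonneg x) (sub_nonneg.2 h1)]
      linarith [normalCdf_le_half_add hx]
    · have h2 : 1 / (1 + x ^ 2) ≤ 1 / 2 := by gcongr; nlinarith
      linarith [normalCdf_le_one x]
  have h0 := measureReal_nonneg (μ := ρ) (s := Set.Iic x)
  have h1 := measureReal_le_one (μ := ρ) (s := Set.Iic x)
  rw [abs_le]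
  rcases lt_trichotomy x 0 with hx | rfl | hx
  · have h2 := (hc (neg_pos.2 hx)).2
    rw [neg_neg] at h2
    have h3 := key (-x) (by linarith)
    have h4 := normalCdf_neg x
    have h5 := monotone_normalCdf hx.le
    rw [normalCdf_zero] at h5
    constructor <;> linarith
  · rw [normalCdf_zero]; constructor <;> linarith
  · have h2 := (hc hx).1
    have h3 := key x hx.le
    have h5 := monotone_normalCdf hx.le
    rw [normalCdf_zero] at h5
    have h6 : ρ.real (Set.Iic x) = 1 - ρ.real (Set.Ioi x) := by
      rw [← Set.compl_Iic, probReal_compl_eq_one_sub measurableSet_Iic]; ring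
    have h7 : ρ.real (Set.Ioi x) ≤ ρ.real (Set.Ici x) := measureReal_mono Set.Ioi_subset_Ici_self
    constructor <;> linarith

theorem abs_sub_normalCdf_le (h : IsCenteredShot η ρ L) (x : ℝ) :
    |ρ.real (Set.Iic x) - normalCdf x| ≤ 0.4785 * L := by
  rcases le_total L 1.2 with hL | hL
  · exact h.abs_sub_normalCdf_le_of_small hL x
  · exact (h.abs_sub_normalCdf_le_const x).trans (by linarith)

end IsCenteredShot

/-- The Gaussian Mills ratio. -/
noncomputable def millsRatio (w : ℝ) : ℝ :=
  Real.sqrt (2 * Real.pi) * Real.exp (w ^ 2 / 2) * normalCdf (-w)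

theorem hasDerivAt_normalCdf_neg (w : ℝ) :
    HasDerivAt (fun w => normalCdf (-w)) (-(Real.exp (-w ^ 2 / 2) / Real.sqrt (2 * Real.pi))) w := by
  have := (hasDerivAt_normalCdf (-w)).scomp w (hasDerivAt_neg w)
  exact this.congr_deriv (by simp)

theorem hasDerivAt_millsRatio (w : ℝ) : HasDerivAt millsRatio (w * millsRatio w - 1) w := by
  have h1 : HasDerivAt (fun w : ℝ => Real.exp (w ^ 2 / 2)) (Real.exp (w ^ 2 / 2) * w) w :=
    ((hasDerivAt_pow 2 w).div_const 2).exp.congr_deriv (by norm_num)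
  refine ((h1.const_mul (Real.sqrt (2 * Real.pi))).mul (hasDerivAt_normalCdf_neg w)).congr_deriv ?_
  have hs : Real.sqrt (2 * Real.pi) ≠ 0 := by positivity
  have e : Real.exp (-w ^ 2 / 2) = (Real.exp (w ^ 2 / 2))⁻¹ := by rw [← Real.exp_neg]; ring_nf
  have := Real.exp_ne_zero (w ^ 2 / 2)
  rw [e, millsRatio]
  field_simp
  ring

theorem millsRatio_nonneg (w : ℝ) : 0 ≤ millsRatio w :=
  mul_nonneg (by positivity) (normalCdf_nonneg _)

theorem normalCdf_neg_eq (w : ℝ) :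
    normalCdf (-w) = Real.exp (-w ^ 2 / 2) * millsRatio w / Real.sqrt (2 * Real.pi) := by
  have hs : Real.sqrt (2 * Real.pi) ≠ 0 := by positivity
  have e : Real.exp (-w ^ 2 / 2) = (Real.exp (w ^ 2 / 2))⁻¹ := by rw [← Real.exp_neg]; ring_nf
  rw [e, millsRatio]
  field_simp

theorem tendsto_normalCdf_neg_atTop : Tendsto (fun w => normalCdf (-w)) atTop (𝓝 0) := by
  have h1 : ∀ w : ℝ, normalCdf (-w) =
      1 - (∫ t in Set.Iic w, Real.exp (-t ^ 2 / 2)) / Real.sqrt (2 * Real.pi) := fun w => normalCdf_neg w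
  have h2 : Tendsto (fun w : ℝ => ∫ t in Set.Iic w, Real.exp (-t ^ 2 / 2)) atTop
      (𝓝 (∫ t : ℝ, Real.exp (-t ^ 2 / 2))) :=
    (aecover_Iic tendsto_id).integral_tendsto_of_countably_generated integrable_exp_neg_sq_div_two
  have h3 : ∫ t : ℝ, Real.exp (-t ^ 2 / 2) = Real.sqrt (2 * Real.pi) := by
    have := integral_gaussian (1 / 2)
    rw [show Real.pi / (1 / 2) = 2 * Real.pi by ring] at this
    rw [← this]; congr 1; ext t; ring_nf
  rw [h3] at h2
  simp_rw [h1]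
  have h4 := (h2.div_const (Real.sqrt (2 * Real.pi))).const_sub 1
  rwa [div_self (by positivity), sub_self] at h4

theorem tendsto_exp_neg_sq_div_two_atTop : Tendsto (fun w : ℝ => Real.exp (-w ^ 2 / 2)) atTop (𝓝 0) := by
  have h1 : Tendsto (fun v : ℝ => v ^ 2 / 2) atTop atTop :=
    (tendsto_pow_atTop two_ne_zero).atTop_div_const two_pos
  exact Real.tendsto_exp_atBot.comp
    ((tendsto_neg_atTop_atBot.comp h1).congr fun v => by simp [neg_div])

theorem mul_millsRatio_le_one (w : ℝ) : w * millsRatio w ≤ 1 := by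
  rcases le_or_gt w 0 with hw | hw
  · nlinarith [millsRatio_nonneg w]
  have hs : 0 < Real.sqrt (2 * Real.pi) := by positivity
  set g : ℝ → ℝ := fun w => Real.exp (-w ^ 2 / 2) / Real.sqrt (2 * Real.pi) * w⁻¹ - normalCdf (-w) with hg
  have hd : ∀ v, 0 < v → HasDerivAt g
      (-(Real.exp (-v ^ 2 / 2) / Real.sqrt (2 * Real.pi) * (v ^ 2)⁻¹)) v := by
    intro v hv
    have h1 : HasDerivAt (fun w : ℝ => Real.exp (-w ^ 2 / 2)) (-(v * Real.exp (-v ^ 2 / 2))) v :=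
      (((hasDerivAt_pow 2 v).neg).div_const 2).exp.congr_deriv (by norm_num; ring)
    refine (((h1.div_const _).mul (hasDerivAt_inv hv.ne')).sub (hasDerivAt_normalCdf_neg v)).congr_deriv ?_
    field_simp
    ring
  have hanti : AntitoneOn g (Set.Ioi 0) := by
    refine antitoneOn_of_deriv_nonpos (convex_Ioi 0)
      (fun v hv => (hd v hv).continuousAt.continuousWithinAt) (fun v hv => ?_) (fun v hv => ?_)
    · rw [interior_Ioi] at hv
      exact (hd v hv).differentiableAt.differentiableWithinAt
    · rw [interior_Ioi] at hv
      rw [(hd v hv).deriv, neg_nonpos]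
      positivity
  have hlim : Tendsto g atTop (𝓝 0) := by
    have := ((tendsto_exp_neg_sq_div_two_atTop.div_const (Real.sqrt (2 * Real.pi))).mul
      tendsto_inv_atTop_zero).sub tendsto_normalCdf_neg_atTop
    rwa [mul_zero, sub_zero] at this
  have h0 : 0 ≤ g w := le_of_tendsto hlim (by
    filter_upwards [eventually_ge_atTop w] with v hv
    exact hanti hw (hw.trans_le hv) hv)
  rw [hg] at h0
  simp only [sub_nonneg] at h0
  rw [normalCdf_neg_eq, div_mul_eq_mul_div] at h0
  have h1 := (div_le_div_iff_of_pos_right hs).1 h0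
  have h2 := le_of_mul_le_mul_left h1 (Real.exp_pos _)
  calc w * millsRatio w ≤ w * w⁻¹ := by gcongr
    _ = 1 := mul_inv_cancel₀ hw.ne'

theorem le_one_add_sq_mul_millsRatio (w : ℝ) : w ≤ (1 + w ^ 2) * millsRatio w := by
  have hs : 0 < Real.sqrt (2 * Real.pi) := by positivity
  set g : ℝ → ℝ := fun w => normalCdf (-w) -
    Real.exp (-w ^ 2 / 2) / Real.sqrt (2 * Real.pi) * (w / (1 + w ^ 2)) with hg
  have hd : ∀ v, HasDerivAt g
      (-(Real.exp (-v ^ 2 / 2) / Real.sqrt (2 * Real.pi) * (2 / (1 + v ^ 2) ^ 2))) v := by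
    intro v
    have h1 : HasDerivAt (fun w : ℝ => Real.exp (-w ^ 2 / 2)) (-(v * Real.exp (-v ^ 2 / 2))) v :=
      (((hasDerivAt_pow 2 v).neg).div_const 2).exp.congr_deriv (by norm_num; ring)
    have h2 : HasDerivAt (fun w : ℝ => w / (1 + w ^ 2)) ((1 * (1 + v ^ 2) - v * (2 * v)) / (1 + v ^ 2) ^ 2) v :=
      ((hasDerivAt_id v).div (((hasDerivAt_pow 2 v).const_add 1).congr_deriv (by simp)) (by positivity))
    refine ((hasDerivAt_normalCdf_neg v).sub ((h1.div_const _).mul h2)).congr_deriv ?_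
    field_simp
    ring
  have hanti : Antitone g := antitone_of_deriv_nonpos (fun v => (hd v).differentiableAt) fun v => by
    rw [(hd v).deriv, neg_nonpos]
    positivity
  have hlim : Tendsto g atTop (𝓝 0) := by
    have h3 : Tendsto (fun v : ℝ => Real.exp (-v ^ 2 / 2) / Real.sqrt (2 * Real.pi) * (v / (1 + v ^ 2)))
        atTop (𝓝 0) := by
      have h4 := tendsto_exp_neg_sq_div_two_atTop.div_const (Real.sqrt (2 * Real.pi))
      rw [zero_div] at h4
      refine squeeze_zero' ?_ ?_ h4
      · filter_upwards [eventually_ge_atTop 0] with v hv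
        positivity
      · filter_upwards [eventually_ge_atTop 0] with v hv
        refine mul_le_of_le_one_right (by positivity) ?_
        rw [div_le_one (by positivity)]
        nlinarith [sq_nonneg (v - 1)]
    have := tendsto_normalCdf_neg_atTop.sub h3
    rwa [sub_zero] at this
  have h0 : 0 ≤ g w := le_of_tendsto hlim (by
    filter_upwards [eventually_ge_atTop w] with v hv
    exact hanti hv)
  rw [hg] at h0
  simp only [sub_nonneg] at h0
  rw [normalCdf_neg_eq, div_mul_eq_mul_div] at h0
  have h1 := (div_le_div_iff_of_pos_right hs).1 h0
  have h2 := le_of_mul_le_mul_left h1 (Real.exp_pos _)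
  rw [div_le_iff₀ (by positivity)] at h2
  linarith

theorem antitone_millsRatio : Antitone millsRatio :=
  antitone_of_deriv_nonpos (fun w => (hasDerivAt_millsRatio w).differentiableAt) fun w => by
    rw [(hasDerivAt_millsRatio w).deriv]
    linarith [mul_millsRatio_le_one w]

theorem monotone_mul_millsRatio : Monotone fun w => w * millsRatio w := by
  have hd : ∀ w, HasDerivAt (fun w => w * millsRatio w)
      (1 * millsRatio w + w * (w * millsRatio w - 1)) w := fun w =>
    (hasDerivAt_id w).mul (hasDerivAt_millsRatio w)
  refine monotone_of_deriv_nonneg (fun w => (hd w).differentiableAt) fun w => ?_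
  rw [(hd w).deriv]
  linarith [le_one_add_sq_mul_millsRatio w]

theorem normalCdf_neg_le {x : ℝ} (hx : 0 < x) :
    Real.sqrt (2 * Real.pi) * normalCdf (-x) ≤ Real.exp (-x ^ 2 / 2) / x := by
  rw [normalCdf_neg_eq, mul_div_cancel₀ _ (by positivity), le_div_iff₀ hx]
  have := mul_millsRatio_le_one x
  nlinarith [Real.exp_pos (-x ^ 2 / 2)]

/-- Solutions of Stein's equation for the indicator of a half line, with the bounds needed for
nonuniform normal approximation. -/
theorem exists_stein_solution {x : ℝ} (hx : 0 < x) :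
    ∃ f γ : ℝ → ℝ, Continuous f ∧ (∀ w, 0 ≤ f w) ∧ (∀ w, f w ≤ 1 / x) ∧ Monotone γ ∧
      (∀ w, 0 ≤ γ w) ∧ (∀ w, γ w ≤ 1) ∧ (∀ w, γ w = w * f w + normalCdf (-x)) ∧
      (∀ w, w ≠ x → HasDerivAt f (γ w - if x < w then 1 else 0) w) ∧
      ∀ w, x / 3 ≤ w → w ≤ x → γ w ≤ Real.exp (-(2 * x / 3 * (x - w))) + normalCdf (-x) := by
  have hQ := normalCdf_nonneg (-x)
  have hQ' := normalCdf_nonneg x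
  have hN := normalCdf_neg x
  set f : ℝ → ℝ := fun w =>
    if w ≤ x then normalCdf (-x) * millsRatio (-w) else normalCdf x * millsRatio w with hf
  set γ : ℝ → ℝ := fun w => w * f w + normalCdf (-x) with hγ
  have hmid : normalCdf (-x) * millsRatio (-x) = normalCdf x * millsRatio x := by
    simp only [millsRatio, neg_neg, neg_sq]; ring
  have hcm : Continuous millsRatio :=
    continuous_iff_continuousAt.2 fun w => (hasDerivAt_millsRatio w).continuousAt
  have hfc : Continuous f := by
    refine Continuous.if_le (by fun_prop) (by fun_prop) continuous_id continuous_const fun w hw => ?_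
    rw [hw, hmid]
  have hf0 : ∀ w, 0 ≤ f w := fun w => by
    rw [hf]; beta_reduce
    split_ifs
    · exact mul_nonneg hQ (millsRatio_nonneg _)
    · exact mul_nonneg hQ' (millsRatio_nonneg _)
  have hm : ∀ w, 0 < w → millsRatio w ≤ 1 / w := fun w hw => by
    rw [le_div_iff₀ hw, mul_comm]; exact mul_millsRatio_le_one w
  have hx1 : normalCdf x * millsRatio x ≤ 1 / x :=
    (mul_le_of_le_one_left (millsRatio_nonneg _) (normalCdf_le_one _)).trans (hm x hx)
  have hfx : ∀ w, f w ≤ 1 / x := fun w => by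
    rw [hf]; beta_reduce
    split_ifs with h
    · refine le_trans ?_ hx1
      rw [← hmid]
      exact mul_le_mul_of_nonneg_left (antitone_millsRatio (neg_le_neg h)) hQ
    · push Not at h
      refine le_trans ?_ hx1
      exact mul_le_mul_of_nonneg_left (antitone_millsRatio h.le) hQ'
  have e1 : ∀ w, w ≤ x → γ w = normalCdf (-x) * (1 - (-w) * millsRatio (-w)) := fun w hw => by
    rw [hγ, hf]; beta_reduce; rw [if_pos hw]; ring
  have e2 : ∀ w, x ≤ w → γ w = normalCdf x * (w * millsRatio w) + normalCdf (-x) := fun w hw => by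
    rcases hw.eq_or_lt with rfl | hw
    · rw [hγ, hf]; beta_reduce; rw [if_pos le_rfl, hmid]; ring
    · rw [hγ, hf]; beta_reduce; rw [if_neg hw.not_ge]; ring
  have m1 : MonotoneOn γ (Set.Iic x) := fun u hu v hv huv => by
    rw [e1 u hu, e1 v hv]
    refine mul_le_mul_of_nonneg_left ?_ hQ
    have := monotone_mul_millsRatio (neg_le_neg huv)
    beta_reduce at this
    linarith
  have m2 : MonotoneOn γ (Set.Ici x) := fun u hu v hv huv => by
    rw [e2 u hu, e2 v hv]
    have := mul_le_mul_of_nonneg_left (monotone_mul_millsRatio huv) hQ'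
    beta_reduce at this
    linarith
  have hmono : Monotone γ := by
    have := m1.Iic_union_Ici m2
    exact this
  refine ⟨f, γ, hfc, hf0, hfx, hmono, fun w => ?_, fun w => ?_, fun w => rfl, fun w hw => ?_,
    fun w h1 h2 => ?_⟩
  · refine le_trans ?_ (hmono (min_le_left w x))
    rw [e1 _ (min_le_right _ _)]
    exact mul_nonneg hQ (sub_nonneg.2 (mul_millsRatio_le_one _))
  · refine (hmono (le_max_left w x)).trans ?_
    rw [e2 _ (le_max_right _ _)]
    have := mul_le_mul_of_nonneg_left (mul_millsRatio_le_one (max w x)) hQ'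
    linarith
  · rcases hw.lt_or_gt with h | h
    · rw [if_neg h.not_gt, sub_zero, e1 w h.le]
      have := ((hasDerivAt_millsRatio (-w)).scomp w (hasDerivAt_neg w)).const_mul (normalCdf (-x))
      refine (this.congr_deriv (by simp)).congr_of_eventuallyEq ?_
      filter_upwards [Iio_mem_nhds h] with v hv
      rw [hf]; beta_reduce; rw [if_pos (le_of_lt hv)]; rfl
    · rw [if_pos h, e2 w h.le]
      have := (hasDerivAt_millsRatio w).const_mul (normalCdf x)
      refine (this.congr_deriv (by rw [hN]; ring)).congr_of_eventuallyEq ?_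
      filter_upwards [Ioi_mem_nhds h] with v hv
      rw [hf]; beta_reduce; rw [if_neg (not_le.2 hv)]
  · have hw : 0 < w := by linarith
    rw [hγ, hf]; beta_reduce
    rw [if_pos h2]
    refine add_le_add_left ?_ _
    rw [millsRatio, neg_neg, neg_sq]
    have hq := normalCdf_neg_le hx
    calc w * (normalCdf (-x) * (Real.sqrt (2 * Real.pi) * Real.exp (w ^ 2 / 2) * normalCdf w))
        = normalCdf w * (w * Real.exp (w ^ 2 / 2) * (Real.sqrt (2 * Real.pi) * normalCdf (-x))) := by ring
      _ ≤ 1 * (w * Real.exp (w ^ 2 / 2) * (Real.exp (-x ^ 2 / 2) / x)) := by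
        gcongr
        exact normalCdf_le_one w
      _ = w / x * Real.exp (w ^ 2 / 2 + -x ^ 2 / 2) := by rw [Real.exp_add]; ring
      _ ≤ 1 * Real.exp (-(2 * x / 3 * (x - w))) := by
        gcongr
        · exact (div_le_one hx).2 h2
        · nlinarith
      _ = _ := one_mul _

/-- The truncated exponential moment generating function `E exp (u min(Y, b))`. -/
noncomputable def truncMgf (ρ : Measure ℝ) (b u : ℝ) : ℝ := ∫ y, Real.exp (u * min y b) ∂ρ

/-- The rate appearing in the differential inequality for `truncMgf`. -/
noncomputable def mgfRate (L a u : ℝ) : ℝ := u + L * (Real.exp (u * a) - 1 - u * a) / a ^ 2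

/-- The primitive of `mgfRate`. -/
noncomputable def mgfExponent (L a u : ℝ) : ℝ :=
  u ^ 2 / 2 + L * (Real.exp (u * a) - 1 - u * a - (u * a) ^ 2 / 2) / a ^ 3

theorem hasDerivAt_mgfExponent {L a : ℝ} (ha : 0 < a) (u : ℝ) :
    HasDerivAt (mgfExponent L a) (mgfRate L a u) u := by
  have h1 : HasDerivAt (fun u => u * a) a u := by simpa using (hasDerivAt_id u).mul_const a
  refine (((hasDerivAt_pow 2 u).div_const 2).add
    (((((h1.exp.sub_const 1).sub h1).sub ((h1.pow 2).div_const 2)).const_mul L).div_const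
      (a ^ 3))).congr_deriv ?_
  rw [mgfRate]
  field_simp
  norm_num
  ring

theorem mgfRate_mono {L a : ℝ} (hL : 0 ≤ L) (ha : 0 ≤ a) {u v : ℝ} (hu : 0 ≤ u) (huv : u ≤ v) :
    mgfRate L a u ≤ mgfRate L a v := by
  have h1 : Real.exp (u * a) - 1 - u * a ≤ Real.exp (v * a) - 1 - v * a := by
    have h2 := Real.add_one_le_exp ((v - u) * a)
    have h3 : Real.exp (v * a) = Real.exp (u * a) * Real.exp ((v - u) * a) := by
      rw [← Real.exp_add]; ring_nf
    have h4 : 1 ≤ Real.exp (u * a) := Real.one_le_exp (by positivity)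
    have h5 : 0 ≤ (v - u) * a := mul_nonneg (sub_nonneg.2 huv) ha
    nlinarith
  unfold mgfRate
  gcongr

theorem le_mgfExponent {L a u : ℝ} (hL : 0 ≤ L) (ha : 0 ≤ a) (hu : 0 ≤ u) :
    u ^ 2 / 2 ≤ mgfExponent L a u := by
  have := Real.quadratic_le_exp_of_nonneg (x := u * a) (by positivity)
  have h : 0 ≤ Real.exp (u * a) - 1 - u * a - (u * a) ^ 2 / 2 := by linarith
  unfold mgfExponent
  have : 0 ≤ L * (Real.exp (u * a) - 1 - u * a - (u * a) ^ 2 / 2) / a ^ 3 := by positivity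
  linarith

theorem exp_mul_min_le {u : ℝ} (hu : 0 ≤ u) (b y : ℝ) : Real.exp (u * min y b) ≤ Real.exp (u * b) :=
  Real.exp_le_exp.2 (mul_le_mul_of_nonneg_left (min_le_right _ _) hu)

theorem integrable_exp_mul_min {ρ : Measure ℝ} [IsFiniteMeasure ρ] {u : ℝ} (hu : 0 ≤ u) (b : ℝ) :
    Integrable (fun y => Real.exp (u * min y b)) ρ :=
  Integrable.of_bound (by fun_prop) (Real.exp (u * b)) (ae_of_all _ fun y => by
    rw [Real.norm_eq_abs, abs_of_pos (Real.exp_pos _)]; exact exp_mul_min_le hu b y)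

theorem integrable_mul_exp_mul_min {ρ : Measure ℝ} {u : ℝ} (hu : 0 ≤ u) (b : ℝ) {f : ℝ → ℝ}
    (hf : Integrable f ρ) : Integrable (fun y => f y * Real.exp (u * min y b)) ρ :=
  hf.mul_bdd (c := Real.exp (u * b)) (by fun_prop) (ae_of_all _ fun y => by
    rw [Real.norm_eq_abs, abs_of_pos (Real.exp_pos _)]; exact exp_mul_min_le hu b y)

theorem continuousOn_truncMgf (ρ : Measure ℝ) [IsFiniteMeasure ρ] {b : ℝ} (hb : 0 ≤ b) (s : ℝ) :
    ContinuousOn (truncMgf ρ b) (Set.Icc 0 s) := by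
  refine continuousOn_of_dominated (bound := fun _ => Real.exp (s * b))
    (fun u _ => (by fun_prop : Measurable _).aestronglyMeasurable)
    (fun u hu => ae_of_all _ fun y => ?_) (integrable_const _)
    (ae_of_all _ fun y => by fun_prop)
  rw [Real.norm_eq_abs, abs_of_pos (Real.exp_pos _)]
  exact (exp_mul_min_le hu.1 b y).trans (Real.exp_le_exp.2 (mul_le_mul_of_nonneg_right hu.2 hb))

theorem hasDerivAt_truncMgf {ρ : Measure ℝ} [IsFiniteMeasure ρ] (hi : Integrable (fun y => y) ρ)
    {b : ℝ} (hb : 0 ≤ b) {u : ℝ} (hu : 0 < u) :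
    HasDerivAt (truncMgf ρ b) (∫ y, min y b * Real.exp (u * min y b) ∂ρ) u := by
  refine (hasDerivAt_integral_of_dominated_loc_of_deriv_le (μ := ρ) (x₀ := u)
    (F := fun u y => Real.exp (u * min y b)) (F' := fun u y => min y b * Real.exp (u * min y b))
    (s := Set.Ioo 0 (u + 1)) (bound := fun y => (|y| + b) * Real.exp ((u + 1) * b))
    (Ioo_mem_nhds hu (by linarith)) (Eventually.of_forall fun v => (by fun_prop : Measurable _).aestronglyMeasurable)
    (integrable_exp_mul_min hu.le b) (by fun_prop) (ae_of_all _ fun y v hv => ?_)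
    ((hi.abs.add (integrable_const b)).mul_const _) (ae_of_all _ fun y v hv => ?_)).2
  · rw [norm_mul, Real.norm_eq_abs, Real.norm_eq_abs, abs_of_pos (Real.exp_pos _)]
    have h1 : |min y b| ≤ |y| + b := by
      rw [abs_le]
      constructor
      · rcases le_total y b with h | h
        · rw [min_eq_left h]; linarith [neg_abs_le y]
        · rw [min_eq_right h]; linarith [abs_nonneg y]
      · linarith [min_le_right y b, abs_nonneg y]
    refine mul_le_mul h1 ?_ (Real.exp_pos _).le (by positivity)
    exact (exp_mul_min_le hv.1.le b y).trans
      (Real.exp_le_exp.2 (mul_le_mul_of_nonneg_right hv.2.le hb))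
  · have h1 : HasDerivAt (fun v => v * min y b) (min y b) v := by
      simpa using (hasDerivAt_id v).mul_const (min y b)
    exact h1.exp.congr_deriv (by ring)

namespace IsCenteredShot

variable {η ρ : Measure ℝ} [IsFiniteMeasure η] [IsProbabilityMeasure ρ] {L : ℝ}

theorem integral_mul_exp_mul_min_le (h : IsCenteredShot η ρ L) {a b u : ℝ} (ha : 0 < a)
    (hu : 0 ≤ u) :
    ∫ y, y * Real.exp (u * min y b) ∂ρ ≤
      mgfRate L a u * truncMgf ρ b u + L / a ^ 2 * Real.exp (u * b) := by
  rw [h.mecke (fun y => Real.exp (u * min y b)) (by fun_prop) ⟨Real.exp (u * b), fun y => by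
    rw [abs_of_pos (Real.exp_pos _)]; exact exp_mul_min_le hu b y⟩]
  set κ := (Real.exp (u * a) - 1 - u * a) / a ^ 2 with hκ
  have hκ0 : 0 ≤ κ := div_nonneg (by linarith [Real.add_one_le_exp (u * a)]) (by positivity)
  have hM := integrable_exp_mul_min (ρ := ρ) hu b
  have hle : ∀ᵐ t ∂η, ∫ y, (Real.exp (u * min (y + t) b) - Real.exp (u * min y b)) ∂ρ ≤
      truncMgf ρ b u * u * t + (truncMgf ρ b u * κ + Real.exp (u * b) / a ^ 2) * t ^ 2 := by
    filter_upwards [h.nonneg] with t ht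
    have hp : ∀ y, Real.exp (u * min (y + t) b) - Real.exp (u * min y b) ≤
        Real.exp (u * min y b) * (u * t + t ^ 2 * κ) + Real.exp (u * b) / a ^ 2 * t ^ 2 := by
      intro y
      have he := Real.exp_pos (u * min y b)
      rcases le_or_gt t a with hta | hta
      · have h1 : Real.exp (u * min (y + t) b) ≤ Real.exp (u * min y b) * Real.exp (u * t) := by
          rw [← Real.exp_add, ← mul_add]
          refine Real.exp_le_exp.2 (mul_le_mul_of_nonneg_left ?_ hu)
          rcases le_total y b with hy | hy
          · rw [min_eq_left hy]; exact min_le_left _ _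
          · rw [min_eq_right hy]; linarith [min_le_right (y + t) b]
        have h2 := exp_mul_le (a := t / a) (y := u * a) (by positivity) ((div_le_one ha).2 hta)
          (by positivity)
        have e1 : t / a * (u * a) = u * t := by field_simp
        have e2 : (t / a) ^ 2 * (Real.exp (u * a) - 1 - u * a) = t ^ 2 * κ := by rw [hκ]; field_simp
        rw [e1, e2] at h2
        have h3 : 0 ≤ Real.exp (u * b) / a ^ 2 * t ^ 2 := by positivity
        nlinarith
      · have h1 := exp_mul_min_le hu b (y + t)
        have h2 : Real.exp (u * b) ≤ Real.exp (u * b) / a ^ 2 * t ^ 2 := by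
          rw [div_mul_eq_mul_div, le_div_iff₀ (by positivity)]
          gcongr
        have h3 : 0 ≤ Real.exp (u * min y b) * (u * t + t ^ 2 * κ) := by positivity
        linarith
    have hMt : Integrable (fun y => Real.exp (u * min (y + t) b)) ρ :=
      Integrable.of_bound (by fun_prop) (Real.exp (u * b)) (ae_of_all _ fun y => by
        rw [Real.norm_eq_abs, abs_of_pos (Real.exp_pos _)]; exact exp_mul_min_le hu b _)
    refine (integral_mono (hMt.sub hM) ((hM.mul_const _).add (integrable_const _)) hp).trans ?_
    simp only [Pi.add_apply]
    rw [integral_add (hM.mul_const _) (integrable_const _), integral_mul_const]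
    simp only [integral_const, probReal_univ, one_smul]
    rw [truncMgf]
    apply le_of_eq; ring
  have i1 := h.integrable_id.const_mul (truncMgf ρ b u * u)
  have i2 := h.integrable_sq.const_mul (truncMgf ρ b u * κ + Real.exp (u * b) / a ^ 2)
  have hge : ∀ᵐ t ∂η, 0 ≤ ∫ y, (Real.exp (u * min (y + t) b) - Real.exp (u * min y b)) ∂ρ := by
    filter_upwards [h.nonneg] with t ht
    refine integral_nonneg fun y => sub_nonneg.2 (Real.exp_le_exp.2
      (mul_le_mul_of_nonneg_left ?_ hu))
    exact min_le_min_right b (by linarith)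
  refine (integral_mono_of_nonneg hge (i1.add i2) hle).trans ?_
  simp only [Pi.add_apply]
  rw [integral_add i1 i2, integral_const_mul, integral_const_mul, h.integral_id, h.integral_sq,
    mgfRate, hκ]
  apply le_of_eq; ring

theorem truncMgf_le (h : IsCenteredShot η ρ L) {a b s : ℝ} (ha : 0 < a) (hb : 0 ≤ b) (hs : 0 ≤ s)
    {B B' : ℝ → ℝ} (hB : ∀ u, HasDerivAt B (B' u) u) (hB0 : 1 ≤ B 0)
    (hle : ∀ u, 0 < u → u < s → mgfRate L a u * B u + L / a ^ 2 * Real.exp (u * b) ≤ B' u) :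
    truncMgf ρ b s ≤ B s := by
  have hd : ∀ u, 0 < u → HasDerivAt
      (fun u => (B u - truncMgf ρ b u) * Real.exp (-mgfExponent L a u))
      (((B' u - ∫ y, min y b * Real.exp (u * min y b) ∂ρ) - mgfRate L a u * (B u - truncMgf ρ b u)) *
        Real.exp (-mgfExponent L a u)) u := fun u hu =>
    (((hB u).sub (hasDerivAt_truncMgf h.integrable_law hb hu)).mul
      (hasDerivAt_mgfExponent ha u).neg.exp).congr_deriv (by simp only [Pi.neg_apply, Pi.sub_apply]; ring)
  have hce : Continuous (mgfExponent L a) :=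
    continuous_iff_continuousAt.2 fun u => (hasDerivAt_mgfExponent ha u).continuousAt
  have hcB : Continuous B := continuous_iff_continuousAt.2 fun u => (hB u).continuousAt
  have hm : MonotoneOn (fun u => (B u - truncMgf ρ b u) * Real.exp (-mgfExponent L a u))
      (Set.Icc 0 s) := by
    refine monotoneOn_of_deriv_nonneg (convex_Icc 0 s) ?_ ?_ ?_
    · exact (hcB.continuousOn.sub (continuousOn_truncMgf ρ hb s)).mul
        (by fun_prop : Continuous _).continuousOn
    · intro u hu
      rw [interior_Icc] at hu
      exact (hd u hu.1).differentiableAt.differentiableWithinAt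
    · intro u hu
      rw [interior_Icc] at hu
      rw [(hd u hu.1).deriv]
      refine mul_nonneg ?_ (Real.exp_pos _).le
      have h1 := h.integral_mul_exp_mul_min_le (b := b) ha hu.1.le
      have h2 : ∫ y, min y b * Real.exp (u * min y b) ∂ρ ≤ ∫ y, y * Real.exp (u * min y b) ∂ρ := by
        refine integral_mono (integrable_mul_exp_mul_min hu.1.le b
          (h.integrable_law.inf (integrable_const b)))
          (integrable_mul_exp_mul_min hu.1.le b h.integrable_law) fun y => ?_
        exact mul_le_mul_of_nonneg_right (min_le_left _ _) (Real.exp_pos _).le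
      have h3 := hle u hu.1 hu.2
      nlinarith
  have h0 := hm (Set.left_mem_Icc.2 hs) (Set.right_mem_Icc.2 hs) hs
  have e0 : truncMgf ρ b 0 = 1 := by simp [truncMgf]
  beta_reduce at h0
  rw [e0] at h0
  have h1 : 0 ≤ (B s - truncMgf ρ b s) * Real.exp (-mgfExponent L a s) :=
    (mul_nonneg (sub_nonneg.2 hB0) (Real.exp_pos _).le).trans h0
  exact sub_nonneg.1 (nonneg_of_mul_nonneg_left h1 (Real.exp_pos _))

theorem truncMgf_le_add (h : IsCenteredShot η ρ L) {a b s : ℝ} (ha : 0 < a) (hb : 0 ≤ b)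
    (hs : 0 ≤ s) (hk : mgfRate L a s < b) :
    truncMgf ρ b s ≤ Real.exp (mgfExponent L a s) +
      L / a ^ 2 / (b - mgfRate L a s) * Real.exp (s * b) := by
  have hLp := h.pos
  set c := L / a ^ 2 / (b - mgfRate L a s) with hc
  have hbk := sub_pos.2 hk
  have hc0 : 0 < c := by positivity
  refine h.truncMgf_le ha hb hs (B := fun u => Real.exp (mgfExponent L a u) + c * Real.exp (u * b))
    (B' := fun u => Real.exp (mgfExponent L a u) * mgfRate L a u + c * (Real.exp (u * b) * b))
    (fun u => ?_) ?_ fun u hu hus => ?_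
  · have h1 : HasDerivAt (fun u => u * b) b u := by simpa using (hasDerivAt_id u).mul_const b
    exact (hasDerivAt_mgfExponent ha u).exp.add (h1.exp.const_mul c)
  · simp [mgfExponent, hc0.le]
  · have h1 := mgfRate_mono (L := L) hLp.le ha.le hu.le hus.le
    have h2 : L / a ^ 2 ≤ c * (b - mgfRate L a u) := by
      have : L / a ^ 2 = c * (b - mgfRate L a s) := by rw [hc, div_mul_cancel₀ _ hbk.ne']
      rw [this]
      gcongr
    nlinarith [Real.exp_pos (u * b), mul_le_mul_of_nonneg_right h2 (Real.exp_pos (u * b)).le]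

theorem truncMgf_self_le (h : IsCenteredShot η ρ L) {a b : ℝ} (ha : 0 < a) (hb : 0 ≤ b) :
    truncMgf ρ b b ≤ Real.exp (mgfExponent L a b) *
      (1 + L / a ^ 2 * Real.exp (b ^ 2 / 2) * b) := by
  have hLp := h.pos
  set c := L / a ^ 2 * Real.exp (b ^ 2 / 2) with hc
  refine h.truncMgf_le ha hb hb (B := fun u => Real.exp (mgfExponent L a u) * (1 + c * u))
    (B' := fun u => Real.exp (mgfExponent L a u) * mgfRate L a u * (1 + c * u) +
      Real.exp (mgfExponent L a u) * c) (fun u => ?_) ?_ fun u hu hus => ?_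
  · have h1 : HasDerivAt (fun u => 1 + c * u) c u := by
      simpa using ((hasDerivAt_id u).const_mul c).const_add 1
    exact (hasDerivAt_mgfExponent ha u).exp.mul h1
  · simp [mgfExponent]
  · have h1 : L / a ^ 2 * Real.exp (u * b) ≤ Real.exp (mgfExponent L a u) * c := by
      have : Real.exp (mgfExponent L a u) * c =
          L / a ^ 2 * Real.exp (mgfExponent L a u + b ^ 2 / 2) := by rw [hc, Real.exp_add]; ring
      rw [this]
      have := le_mgfExponent (L := L) hLp.le ha.le hu.le
      gcongr
      nlinarith [sq_nonneg (u - b)]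
    linarith

end IsCenteredShot

theorem measureReal_Ici_le_truncMgf (ρ : Measure ℝ) [IsFiniteMeasure ρ] {s : ℝ} (hs : 0 ≤ s) (b : ℝ) :
    ρ.real (Set.Ici b) ≤ Real.exp (-(s * b)) * truncMgf ρ b s := by
  have e : ρ.real (Set.Ici b) = ∫ y, (Set.Ici b).indicator (fun _ => 1) y ∂ρ := by
    rw [integral_indicator_const _ measurableSet_Ici, smul_eq_mul, mul_one]
  rw [e, truncMgf, ← integral_const_mul]
  refine integral_mono ((integrable_const _).indicator measurableSet_Ici)
    ((integrable_exp_mul_min hs b).const_mul _) fun y => ?_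
  by_cases hy : y ∈ Set.Ici b
  · rw [Set.indicator_of_mem hy]
    beta_reduce
    rw [min_eq_right hy, ← Real.exp_add]
    simp
  · rw [Set.indicator_of_notMem hy]
    positivity

theorem measureReal_Iic_eq (ρ : Measure ℝ) [IsProbabilityMeasure ρ] (x : ℝ) :
    ρ.real (Set.Iic x) = 1 - ρ.real (Set.Ioi x) := by
  have := probReal_compl_eq_one_sub (μ := ρ) (measurableSet_Ioi (a := x))
  rwa [Set.compl_Ioi] at this

theorem normalCdf_neg_le_exp {x : ℝ} (hx : 4 ≤ x) :
    normalCdf (-x) ≤ 0.1 * Real.exp (-x ^ 2 / 2) := by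
  have h1 := normalCdf_neg_le (x := x) (by linarith)
  have h2 := sqrt_two_pi_bounds.1
  have h3 := normalCdf_nonneg (-x)
  have h4 := Real.exp_pos (-x ^ 2 / 2)
  rw [le_div_iff₀ (by linarith)] at h1
  nlinarith [mul_nonneg h3 (by linarith : (0:ℝ) ≤ x - 4)]

theorem abs_sub_normalCdf_le_of_tails {ρ : Measure ℝ} [IsProbabilityMeasure ρ] {x M : ℝ}
    (h1 : ρ.real (Set.Ici x) ≤ M) (h2 : normalCdf (-x) ≤ M) :
    |ρ.real (Set.Iic x) - normalCdf x| ≤ M := by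
  have h3 : ρ.real (Set.Ioi x) ≤ ρ.real (Set.Ici x) := measureReal_mono Set.Ioi_subset_Ici_self
  have h4 := normalCdf_neg x
  have h5 := normalCdf_nonneg (-x)
  have h6 : 0 ≤ ρ.real (Set.Ioi x) := measureReal_nonneg
  rw [measureReal_Iic_eq, abs_le]
  constructor <;> linarith

namespace IsCenteredShot

variable {η ρ : Measure ℝ} [IsFiniteMeasure η] [IsProbabilityMeasure ρ] {L : ℝ}

theorem measureReal_Ici_le_of_moderate (h : IsCenteredShot η ρ L) {x l : ℝ} (hx : 4 ≤ x)
    (hL : L = l * x ^ 3) (hl : l ≤ 0.0019) (hl' : 0.0877 * Real.exp (-(0.42 * x ^ 2)) ≤ l) :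
    ρ.real (Set.Ici x) ≤ 31.4 * l := by
  have hx0 : 0 < x := by linarith
  have hl0 : 0 < l := lt_of_lt_of_le (by positivity) hl'
  set v := min (Real.log (0.0375 / l)) (0.3 * x ^ 2) with hv
  have hv1 : v ≤ Real.log (0.0375 / l) := min_le_left _ _
  have hv2 : v ≤ 0.3 * x ^ 2 := min_le_right _ _
  have hlog : 2.5 ≤ Real.log (0.0375 / l) := by
    rw [Real.le_log_iff_exp_le (by positivity), le_div_iff₀ hl0]
    have h1 : Real.exp 2.5 ≤ 13 := by
      have h2 := Real.exp_one_lt_d9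
      have h3 : Real.exp 2.5 = Real.exp (1 / 2) ^ 5 := by rw [← Real.exp_nat_mul]; norm_num
      have h4 : Real.exp (1 / 2) ^ 2 = Real.exp 1 := by rw [← Real.exp_nat_mul]; norm_num
      have h5 : Real.exp (1 / 2) ≤ 1.65 := by
        refine le_of_sq_le_sq ?_ (by norm_num)
        rw [h4]; linarith
      rw [h3]
      calc Real.exp (1/2) ^ 5 ≤ 1.65 ^ 5 := pow_le_pow_left₀ (Real.exp_pos _).le h5 5
        _ ≤ 13 := by norm_num
    nlinarith
  have hv0 : 0 ≤ v := le_min (by linarith) (by positivity)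
  have hev : l * Real.exp v ≤ 0.0375 := by
    have : Real.exp v ≤ 0.0375 / l := by
      rw [← Real.exp_log (show 0 < 0.0375 / l by positivity)]
      exact Real.exp_le_exp.2 hv1
    rw [le_div_iff₀ hl0] at this
    linarith
  have ek : mgfRate L (x / 2) (2 * v / x) = 2 * v / x + 4 * (l * (Real.exp v - 1 - v)) * x := by
    rw [mgfRate, hL, show 2 * v / x * (x / 2) = v by field_simp]
    field_simp
    ring
  have eK : mgfExponent L (x / 2) (2 * v / x) =
      2 * v ^ 2 / x ^ 2 + 8 * (l * (Real.exp v - 1 - v - v ^ 2 / 2)) := by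
    rw [mgfExponent, hL, show 2 * v / x * (x / 2) = v by field_simp]
    field_simp
    ring
  have hk : mgfRate L (x / 2) (2 * v / x) ≤ 0.75 * x := by
    rw [ek]
    have h1 : 2 * v / x ≤ 0.6 * x := by rw [div_le_iff₀ hx0]; nlinarith
    have h2 : l * (Real.exp v - 1 - v) ≤ 0.0375 := by nlinarith
    nlinarith
  have hK : mgfExponent L (x / 2) (2 * v / x) ≤ 0.3 + 0.6 * v := by
    rw [eK]
    have h1 : 2 * v ^ 2 / x ^ 2 ≤ 0.6 * v := by rw [div_le_iff₀ (by positivity)]; nlinarith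
    have h2 : l * (Real.exp v - 1 - v - v ^ 2 / 2) ≤ 0.0375 := by
      nlinarith [mul_nonneg hl0.le hv0, mul_nonneg hl0.le (sq_nonneg v)]
    linarith
  have hb := h.truncMgf_le_add (a := x / 2) (b := x) (s := 2 * v / x) (by positivity) hx0.le
    (by positivity) (by linarith)
  have hc : L / (x / 2) ^ 2 / (x - mgfRate L (x / 2) (2 * v / x)) ≤ 16 * l := by
    rw [div_le_iff₀ (by linarith)]
    have : L / (x / 2) ^ 2 = 4 * l * x := by rw [hL]; field_simp; norm_num
    rw [this]
    nlinarith
  have e1 : 2 * v / x * x = 2 * v := by field_simp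
  have h1 := measureReal_Ici_le_truncMgf ρ (s := 2 * v / x) (by positivity) x
  rw [e1] at h1 hb
  have h2 : ρ.real (Set.Ici x) ≤ Real.exp (0.3 - 1.4 * v) + 16 * l := by
    refine h1.trans ((mul_le_mul_of_nonneg_left hb (Real.exp_pos _).le).trans ?_)
    rw [mul_add, ← Real.exp_add]
    refine add_le_add (Real.exp_le_exp.2 (by linarith)) ?_
    rw [mul_left_comm, ← Real.exp_add, neg_add_cancel, Real.exp_zero, mul_one]
    exact hc
  have h3 : Real.exp (0.3 - 1.4 * v) ≤ 15.4 * l := by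
    rcases le_total (Real.log (0.0375 / l)) (0.3 * x ^ 2) with hc | hc
    · rw [min_eq_left hc] at hv
      have e2 : Real.exp (-v) = l / 0.0375 := by
        rw [Real.exp_neg, hv, Real.exp_log (by positivity), inv_div]
      have e3 : Real.exp (0.3 - 1.4 * v) = Real.exp (0.3 - 0.4 * v) * Real.exp (-v) := by
        rw [← Real.exp_add]; ring_nf
      have h4 : Real.exp (0.3 - 0.4 * v) ≤ 0.5775 := by
        have h5 : Real.exp (0.3 - 0.4 * v) ≤ Real.exp (-0.7) := Real.exp_le_exp.2 (by linarith)
        refine h5.trans ?_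
        rw [Real.exp_neg]
        refine inv_le_of_inv_le₀ (by norm_num) ?_
        have := Real.quadratic_le_exp_of_nonneg (x := 0.7) (by norm_num)
        norm_num at this ⊢
        linarith
      rw [e3, e2]
      have : 0 ≤ l / 0.0375 := by positivity
      calc _ ≤ 0.5775 * (l / 0.0375) := by gcongr
        _ = 15.4 * l := by ring
    · rw [min_eq_right hc] at hv
      have e3 : Real.exp (0.3 - 1.4 * v) = Real.exp 0.3 * Real.exp (-(0.42 * x ^ 2)) := by
        rw [← Real.exp_add, hv]; ring_nf
      have h4 : Real.exp 0.3 ≤ 1.35 := by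
        have h5 := Real.exp_bound' (x := 0.3) (by norm_num) (by norm_num) (n := 5) (by norm_num)
        norm_num [Finset.sum_range_succ, Nat.factorial] at h5 ⊢
        linarith
      rw [e3]
      nlinarith [Real.exp_pos (-(0.42 * x ^ 2))]
  linarith

theorem abs_sub_le_of_moderate (h : IsCenteredShot η ρ L) {x l : ℝ} (hx : 4 ≤ x)
    (hL : L = l * x ^ 3) (hl' : 0.0877 * Real.exp (-(0.42 * x ^ 2)) ≤ l) :
    |ρ.real (Set.Iic x) - normalCdf x| ≤ 31.4 * l := by
  have hQ := normalCdf_neg_le_exp hx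
  refine abs_sub_normalCdf_le_of_tails ?_ ?_
  · rcases le_or_gt l 0.0019 with hl | hl
    · exact h.measureReal_Ici_le_of_moderate hx hL hl hl'
    · refine (measureReal_ge_le_cantelli h.integrable_law h.integrable_sq_law h.integral_law
        h.integral_sq_law (by linarith : 0 < x)).1.trans ?_
      rw [div_le_iff₀ (by positivity)]
      nlinarith
  · have : Real.exp (-x ^ 2 / 2) ≤ Real.exp (-(0.42 * x ^ 2)) :=
      Real.exp_le_exp.2 (by nlinarith [sq_nonneg x])
    linarith [Real.exp_pos (-(0.42 * x ^ 2))]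

end IsCenteredShot

theorem mul_sub_le_integral_shift {γ : ℝ → ℝ} (hm : Monotone γ) {t : ℝ} (ht : 0 ≤ t) (p q : ℝ) :
    t * (γ q - γ (p + t)) ≤ (∫ v in (p + t)..(q + t), γ v) - ∫ v in p..q, γ v := by
  have hi : ∀ a b, IntervalIntegrable γ volume a b := fun a b => hm.intervalIntegrable
  rw [intervalIntegral.integral_interval_sub_interval_comm (hi _ _) (hi _ _) (hi _ _)]
  have h1 : t * γ q ≤ ∫ v in q..(q + t), γ v := by
    have := intervalIntegral.integral_mono_on (by linarith) (intervalIntegrable_const (c := γ q))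
      (hi q (q + t)) fun v hv => hm hv.1
    simpa using this
  have h2 : ∫ v in p..(p + t), γ v ≤ t * γ (p + t) := by
    have := intervalIntegral.integral_mono_on (by linarith) (hi p (p + t))
      (intervalIntegrable_const (c := γ (p + t))) fun v hv => hm hv.2
    simpa using this
  rw [intervalIntegral.integral_symm p (p + t), intervalIntegral.integral_symm q (q + t)]
  linarith

theorem integral_le_integral_shift {γ : ℝ → ℝ} (hm : Monotone γ) {t p q : ℝ} (ht : 0 ≤ t)
    (hpq : p ≤ q) : ∫ v in p..q, γ v ≤ ∫ v in (p + t)..(q + t), γ v := by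
  rw [← intervalIntegral.integral_comp_add_right (a := p) (b := q) γ t]
  have hm' : Monotone fun v => γ (v + t) := fun u v huv => hm (by linarith)
  exact intervalIntegral.integral_mono_on hpq hm.intervalIntegrable hm'.intervalIntegrable
    fun v _ => hm (by linarith)

theorem integral_nonneg_and_le {γ : ℝ → ℝ} (hm : Monotone γ) (h0 : ∀ w, 0 ≤ γ w) {p q : ℝ}
    (hpq : p ≤ q) : 0 ≤ ∫ v in p..q, γ v ∧ ∫ v in p..q, γ v ≤ (q - p) * γ q := by
  refine ⟨intervalIntegral.integral_nonneg hpq fun v _ => h0 v, ?_⟩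
  have := intervalIntegral.integral_mono_on (μ := volume) hpq hm.intervalIntegrable
    (intervalIntegrable_const (c := γ q)) fun v hv => hm hv.2
  simpa using this

theorem sub_sq_div_le_min {t τ : ℝ} (hτ : 0 < τ) : t - t ^ 2 / (4 * τ) ≤ min t τ := by
  refine le_min (by linarith [show 0 ≤ t ^ 2 / (4 * τ) by positivity]) ?_
  rw [sub_le_iff_le_add, ← sub_le_iff_le_add', le_div_iff₀ (by positivity)]
  nlinarith [sq_nonneg (t - 2 * τ)]

theorem integrable_comp_monotone {ρ : Measure ℝ} [IsFiniteMeasure ρ] {γ : ℝ → ℝ} (hm : Monotone γ)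
    {C : ℝ} (h0 : ∀ w, 0 ≤ γ w) (h1 : ∀ w, γ w ≤ C) (s : ℝ) : Integrable (fun y => γ (y + s)) ρ :=
  Integrable.of_bound (hm.measurable.comp (measurable_add_const s)).aestronglyMeasurable C
    (ae_of_all _ fun y => by rw [Real.norm_eq_abs, abs_of_nonneg (h0 _)]; exact h1 _)

theorem integrable_posPart_mul {ρ : Measure ℝ} (hi : Integrable (fun y => y) ρ)
    {γ : ℝ → ℝ} (hm : Monotone γ) {C : ℝ} (h0 : ∀ w, 0 ≤ γ w) (h1 : ∀ w, γ w ≤ C) (a : ℝ) :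
    Integrable (fun y => max y 0 * γ (y + a)) ρ :=
  hi.pos_part.mul_bdd (c := C) (hm.measurable.comp (measurable_add_const a)).aestronglyMeasurable
    (ae_of_all _ fun y => by rw [Real.norm_eq_abs, abs_of_nonneg (h0 _)]; exact h1 _)

/-- Averaging a bound on `E[γ(Y + εv) - γ(Y)]`, `ε = ±1`, over `0 ≤ v ≤ t`. -/
theorem integral_intervalIntegral_le {ρ : Measure ℝ} [IsFiniteMeasure ρ] {k : ℝ → ℝ → ℝ}
    (hk : Measurable (Function.uncurry k)) (hb : ∀ v y, |k v y| ≤ 1) {t L c : ℝ} (ht : 0 ≤ t)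
    (hle : ∀ v, 0 ≤ v → v ≤ t → ∫ y, k v y ∂ρ ≤ c * (v + L)) :
    ∫ y, (∫ v in (0:ℝ)..t, k v y) ∂ρ ≤ c * (t ^ 2 / 2 + L * t) := by
  have hint : Integrable (Function.uncurry k) ((volume.restrict (Set.uIoc 0 t)).prod ρ) := by
    rw [Set.uIoc_of_le ht]
    exact Integrable.of_bound hk.aestronglyMeasurable 1 (ae_of_all _ fun p => hb _ _)
  rw [← intervalIntegral_integral_swap hint]
  have hii : IntervalIntegrable (fun v => ∫ y, k v y ∂ρ) volume 0 t := by
    rw [intervalIntegrable_iff]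
    exact hint.integral_prod_left
  refine (intervalIntegral.integral_mono_on ht hii (g := fun v => c * (v + L))
    (Continuous.intervalIntegrable (by fun_prop) _ _) fun v hv => hle v hv.1 hv.2).trans ?_
  rw [intervalIntegral.integral_const_mul, intervalIntegral.integral_add
    (Continuous.intervalIntegrable (by fun_prop) _ _) (Continuous.intervalIntegrable (by fun_prop) _ _)]
  simp
  apply le_of_eq; ring

namespace IsCenteredShot

variable {η ρ : Measure ℝ} [IsFiniteMeasure η] [IsProbabilityMeasure ρ] {L : ℝ}

theorem integral_shift_sub_le (h : IsCenteredShot η ρ L) {γ : ℝ → ℝ} (hm : Monotone γ)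
    (h0 : ∀ w, 0 ≤ γ w) (h1 : ∀ w, γ w ≤ 1) {s a W : ℝ} (hs : 0 ≤ s) (hsa : s ≤ a)
    (hW : ∫ y, max y 0 * γ (y + a) ∂ρ ≤ W) :
    ∫ y, (γ (y + s) - γ y) ∂ρ ≤ 4 / 3 * W * (s + L) := by
  have hL := h.pos
  set H : ℝ → ℝ := fun w => ∫ v in (w - L)..(w + s), γ v with hH
  have hHmono : Monotone H := fun u w huw => by
    have := integral_le_integral_shift hm (sub_nonneg.2 huw) (by linarith : u - L ≤ u + s)
    rw [show u - L + (w - u) = w - L by ring, show u + s + (w - u) = w + s by ring] at this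
    exact this
  have hH0 : ∀ w, 0 ≤ H w := fun w => (integral_nonneg_and_le hm h0 (by linarith)).1
  have hHle : ∀ w, H w ≤ (s + L) * γ (w + s) := fun w => by
    refine (integral_nonneg_and_le hm h0 (by linarith)).2.trans (le_of_eq ?_); ring
  have hH1 : ∀ w, H w ≤ s + L := fun w => (hHle w).trans
    (mul_le_of_le_one_right (by linarith) (h1 _))
  set D := ∫ y, (γ (y + s) - γ y) ∂ρ with hD
  have hD0 : 0 ≤ D := integral_nonneg fun y => sub_nonneg.2 (hm (by linarith))
  have iγ := fun s => integrable_comp_monotone (ρ := ρ) hm h0 h1 s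
  have iγ0 : Integrable γ ρ := by simpa using iγ 0
  have iH := fun s => integrable_comp_monotone (ρ := ρ) hHmono hH0 hH1 s
  have iH0 : Integrable H ρ := by simpa using iH 0
  have hHt : ∀ w t, 0 ≤ t → (t - t ^ 2 / (4 * L)) * (γ (w + s) - γ w) ≤ H (w + t) - H w := by
    intro w t ht
    have hg : 0 ≤ γ (w + s) - γ w := sub_nonneg.2 (hm (by linarith))
    refine (mul_le_mul_of_nonneg_right (sub_sq_div_le_min hL) hg).trans ?_
    set m := min t L with hm'
    have hm0 : 0 ≤ m := le_min ht hL.le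
    have hmL : m ≤ L := min_le_right _ _
    have hmt : m ≤ t := min_le_left _ _
    have h2 := mul_sub_le_integral_shift hm hm0 (w - L) (w + s)
    have h3 : γ (w - L + m) ≤ γ w := hm (by linarith)
    have h4 : H (w + m) ≤ H (w + t) := hHmono (by linarith)
    have h5 : H (w + m) = ∫ v in (w - L + m)..(w + s + m), γ v := by
      rw [hH]; beta_reduce; congr 1 <;> ring
    rw [← h5] at h2
    have h6 : m * (γ (w + s) - γ w) ≤ m * (γ (w + s) - γ (w - L + m)) := by gcongr
    have h7 : H w = ∫ v in (w - L)..(w + s), γ v := rfl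
    linarith
  have hmk := h.mecke H hHmono.measurable ⟨s + L, fun y => by
    rw [abs_of_nonneg (hH0 y)]; exact hH1 y⟩
  have hlow : 3 / 4 * D ≤ ∫ t, ∫ y, (H (y + t) - H y) ∂ρ ∂η := by
    have e : 3 / 4 * D = ∫ t, (t - t ^ 2 / (4 * L)) * D ∂η := by
      rw [integral_mul_const, integral_sub h.integrable_id (h.integrable_sq.div_const _),
        integral_div, h.integral_id, h.integral_sq]
      field_simp; ring
    rw [e]
    refine integral_mono_ae ((h.integrable_id.sub (h.integrable_sq.div_const _)).mul_const _) ?_ ?_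
    · have hmm : Monotone fun t => ∫ y, (H (y + t) - H y) ∂ρ := fun u v huv =>
        integral_mono ((iH u).sub iH0) ((iH v).sub iH0) fun y => by
          have : H (y + u) ≤ H (y + v) := hHmono (by linarith)
          beta_reduce
          linarith
      refine Integrable.of_bound hmm.measurable.aestronglyMeasurable (s + L) (ae_of_all _ fun t => ?_)
      have := norm_integral_le_of_norm_le_const (μ := ρ) (f := fun y => H (y + t) - H y) (C := s + L)
        (ae_of_all _ fun y => by
          rw [Real.norm_eq_abs, abs_le]
          constructor <;> linarith [hH0 y, hH1 y, hH0 (y + t), hH1 (y + t)])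
      simpa using this
    · filter_upwards [h.nonneg] with t ht
      rw [hD, ← integral_const_mul]
      exact integral_mono (((iγ s).sub iγ0).const_mul _) ((iH t).sub iH0) fun y => hHt y t ht
  have hup : ∫ y, y * H y ∂ρ ≤ (s + L) * W := by
    refine le_trans ?_ (mul_le_mul_of_nonneg_left hW (by linarith))
    rw [← integral_const_mul]
    refine integral_mono (h.integrable_law.mul_bdd (c := s + L)
      hHmono.measurable.aestronglyMeasurable (ae_of_all _ fun y => by
        rw [Real.norm_eq_abs, abs_of_nonneg (hH0 y)]; exact hH1 y))
      ((integrable_posPart_mul h.integrable_law hm h0 h1 a).const_mul _) fun y => ?_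
    beta_reduce
    rcases le_total y 0 with hy | hy
    · rw [max_eq_right hy]
      have := hH0 y
      nlinarith
    · rw [max_eq_left hy]
      have h2 : γ (y + s) ≤ γ (y + a) := hm (by linarith)
      calc y * H y ≤ y * ((s + L) * γ (y + a)) := by
            refine mul_le_mul_of_nonneg_left ((hHle y).trans ?_) hy
            exact mul_le_mul_of_nonneg_left h2 (by linarith)
        _ = _ := by ring
  linarith

theorem integral_shift_neg_sub_le (h : IsCenteredShot η ρ L) {γ : ℝ → ℝ} (hm : Monotone γ)
    (h0 : ∀ w, 0 ≤ γ w) (h1 : ∀ w, γ w ≤ 1) {s a W : ℝ} (hs : 0 ≤ s) (hLa : L ≤ a)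
    (hW : ∫ y, max (-y) 0 * γ (-y + a) ∂ρ ≤ W) :
    ∫ y, (γ (-y) - γ (-y - s)) ∂ρ ≤ 4 / 3 * W * (s + L) := by
  have hL := h.pos
  set H : ℝ → ℝ := fun w => ∫ v in (w - s)..(w + L), γ v with hH
  have hHmono : Monotone H := fun u w huw => by
    have := integral_le_integral_shift hm (sub_nonneg.2 huw) (by linarith : u - s ≤ u + L)
    rw [show u - s + (w - u) = w - s by ring, show u + L + (w - u) = w + L by ring] at this
    exact this
  have hH0 : ∀ w, 0 ≤ H w := fun w => (integral_nonneg_and_le hm h0 (by linarith)).1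
  have hHle : ∀ w, H w ≤ (s + L) * γ (w + L) := fun w => by
    refine (integral_nonneg_and_le hm h0 (by linarith)).2.trans (le_of_eq ?_); ring
  have hH1 : ∀ w, H w ≤ s + L := fun w => (hHle w).trans
    (mul_le_of_le_one_right (by linarith) (h1 _))
  set D := ∫ y, (γ (-y) - γ (-y - s)) ∂ρ with hD
  have hD0 : 0 ≤ D := integral_nonneg fun y => sub_nonneg.2 (hm (by linarith))
  have iγ : ∀ s, Integrable (fun y => γ (-y + s)) ρ := fun s =>
    Integrable.of_bound (hm.measurable.comp (by fun_prop)).aestronglyMeasurable 1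
      (ae_of_all _ fun y => by rw [Real.norm_eq_abs, abs_of_nonneg (h0 _)]; exact h1 _)
  have iγ0 : Integrable (fun y => γ (-y)) ρ := by simpa using iγ 0
  have iH : ∀ s, Integrable (fun y => H (-y - s)) ρ := fun t =>
    Integrable.of_bound (hHmono.measurable.comp (by fun_prop)).aestronglyMeasurable (s + L)
      (ae_of_all _ fun y => by rw [Real.norm_eq_abs, abs_of_nonneg (hH0 _)]; exact hH1 _)
  have iH0 : Integrable (fun y => H (-y)) ρ := by simpa using iH 0
  have hHt : ∀ w t, 0 ≤ t → (t - t ^ 2 / (4 * L)) * (γ w - γ (w - s)) ≤ H w - H (w - t) := by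
    intro w t ht
    have hg : 0 ≤ γ w - γ (w - s) := sub_nonneg.2 (hm (by linarith))
    refine (mul_le_mul_of_nonneg_right (sub_sq_div_le_min hL) hg).trans ?_
    set m := min t L with hm'
    have hm0 : 0 ≤ m := le_min ht hL.le
    have hmL : m ≤ L := min_le_right _ _
    have hmt : m ≤ t := min_le_left _ _
    have h2 := mul_sub_le_integral_shift hm hm0 (w - s - m) (w + L - m)
    have h3 : γ w ≤ γ (w + L - m) := hm (by linarith)
    have h4 : H (w - t) ≤ H (w - m) := hHmono (by linarith)
    have h5 : H (w - m) = ∫ v in (w - s - m)..(w + L - m), γ v := by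
      rw [hH]; beta_reduce; congr 1 <;> ring
    rw [← h5, sub_add_cancel, sub_add_cancel] at h2
    have h6 : m * (γ w - γ (w - s)) ≤ m * (γ (w + L - m) - γ (w - s)) := by gcongr
    have h7 : H w = ∫ v in (w - s)..(w + L), γ v := rfl
    linarith
  have hmk := h.mecke (fun y => H (-y)) (hHmono.measurable.comp measurable_neg) ⟨s + L, fun y => by
    rw [abs_of_nonneg (hH0 _)]; exact hH1 _⟩
  have hlow : 3 / 4 * D ≤ ∫ t, ∫ y, (H (-y) - H (-y - t)) ∂ρ ∂η := by
    have e : 3 / 4 * D = ∫ t, (t - t ^ 2 / (4 * L)) * D ∂η := by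
      rw [integral_mul_const, integral_sub h.integrable_id (h.integrable_sq.div_const _),
        integral_div, h.integral_id, h.integral_sq]
      field_simp; ring
    rw [e]
    refine integral_mono_ae ((h.integrable_id.sub (h.integrable_sq.div_const _)).mul_const _) ?_ ?_
    · have hmm : Monotone fun t => ∫ y, (H (-y) - H (-y - t)) ∂ρ := fun u v huv =>
        integral_mono (iH0.sub (iH u)) (iH0.sub (iH v)) fun y => by
          have : H (-y - v) ≤ H (-y - u) := hHmono (by linarith)
          beta_reduce
          linarith
      refine Integrable.of_bound hmm.measurable.aestronglyMeasurable (s + L) (ae_of_all _ fun t => ?_)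
      have := norm_integral_le_of_norm_le_const (μ := ρ) (f := fun y => H (-y) - H (-y - t)) (C := s + L)
        (ae_of_all _ fun y => by
          rw [Real.norm_eq_abs, abs_le]
          constructor <;> linarith [hH0 (-y), hH1 (-y), hH0 (-y - t), hH1 (-y - t)])
      simpa using this
    · filter_upwards [h.nonneg] with t ht
      rw [hD, ← integral_const_mul]
      exact integral_mono ((iγ0.sub (by simpa [sub_eq_add_neg] using iγ (-s))).const_mul _) (iH0.sub (iH t)) fun y => hHt (-y) t ht
  have hneg : ∫ y, y * H (-y) ∂ρ = -∫ y, -y * H (-y) ∂ρ := by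
    rw [← integral_neg]; congr 1; ext y; ring
  have hmk2 : ∫ t, ∫ y, (H (-y) - H (-y - t)) ∂ρ ∂η = ∫ y, -y * H (-y) ∂ρ := by
    rw [hneg] at hmk
    rw [← neg_inj, hmk, ← integral_neg]
    congr 1; ext t
    rw [← integral_neg]
    congr 1; ext y
    rw [neg_add']; ring
  have hup : ∫ y, -y * H (-y) ∂ρ ≤ (s + L) * W := by
    refine le_trans ?_ (mul_le_mul_of_nonneg_left hW (by linarith))
    rw [← integral_const_mul]
    refine integral_mono (h.integrable_law.neg.mul_bdd (c := s + L)
      (hHmono.measurable.comp measurable_neg).aestronglyMeasurable (ae_of_all _ fun y => by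
        rw [Real.norm_eq_abs, abs_of_nonneg (hH0 _)]; exact hH1 _))
      ((h.integrable_law.neg.pos_part.mul_bdd (c := 1)
        (hm.measurable.comp (by fun_prop)).aestronglyMeasurable
        (ae_of_all _ fun y => by
          rw [Function.comp_apply, Real.norm_eq_abs, abs_of_nonneg (h0 _)]; exact h1 _)).const_mul _)
      fun y => ?_
    beta_reduce
    rcases le_total (-y) 0 with hy | hy
    · rw [max_eq_right hy]
      have := hH0 (-y)
      nlinarith
    · rw [max_eq_left hy]
      have h2 : γ (-y + L) ≤ γ (-y + a) := hm (by linarith)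
      calc -y * H (-y) ≤ -y * ((s + L) * γ (-y + a)) := by
            refine mul_le_mul_of_nonneg_left ((hHle (-y)).trans ?_) hy
            exact mul_le_mul_of_nonneg_left h2 (by linarith)
        _ = _ := by ring
  linarith


end IsCenteredShot

/-- Monotone functions with values in `[0, 1]` dominated below `x` by the envelope of the derivative
of Stein's solution. -/
structure IsSteinEnvelope (x : ℝ) (γ : ℝ → ℝ) : Prop where
  mono : Monotone γ
  nonneg : ∀ w, 0 ≤ γ w
  le_one : ∀ w, γ w ≤ 1
  le_exp : ∀ w, x / 3 ≤ w → w ≤ x →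
    γ w ≤ Real.exp (-(2 * x / 3 * (x - w))) + normalCdf (-x)

theorem intervalIntegral_shift_eq {f γ₁ γ₂ : ℝ → ℝ} {x : ℝ} (hf : Continuous f)
    (h1 : Monotone γ₁) (h2 : Monotone γ₂) (hd : ∀ w, w ≠ x → HasDerivAt f (γ₁ w - γ₂ w) w) (p q : ℝ) :
    ∫ v in p..q, (γ₁ v - γ₂ v) = f q - f p :=
  MeasureTheory.integral_eq_of_hasDerivAt_off_countable f _ (Set.countable_singleton x)
    hf.continuousOn (fun v hv => hd v (by simpa using hv.2))
    (h1.intervalIntegrable.sub h2.intervalIntegrable)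

theorem continuous_integral_comp_add {ρ : Measure ℝ} [IsFiniteMeasure ρ] {f : ℝ → ℝ}
    (hf : Continuous f) {C : ℝ} (hb : ∀ w, |f w| ≤ C) : Continuous fun t => ∫ y, f (y + t) ∂ρ :=
  continuous_of_dominated (bound := fun _ => C)
    (fun t => (by fun_prop : Continuous fun y => f (y + t)).aestronglyMeasurable)
    (fun t => ae_of_all _ fun y => hb _) (integrable_const _) (ae_of_all _ fun y => by fun_prop)

namespace IsCenteredShot

variable {η ρ : Measure ℝ} [IsFiniteMeasure η] [IsProbabilityMeasure ρ] {L : ℝ}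

theorem abs_sub_normalCdf_le_of_envelope (h : IsCenteredShot η ρ L) {x V W : ℝ} (hx : 0 < x)
    (hV : ∀ γ, IsSteinEnvelope x γ → ∫ y, γ y ∂ρ ≤ V)
    (hW : ∀ γ, IsSteinEnvelope x γ → ∫ y, max y 0 * γ (y + x / 3) ∂ρ ≤ W) :
    |ρ.real (Set.Iic x) - normalCdf x| ≤ L * (2 * W + 3 * V / x + 9 / x ^ 3) := by
  have hL := h.pos
  obtain ⟨f, γ₁, hfc, hf0, hf1, m1, p1, q1, hγ, hd, henv⟩ := exists_stein_solution hx
  set γ₂ : ℝ → ℝ := fun w => if x < w then 1 else 0 with hγ₂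
  have E1 : IsSteinEnvelope x γ₁ := ⟨m1, p1, q1, henv⟩
  have E2 : IsSteinEnvelope x γ₂ := by
    refine ⟨fun u v huv => ?_, fun w => ?_, fun w => ?_, fun w _ hw => ?_⟩
    · rw [hγ₂]; beta_reduce
      split_ifs with h1 h2 <;> linarith
    · rw [hγ₂]; beta_reduce; split_ifs <;> norm_num
    · rw [hγ₂]; beta_reduce; split_ifs <;> norm_num
    · rw [hγ₂]; beta_reduce; rw [if_neg (not_lt.2 hw)]
      have := normalCdf_nonneg (-x)
      positivity
  have iγ : ∀ γ, IsSteinEnvelope x γ → ∀ s, Integrable (fun y => γ (y + s)) ρ :=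
    fun γ E s => integrable_comp_monotone E.mono E.nonneg E.le_one s
  have iγ0 : ∀ γ, IsSteinEnvelope x γ → Integrable γ ρ := fun γ E => by simpa using iγ γ E 0
  have hfb : ∀ w, |f w| ≤ 1 / x := fun w => by rw [abs_of_nonneg (hf0 w)]; exact hf1 w
  have if' : ∀ s, Integrable (fun y => f (y + s)) ρ := fun s =>
    Integrable.of_bound (by fun_prop : Continuous fun y => f (y + s)).aestronglyMeasurable (1 / x)
      (ae_of_all _ fun y => hfb _)
  have if0 : Integrable f ρ := by simpa using if' 0
  set A := ∫ y, (γ₁ y - γ₂ y) ∂ρ with hA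
  set Ψ : ℝ → ℝ := fun t => ∫ y, (f (y + t) - f y) ∂ρ with hΨ
  have iΨ : Integrable Ψ η := by
    have hc : Continuous Ψ := by
      have : Ψ = fun t => ∫ y, f (y + t) ∂ρ - ∫ y, f y ∂ρ := by
        ext t; exact integral_sub (if' t) if0
      rw [this]
      exact (continuous_integral_comp_add hfc hfb).sub continuous_const
    refine Integrable.of_bound hc.aestronglyMeasurable (1 / x) (ae_of_all _ fun t => ?_)
    have := norm_integral_le_of_norm_le_const (μ := ρ) (f := fun y => f (y + t) - f y) (C := 1 / x)
      (ae_of_all _ fun y => by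
        rw [Real.norm_eq_abs, abs_le]
        constructor <;> linarith [hf0 y, hf1 y, hf0 (y + t), hf1 (y + t)])
    simpa using this
  have hm : ∫ y, y * f y ∂ρ = ∫ t, Ψ t ∂η := h.mecke f hfc.measurable ⟨_, hfb⟩
  have e1 : ρ.real (Set.Iic x) - normalCdf x = A - ∫ t, Ψ t ∂η := by
    rw [← hm, hA, integral_sub (iγ0 _ E1) (iγ0 _ E2)]
    have e2 : ∫ y, γ₂ y ∂ρ = ρ.real (Set.Ioi x) := by
      have : γ₂ = (Set.Ioi x).indicator fun _ => 1 := by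
        ext w; simp only [hγ₂, Set.indicator, Set.mem_Ioi]
      rw [this, integral_indicator_const _ measurableSet_Ioi, smul_eq_mul, mul_one]
    have e3 : ∫ y, γ₁ y ∂ρ = ∫ y, y * f y ∂ρ + normalCdf (-x) := by
      have iyf : Integrable (fun y => y * f y) ρ :=
        h.integrable_law.mul_bdd (c := 1 / x) hfc.aestronglyMeasurable (ae_of_all _ hfb)
      rw [funext hγ, integral_add iyf (integrable_const _)]
      simp
    rw [e2, e3, measureReal_Iic_eq, normalCdf_neg]
    ring
  have e4 : A - ∫ t, Ψ t ∂η = ∫ t, (t * A - Ψ t) ∂η := by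
    rw [integral_sub (h.integrable_id.mul_const _) iΨ, integral_mul_const, h.integral_id, one_mul]
  have hbd : ∀ γ, IsSteinEnvelope x γ → ∀ t, 0 ≤ t → t ≤ x / 3 →
      0 ≤ ∫ y, (∫ v in (0:ℝ)..t, (γ (y + v) - γ y)) ∂ρ ∧
      ∫ y, (∫ v in (0:ℝ)..t, (γ (y + v) - γ y)) ∂ρ ≤ 4 / 3 * W * (t ^ 2 / 2 + L * t) := by
    intro γ E t ht hta
    refine ⟨integral_nonneg fun y => intervalIntegral.integral_nonneg ht fun v hv =>
      sub_nonneg.2 (E.mono (by linarith [hv.1])), ?_⟩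
    refine integral_intervalIntegral_le (k := fun v y => γ (y + v) - γ y) ?_ (fun v y => ?_) ht
      fun v hv hvt => h.integral_shift_sub_le E.mono E.nonneg E.le_one hv (hvt.trans hta) (hW γ E)
    · exact (E.mono.measurable.comp (measurable_snd.add measurable_fst)).sub
        (E.mono.measurable.comp measurable_snd)
    · rw [abs_le]
      constructor <;> linarith [E.nonneg (y + v), E.nonneg y, E.le_one (y + v), E.le_one y]
  have hV0 : ∀ γ, IsSteinEnvelope x γ → 0 ≤ ∫ y, γ y ∂ρ := fun γ E => integral_nonneg E.nonneg
  have hW0 : 0 ≤ W := (integral_nonneg fun y =>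
    mul_nonneg (le_max_right _ _) (E1.nonneg _)).trans (hW γ₁ E1)
  have hVn : 0 ≤ V := (hV0 γ₁ E1).trans (hV γ₁ E1)
  have hAV : |A| ≤ V := by
    rw [hA, integral_sub (iγ0 _ E1) (iγ0 _ E2), abs_le]
    constructor <;> linarith [hV0 _ E1, hV0 _ E2, hV _ E1, hV _ E2]
  have hpt : ∀ᵐ t ∂η, ‖t * A - Ψ t‖ ≤
      (3 * V / x + 9 / x ^ 3 + 2 / 3 * W) * t ^ 2 + 4 / 3 * W * L * t := by
    filter_upwards [h.nonneg] with t ht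
    have z1 : 0 ≤ 3 * V / x := by positivity
    have z2 : 0 ≤ 9 / x ^ 3 := by positivity
    rcases le_or_gt t (x / 3) with hta | hta
    · have e5 : t * A - Ψ t = -(∫ y, (∫ v in (0:ℝ)..t, (γ₁ (y + v) - γ₁ y)) ∂ρ) +
          ∫ y, (∫ v in (0:ℝ)..t, (γ₂ (y + v) - γ₂ y)) ∂ρ := by
        have ii : ∀ γ, IsSteinEnvelope x γ →
            Integrable (fun y => ∫ v in (0:ℝ)..t, (γ (y + v) - γ y)) ρ := by
          intro γ E
          have : Integrable (Function.uncurry fun v y => γ (y + v) - γ y)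
              ((volume.restrict (Set.Ioc 0 t)).prod ρ) :=
            Integrable.of_bound ((E.mono.measurable.comp (measurable_snd.add measurable_fst)).sub
              (E.mono.measurable.comp measurable_snd)).aestronglyMeasurable 1 (ae_of_all _ fun p => by
                simp only [Function.uncurry, Real.norm_eq_abs]
                rw [abs_le]
                constructor <;> linarith [E.nonneg (p.2 + p.1), E.nonneg p.2, E.le_one (p.2 + p.1),
                  E.le_one p.2])
          have := this.integral_prod_right
          simpa only [intervalIntegral.integral_of_le ht, Function.uncurry] using this
        have iA : Integrable (fun y => t * (γ₁ y - γ₂ y)) ρ :=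
          ((iγ0 _ E1).sub (iγ0 _ E2)).const_mul _
        have iF : Integrable (fun y => f (y + t) - f y) ρ := (if' t).sub if0
        have iN : Integrable (fun y => -∫ v in (0:ℝ)..t, (γ₁ (y + v) - γ₁ y)) ρ := (ii _ E1).neg
        rw [hA, hΨ, ← integral_const_mul]
        beta_reduce
        rw [← integral_sub iA iF, ← integral_neg, ← integral_add iN (ii _ E2)]
        congr 1; ext y
        have h3 := intervalIntegral_shift_eq hfc E1.mono E2.mono hd y (y + t)
        have h4 := intervalIntegral.integral_comp_add_left (a := 0) (b := t) (fun v => γ₁ v - γ₂ v) y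
        rw [add_zero] at h4
        rw [← h3, ← h4]
        have j : ∀ γ, IsSteinEnvelope x γ → IntervalIntegrable (fun v => γ (y + v)) volume 0 t :=
          fun γ E => Monotone.intervalIntegrable fun u v huv => E.mono (by linarith)
        rw [intervalIntegral.integral_sub (j _ E1) (j _ E2),
          intervalIntegral.integral_sub (j _ E1) intervalIntegrable_const,
          intervalIntegral.integral_sub (j _ E2) intervalIntegrable_const]
        simp
        ring
      have b1 := hbd _ E1 t ht hta
      have b2 := hbd _ E2 t ht hta
      have z3 : 0 ≤ (3 * V / x + 9 / x ^ 3) * t ^ 2 := by positivity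
      rw [e5, Real.norm_eq_abs, abs_le]
      constructor <;> linarith [b1.1, b1.2, b2.1, b2.2]
    · have c1 : |Ψ t| ≤ 1 / x := by
        have := norm_integral_le_of_norm_le_const (μ := ρ) (f := fun y => f (y + t) - f y) (C := 1 / x)
          (ae_of_all _ fun y => by
            rw [Real.norm_eq_abs, abs_le]
            constructor <;> linarith [hf0 y, hf1 y, hf0 (y + t), hf1 (y + t)])
        simpa using this
      have c2 : |t * A| ≤ t * V := by rw [abs_mul, abs_of_nonneg ht]; gcongr
      have c3 : t * V ≤ 3 * V / x * t ^ 2 := by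
        rw [div_mul_eq_mul_div, le_div_iff₀ hx]
        nlinarith [mul_nonneg (mul_nonneg ht hVn) (by linarith : 0 ≤ 3 * t - x)]
      have c4 : 1 / x ≤ 9 / x ^ 3 * t ^ 2 := by
        rw [div_mul_eq_mul_div, div_le_div_iff₀ hx (by positivity)]
        have : x ^ 2 ≤ 9 * t ^ 2 := by nlinarith
        nlinarith
      have c5 : 0 ≤ 2 / 3 * W * t ^ 2 + 4 / 3 * W * L * t := by positivity
      rw [Real.norm_eq_abs]
      have := abs_sub (t * A) (Ψ t)
      linarith
  rw [e1, e4, ← Real.norm_eq_abs]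
  have i1 := h.integrable_sq.const_mul (3 * V / x + 9 / x ^ 3 + 2 / 3 * W)
  have i2 := h.integrable_id.const_mul (4 / 3 * W * L)
  refine (norm_integral_le_of_norm_le (i1.add i2) hpt).trans ?_
  simp only [Pi.add_apply]
  rw [integral_add i1 i2, integral_const_mul, integral_const_mul, h.integral_sq, h.integral_id]
  apply le_of_eq; ring

theorem abs_sub_normalCdf_neg_le_of_envelope (h : IsCenteredShot η ρ L) {x W : ℝ} (hx : 0 < x)
    (hLx : L ≤ x / 3)
    (hW : ∀ γ, IsSteinEnvelope x γ → ∫ y, max (-y) 0 * γ (-y + x / 3) ∂ρ ≤ W) :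
    |ρ.real (Set.Iic (-x)) - normalCdf (-x)| ≤ 2 * L * W := by
  have hL := h.pos
  obtain ⟨f, γ₁, hfc, hf0, hf1, m1, p1, q1, hγ, hd, henv⟩ := exists_stein_solution hx
  have E1 : IsSteinEnvelope x γ₁ := ⟨m1, p1, q1, henv⟩
  have iγ : ∀ γ, IsSteinEnvelope x γ → ∀ s, Integrable (fun y => γ (-y + s)) ρ :=
    fun γ E s => Integrable.of_bound (E.mono.measurable.comp (by fun_prop)).aestronglyMeasurable 1
      (ae_of_all _ fun y => by
        rw [Real.norm_eq_abs, abs_of_nonneg (E.nonneg _)]; exact E.le_one _)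
  set γ₂ : ℝ → ℝ := fun w => if x ≤ w then 1 else 0 with hγ₂
  have E2 : IsSteinEnvelope x γ₂ := by
    refine ⟨fun u v huv => ?_, fun w => ?_, fun w => ?_, fun w _ hw => ?_⟩
    · rw [hγ₂]; beta_reduce
      split_ifs with h1 h2 <;> linarith
    · rw [hγ₂]; beta_reduce; split_ifs <;> norm_num
    · rw [hγ₂]; beta_reduce; split_ifs <;> norm_num
    · have := normalCdf_nonneg (-x)
      rw [hγ₂]; beta_reduce
      split_ifs with h1
      · rw [le_antisymm hw h1, sub_self, mul_zero, neg_zero, Real.exp_zero]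
        linarith
      · positivity
  have hd2 : ∀ w, w ≠ x → HasDerivAt f (γ₁ w - γ₂ w) w := fun w hw => by
    have : (if x < w then (1:ℝ) else 0) = γ₂ w := by
      rw [hγ₂]; beta_reduce
      rcases hw.lt_or_gt with h1 | h1
      · rw [if_neg h1.not_gt, if_neg h1.not_ge]
      · rw [if_pos h1, if_pos h1.le]
    rw [← this]
    exact hd w hw
  have iγ0 : ∀ γ, IsSteinEnvelope x γ → Integrable (fun y => γ (-y)) ρ := fun γ E => by
    simpa using iγ γ E 0
  have hfb : ∀ w, |f w| ≤ 1 / x := fun w => by rw [abs_of_nonneg (hf0 w)]; exact hf1 w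
  have if' : ∀ s, Integrable (fun y => f (-y - s)) ρ := fun s =>
    Integrable.of_bound (by fun_prop : Continuous fun y => f (-y - s)).aestronglyMeasurable (1 / x)
      (ae_of_all _ fun y => hfb _)
  have if0 : Integrable (fun y => f (-y)) ρ := by simpa using if' 0
  set A := ∫ y, (γ₁ (-y) - γ₂ (-y)) ∂ρ with hA
  set Ψ : ℝ → ℝ := fun t => ∫ y, (f (-y) - f (-y - t)) ∂ρ with hΨ
  have iΨ : Integrable Ψ η := by
    have hc : Continuous Ψ := by
      have : Ψ = fun t => ∫ y, f (-y) ∂ρ - ∫ y, f (-(y + t)) ∂ρ := by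
        ext t
        simp only [neg_add']
        exact integral_sub if0 (if' t)
      rw [this]
      exact continuous_const.sub (continuous_integral_comp_add (f := fun w => f (-w))
        (by fun_prop) fun w => hfb _)
    refine Integrable.of_bound hc.aestronglyMeasurable (1 / x) (ae_of_all _ fun t => ?_)
    have := norm_integral_le_of_norm_le_const (μ := ρ) (f := fun y => f (-y) - f (-y - t)) (C := 1 / x)
      (ae_of_all _ fun y => by
        rw [Real.norm_eq_abs, abs_le]
        constructor <;> linarith [hf0 (-y), hf1 (-y), hf0 (-y - t), hf1 (-y - t)])
    simpa using this
  have hm : ∫ y, -y * f (-y) ∂ρ = ∫ t, Ψ t ∂η := by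
    have := h.mecke (fun y => f (-y)) (by fun_prop) ⟨_, fun y => hfb (-y)⟩
    have e : ∫ y, -y * f (-y) ∂ρ = -∫ y, y * f (-y) ∂ρ := by
      rw [← integral_neg]; congr 1; ext y; ring
    rw [e, this, ← integral_neg]
    congr 1; ext t
    rw [hΨ, ← integral_neg]
    congr 1; ext y
    rw [neg_add']; ring
  have e1 : normalCdf (-x) - ρ.real (Set.Iic (-x)) = A - ∫ t, Ψ t ∂η := by
    rw [← hm, hA, integral_sub (iγ0 _ E1) (iγ0 _ E2)]
    have e2 : ∫ y, γ₂ (-y) ∂ρ = ρ.real (Set.Iic (-x)) := by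
      have : (fun y => γ₂ (-y)) = (Set.Iic (-x)).indicator fun _ => 1 := by
        ext w; simp only [hγ₂, Set.indicator, Set.mem_Iic, le_neg]
      rw [this, integral_indicator_const _ measurableSet_Iic, smul_eq_mul, mul_one]
    have e3 : ∫ y, γ₁ (-y) ∂ρ = ∫ y, -y * f (-y) ∂ρ + normalCdf (-x) := by
      have iyf : Integrable (fun y => -y * f (-y)) ρ :=
        h.integrable_law.neg.mul_bdd (c := 1 / x)
          (by fun_prop : Continuous fun y => f (-y)).aestronglyMeasurable (ae_of_all _ fun y => hfb _)
      simp_rw [hγ]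
      rw [integral_add iyf (integrable_const _)]
      simp
    rw [e2, e3]
    ring
  have e4 : A - ∫ t, Ψ t ∂η = ∫ t, (t * A - Ψ t) ∂η := by
    rw [integral_sub (h.integrable_id.mul_const _) iΨ, integral_mul_const, h.integral_id, one_mul]
  have hmeas : ∀ γ, IsSteinEnvelope x γ →
      Measurable (Function.uncurry fun v y => γ (-y) - γ (-y - v)) := fun γ E =>
    (E.mono.measurable.comp measurable_snd.neg).sub
      (E.mono.measurable.comp (measurable_snd.neg.sub measurable_fst))
  have hbd : ∀ γ, IsSteinEnvelope x γ → ∀ t, 0 ≤ t →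
      0 ≤ ∫ y, (∫ v in (0:ℝ)..t, (γ (-y) - γ (-y - v))) ∂ρ ∧
      ∫ y, (∫ v in (0:ℝ)..t, (γ (-y) - γ (-y - v))) ∂ρ ≤ 4 / 3 * W * (t ^ 2 / 2 + L * t) := by
    intro γ E t ht
    refine ⟨integral_nonneg fun y => intervalIntegral.integral_nonneg ht fun v hv =>
      sub_nonneg.2 (E.mono (by linarith [hv.1])), ?_⟩
    refine integral_intervalIntegral_le (k := fun v y => γ (-y) - γ (-y - v)) (hmeas γ E)
      (fun v y => ?_) ht
      fun v hv hvt => h.integral_shift_neg_sub_le E.mono E.nonneg E.le_one hv hLx (hW γ E)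
    rw [abs_le]
    constructor <;> linarith [E.nonneg (-y - v), E.nonneg (-y), E.le_one (-y - v), E.le_one (-y)]
  have hpt : ∀ᵐ t ∂η, ‖t * A - Ψ t‖ ≤ 2 / 3 * W * t ^ 2 + 4 / 3 * W * L * t := by
    filter_upwards [h.nonneg] with t ht
    have e5 : t * A - Ψ t = ∫ y, (∫ v in (0:ℝ)..t, (γ₁ (-y) - γ₁ (-y - v))) ∂ρ -
        ∫ y, (∫ v in (0:ℝ)..t, (γ₂ (-y) - γ₂ (-y - v))) ∂ρ := by
      have ii : ∀ γ, IsSteinEnvelope x γ →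
          Integrable (fun y => ∫ v in (0:ℝ)..t, (γ (-y) - γ (-y - v))) ρ := by
        intro γ E
        have : Integrable (Function.uncurry fun v y => γ (-y) - γ (-y - v))
            ((volume.restrict (Set.Ioc 0 t)).prod ρ) :=
          Integrable.of_bound (hmeas γ E).aestronglyMeasurable 1 (ae_of_all _ fun p => by
              simp only [Function.uncurry, Real.norm_eq_abs]
              rw [abs_le]
              constructor <;> linarith [E.nonneg (-p.2 - p.1), E.nonneg (-p.2), E.le_one (-p.2 - p.1),
                E.le_one (-p.2)])
        have := this.integral_prod_right
        simpa only [intervalIntegral.integral_of_le ht, Function.uncurry] using this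
      have iA : Integrable (fun y => t * (γ₁ (-y) - γ₂ (-y))) ρ :=
        ((iγ0 _ E1).sub (iγ0 _ E2)).const_mul _
      have iF : Integrable (fun y => f (-y) - f (-y - t)) ρ := if0.sub (if' t)
      rw [hA, hΨ, ← integral_const_mul]
      beta_reduce
      rw [← integral_sub iA iF, ← integral_sub (ii _ E1) (ii _ E2)]
      congr 1; ext y
      have h3 := intervalIntegral_shift_eq hfc E1.mono E2.mono hd2 (-y - t) (-y)
      have h4 := intervalIntegral.integral_comp_sub_left (a := 0) (b := t) (fun v => γ₁ v - γ₂ v) (-y)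
      rw [sub_zero] at h4
      rw [← h3, ← h4]
      have j : ∀ γ, IsSteinEnvelope x γ → IntervalIntegrable (fun v => γ (-y - v)) volume 0 t :=
        fun γ E => Antitone.intervalIntegrable fun u v huv => E.mono (by linarith)
      rw [intervalIntegral.integral_sub (j _ E1) (j _ E2),
        intervalIntegral.integral_sub intervalIntegrable_const (j _ E1),
        intervalIntegral.integral_sub intervalIntegrable_const (j _ E2)]
      simp
      ring
    have b1 := hbd _ E1 t ht
    have b2 := hbd _ E2 t ht
    rw [e5, Real.norm_eq_abs, abs_le]
    constructor <;> linarith [b1.1, b1.2, b2.1, b2.2]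
  rw [abs_sub_comm, e1, e4, ← Real.norm_eq_abs]
  have i1 := h.integrable_sq.const_mul (2 / 3 * W)
  have i2 := h.integrable_id.const_mul (4 / 3 * W * L)
  refine (norm_integral_le_of_norm_le (i1.add i2) hpt).trans ?_
  simp only [Pi.add_apply]
  rw [integral_add i1 i2, integral_const_mul, integral_const_mul, h.integral_sq, h.integral_id]
  apply le_of_eq; ring

end IsCenteredShot

theorem exp_bounds_of_small {s l : ℝ} (hs : 32 / 9 ≤ s) (hl0 : 0 ≤ l)
    (hl : l ≤ 0.0877 * Real.exp (-(1.89 * s))) :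
    l * Real.exp s ≤ 0.00373 ∧ s * (l * Real.exp s) ≤ 0.0133 ∧ s ^ 2 ≤ 0.371 * Real.exp s ∧
      34 ≤ Real.exp s := by
  have he1 := Real.exp_one_gt_d9
  have he3 : 20.08 ≤ Real.exp 3 := by
    have : Real.exp 3 = Real.exp 1 ^ 3 := by rw [← Real.exp_nat_mul]; norm_num
    rw [this]
    calc (20.08 : ℝ) ≤ 2.7182 ^ 3 := by norm_num
      _ ≤ _ := pow_le_pow_left₀ (by norm_num) (by linarith) 3
  have h1 : 23.6 * (1 + 0.89 * (s - 32 / 9)) ≤ Real.exp (0.89 * s) := by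
    have e : Real.exp (0.89 * s) = Real.exp 3 * Real.exp 0.164 * Real.exp (0.89 * s - 3.164) := by
      rw [← Real.exp_add, ← Real.exp_add]; ring_nf
    have h2 : 1.1774 ≤ Real.exp 0.164 := by
      have := Real.quadratic_le_exp_of_nonneg (x := 0.164) (by norm_num)
      norm_num at this ⊢; linarith
    have h3 := Real.add_one_le_exp (0.89 * s - 3.164)
    rw [e]
    have h4 : 23.6 ≤ Real.exp 3 * Real.exp 0.164 := by nlinarith
    have h5 : 0 ≤ 1 + 0.89 * (s - 32 / 9) := by linarith
    exact mul_le_mul h4 (by linarith) h5 (by positivity)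
  have hp : l * Real.exp s * Real.exp (0.89 * s) ≤ 0.0877 := by
    have e : Real.exp s * Real.exp (0.89 * s) * Real.exp (-(1.89 * s)) = 1 := by
      rw [← Real.exp_add, ← Real.exp_add, ← Real.exp_zero]; ring_nf
    have hE : 0 < Real.exp s * Real.exp (0.89 * s) := by positivity
    nlinarith [mul_le_mul_of_nonneg_right hl hE.le]
  have hp0 : 0 ≤ l * Real.exp s := by positivity
  have h7 : l * Real.exp s * (23.6 * (1 + 0.89 * (s - 32 / 9))) ≤ 0.0877 :=
    (mul_le_mul_of_nonneg_left h1 hp0).trans hp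
  have hd : 0 ≤ l * Real.exp s * (s - 32 / 9) := mul_nonneg hp0 (by linarith)
  have h35 : 33.09 ≤ Real.exp 3.5 := by
    have e : Real.exp 3.5 = Real.exp 3 * Real.exp 0.5 := by
      rw [← Real.exp_add]; norm_num
    have h2 := Real.sum_le_exp_of_nonneg (x := 0.5) (by norm_num) 6
    norm_num [Finset.sum_range_succ, Nat.factorial] at h2
    rw [e]; norm_num at h2 ⊢; nlinarith
  have h8 : Real.exp s = Real.exp 3.5 * Real.exp (s - 3.5) := by
    rw [← Real.exp_add]; ring_nf
  have h9 := Real.quadratic_le_exp_of_nonneg (x := s - 3.5) (by linarith)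
  have h10 : 33.09 * (1 + (s - 3.5) + (s - 3.5) ^ 2 / 2) ≤ Real.exp s := by
    rw [h8]
    exact mul_le_mul h35 h9 (by nlinarith) (by positivity)
  refine ⟨by nlinarith, by nlinarith, by nlinarith, by nlinarith⟩

theorem stein_numeric_bound {x s e Q : ℝ} (hx : 4 ≤ x) (hs : s = 2 * x ^ 2 / 9) (hse : s ^ 2 ≤ 0.371 * e)
    (he : 34 ≤ e) (hQ : Q ≤ 0.1 * (1 / e ^ 2)) :
    2 * (1.0912 * x * (1 / e) + 1 / e ^ 2 + Q) + 3 * (1 / e ^ 2 + 1.51 * (1 / e) + Q) / x + 9 / x ^ 3 ≤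
      31.4 / x ^ 3 := by
  have hx0 : 0 < x := by linarith
  have he0 : 0 < e := by linarith
  have hx2 : x ^ 2 = 4.5 * s := by rw [hs]; ring
  have hs0 : 32 / 9 ≤ s := by rw [hs]; nlinarith
  have h1 : x ^ 4 * (1 / e) ≤ 7.513 := by
    rw [mul_one_div, div_le_iff₀ he0, show x ^ 4 = (x ^ 2) ^ 2 by ring, hx2]
    nlinarith
  have h0 : 0 ≤ 1 / e := by positivity
  have h34 : 1 / e ≤ 1 / 34 := one_div_le_one_div_of_le (by norm_num) he
  have h2 : x ^ 2 * (1 / e) ≤ 0.4696 := by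
    have : 16 ≤ x ^ 2 := by nlinarith
    have h3 : x ^ 2 * (1 / e) * 16 ≤ x ^ 2 * (1 / e) * x ^ 2 := by gcongr
    nlinarith
  have h3 : x ^ 3 * (1 / e) ≤ 1.8783 := by
    have h3 : x ^ 3 * (1 / e) * 4 ≤ x ^ 3 * (1 / e) * x := by gcongr
    nlinarith
  have e2 : 1 / e ^ 2 = 1 / e * (1 / e) := by field_simp
  have h4 : x ^ 3 * (1 / e ^ 2) ≤ 0.0553 := by
    rw [e2, ← mul_assoc]
    calc x ^ 3 * (1 / e) * (1 / e) ≤ 1.8783 * (1 / 34) := by gcongr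
      _ ≤ _ := by norm_num
  have h5 : x ^ 2 * (1 / e ^ 2) ≤ 0.0139 := by
    rw [e2, ← mul_assoc]
    calc x ^ 2 * (1 / e) * (1 / e) ≤ 0.4696 * (1 / 34) := by gcongr
      _ ≤ _ := by norm_num
  have h6 : x ^ 3 * Q ≤ 0.1 * (x ^ 3 * (1 / e ^ 2)) := by
    rw [mul_left_comm]; gcongr
  have h7 : x ^ 2 * Q ≤ 0.1 * (x ^ 2 * (1 / e ^ 2)) := by
    rw [mul_left_comm]; gcongr
  rw [le_div_iff₀ (by positivity)]
  have e3 : (2 * (1.0912 * x * (1 / e) + 1 / e ^ 2 + Q) + 3 * (1 / e ^ 2 + 1.51 * (1 / e) + Q) / x +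
      9 / x ^ 3) * x ^ 3 = 2.1824 * (x ^ 4 * (1 / e)) + 2 * (x ^ 3 * (1 / e ^ 2)) + 2 * (x ^ 3 * Q) +
      3 * (x ^ 2 * (1 / e ^ 2)) + 4.53 * (x ^ 2 * (1 / e)) + 3 * (x ^ 2 * Q) + 9 := by
    field_simp; ring
  rw [e3]
  linarith

theorem IsSteinEnvelope.le_add_exp_mul_min {x : ℝ} {γ : ℝ → ℝ} (E : IsSteinEnvelope x γ) (w : ℝ)
    (hx : 0 < x) :
    γ w ≤ Real.exp (-(2 * x / 3 * (2 * x / 3))) * (1 + Real.exp (2 * x / 3 * min w (2 * x / 3))) +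
      normalCdf (-x) := by
  have hQ := normalCdf_nonneg (-x)
  have h0 := Real.exp_pos (-(2 * x / 3 * (2 * x / 3)))
  rw [mul_add, mul_one, ← Real.exp_add]
  rcases le_total (2 * x / 3) w with h | h
  · rw [min_eq_right h, neg_add_cancel, Real.exp_zero]
    linarith [E.le_one w]
  · rw [min_eq_left h]
    rcases le_total (x / 3) w with h' | h'
    · refine (E.le_exp w h' (by linarith)).trans ?_
      have : Real.exp (-(2 * x / 3 * (x - w))) ≤
          Real.exp (-(2 * x / 3 * (2 * x / 3)) + 2 * x / 3 * w) :=
        Real.exp_le_exp.2 (by nlinarith)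
      linarith
    · refine (E.mono h').trans ((E.le_exp (x / 3) le_rfl (by linarith)).trans ?_)
      have e : -(2 * x / 3 * (x - x / 3)) = -(2 * x / 3 * (2 * x / 3)) := by ring
      rw [e]
      have := Real.exp_pos (-(2 * x / 3 * (2 * x / 3)) + 2 * x / 3 * w)
      linarith

theorem IsSteinEnvelope.shift_le_exp_mul_min {x : ℝ} {γ : ℝ → ℝ} (E : IsSteinEnvelope x γ) {w : ℝ}
    (hw : 0 ≤ w) :
    γ (w + x / 3) ≤ Real.exp (-(2 * x / 3 * (2 * x / 3))) * Real.exp (2 * x / 3 * min w (2 * x / 3)) +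
      normalCdf (-x) := by
  have hQ := normalCdf_nonneg (-x)
  rw [← Real.exp_add]
  rcases le_total (2 * x / 3) w with h | h
  · rw [min_eq_right h, neg_add_cancel, Real.exp_zero]
    linarith [E.le_one (w + x / 3)]
  · rw [min_eq_left h]
    refine (E.le_exp (w + x / 3) (by linarith) (by linarith)).trans (le_of_eq ?_)
    congr 2; ring

namespace IsCenteredShot

variable {η ρ : Measure ℝ} [IsFiniteMeasure η] [IsProbabilityMeasure ρ] {L : ℝ}

theorem integral_abs_law_le_one (h : IsCenteredShot η ρ L) : ∫ y, |y| ∂ρ ≤ 1 := by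
  have h1 : ∫ y, |y| ∂ρ ≤ ∫ y, (1 / 2 + 1 / 2 * y ^ 2) ∂ρ :=
    integral_mono h.integrable_law.abs
      ((integrable_const _).add (h.integrable_sq_law.const_mul _)) fun y => by
        beta_reduce; nlinarith [sq_nonneg (|y| - 1), sq_abs y]
  rw [integral_add (integrable_const _) (h.integrable_sq_law.const_mul _), integral_const_mul,
    h.integral_sq_law] at h1
  simp only [integral_const, probReal_univ, one_smul] at h1
  linarith

theorem integral_pos_mul_exp_le (h : IsCenteredShot η ρ L) {b : ℝ} (hb : 0 ≤ b) :
    ∫ y, max y 0 * Real.exp (b * min y b) ∂ρ ≤ ∫ y, y * Real.exp (b * min y b) ∂ρ + 1 := by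
  have h1 : ∫ y, max y 0 * Real.exp (b * min y b) ∂ρ ≤
      ∫ y, (y * Real.exp (b * min y b) + |y|) ∂ρ := by
    refine integral_mono (integrable_mul_exp_mul_min hb b (h.integrable_law.sup (integrable_const 0)))
      ((integrable_mul_exp_mul_min hb b h.integrable_law).add h.integrable_law.abs) fun y => ?_
    beta_reduce
    rcases le_total 0 y with hy | hy
    · rw [max_eq_left hy]; linarith [abs_nonneg y]
    · rw [max_eq_right hy, abs_of_nonpos hy, zero_mul]
      have h2 : Real.exp (b * min y b) ≤ 1 := by
        rw [Real.exp_le_one_iff, min_eq_left (hy.trans hb)]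
        exact mul_nonpos_of_nonneg_of_nonpos hb hy
      nlinarith
  rw [integral_add (integrable_mul_exp_mul_min hb b h.integrable_law) h.integrable_law.abs] at h1
  linarith [h.integral_abs_law_le_one]

theorem abs_sub_le_of_stein (h : IsCenteredShot η ρ L) {x l : ℝ} (hx : 4 ≤ x)
    (hL : L = l * x ^ 3) (hl : l ≤ 0.0877 * Real.exp (-(0.42 * x ^ 2))) :
    |ρ.real (Set.Iic x) - normalCdf x| ≤ 31.4 * l := by
  have hx0 : 0 < x := by linarith
  have hLp := h.pos
  have hl0 : 0 < l := by
    rw [hL] at hLp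
    exact pos_of_mul_pos_left hLp (by positivity)
  obtain ⟨s, hs⟩ : ∃ s, s = 2 * x ^ 2 / 9 := ⟨_, rfl⟩
  obtain ⟨p1, p2, p3, p4⟩ := exp_bounds_of_small (s := s) (l := l) (by rw [hs]; nlinarith) hl0.le
    (by convert hl using 3; rw [hs]; ring)
  have es : 2 * x / 3 * (x / 3) = s := by rw [hs]; ring
  have es2 : 2 * x / 3 * (2 * x / 3) = 2 * s := by rw [hs]; ring
  have es3 : (2 * x / 3) ^ 2 / 2 = s := by rw [hs]; ring
  have hs0 : 0 ≤ s := by rw [hs]; positivity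
  set e := Real.exp s with he
  have he0 : 0 < e := Real.exp_pos s
  have ee : Real.exp (2 * s) = e ^ 2 := by rw [he, ← Real.exp_nat_mul]; norm_num
  have ee' : Real.exp (-(2 * s)) = 1 / e ^ 2 := by rw [Real.exp_neg, ee, one_div]
  have eL : L / (x / 3) ^ 2 = 9 * l * x := by rw [hL]; field_simp; norm_num
  have hE : mgfExponent L (x / 3) (2 * x / 3) ≤ s + 0.101 := by
    have e1 : mgfExponent L (x / 3) (2 * x / 3) = s + 27 * (l * (e - 1 - s - s ^ 2 / 2)) := by
      rw [mgfExponent, es, es3, hL]; field_simp; ring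
    rw [e1]
    nlinarith [mul_nonneg hl0.le hs0, mul_nonneg hl0.le (sq_nonneg s)]
  have hφ : truncMgf ρ (2 * x / 3) (2 * x / 3) ≤ 1.51 * e := by
    refine (h.truncMgf_self_le (a := x / 3) (b := 2 * x / 3) (by positivity) (by positivity)).trans ?_
    rw [es3, eL, ← he]
    have h1 : 9 * l * x * e * (2 * x / 3) = 27 * (s * (l * e)) := by rw [hs]; ring
    rw [h1]
    have h2 : Real.exp (mgfExponent L (x / 3) (2 * x / 3)) ≤ e * 1.1064 := by
      refine (Real.exp_le_exp.2 hE).trans ?_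
      rw [Real.exp_add, ← he]
      have h5 := Real.exp_bound' (x := 0.101) (by norm_num) (by norm_num) (n := 4) (by norm_num)
      norm_num [Finset.sum_range_succ, Nat.factorial] at h5
      have : Real.exp 0.101 ≤ 1.1064 := by norm_num; linarith
      gcongr
    calc _ ≤ e * 1.1064 * (1 + 27 * 0.0133) := by gcongr
      _ ≤ 1.51 * e := by nlinarith
  have hk : mgfRate L (x / 3) (2 * x / 3) ≤ 0.7003 * x := by
    have e1 : mgfRate L (x / 3) (2 * x / 3) = 2 * x / 3 + 9 * (l * (e - 1 - s)) * x := by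
      rw [mgfRate, es, ← he, mul_div_right_comm L, eL]; ring
    rw [e1]
    have : l * (e - 1 - s) ≤ 0.00373 := by nlinarith [mul_nonneg hl0.le hs0]
    nlinarith
  have hφ0 : 0 ≤ truncMgf ρ (2 * x / 3) (2 * x / 3) := integral_nonneg fun y => (Real.exp_pos _).le
  have hY : ∫ y, y * Real.exp (2 * x / 3 * min y (2 * x / 3)) ∂ρ ≤ 1.0912 * x * e := by
    refine (h.integral_mul_exp_mul_min_le (a := x / 3) (b := 2 * x / 3) (u := 2 * x / 3)
      (by positivity) (by positivity)).trans ?_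
    rw [es2, ee, eL]
    have h1 : mgfRate L (x / 3) (2 * x / 3) * truncMgf ρ (2 * x / 3) (2 * x / 3) ≤
        0.7003 * x * (1.51 * e) := by gcongr
    have h2 : 9 * l * x * e ^ 2 = 9 * (l * e) * (x * e) := by ring
    rw [h2]
    have : 0 < x * e := by positivity
    nlinarith
  have hQ0 := normalCdf_nonneg (-x)
  have hQ : normalCdf (-x) ≤ 0.1 * (1 / e ^ 2) := by
    refine (normalCdf_neg_le_exp hx).trans ?_
    rw [← ee']
    gcongr
    rw [hs]; nlinarith
  have hb : 0 ≤ 2 * x / 3 := by positivity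
  have ih := integrable_exp_mul_min (ρ := ρ) hb (2 * x / 3)
  have key := h.abs_sub_normalCdf_le_of_envelope hx0 (V := 1 / e ^ 2 + 1.51 * (1 / e) + normalCdf (-x))
    (W := 1.0912 * x * (1 / e) + 1 / e ^ 2 + normalCdf (-x)) (fun γ E => ?_) (fun γ E => ?_)
  · refine key.trans ?_
    have := stein_numeric_bound hx hs p3 p4 hQ
    calc _ ≤ L * (31.4 / x ^ 3) := by gcongr
      _ = _ := by rw [hL]; field_simp
  · have i0 : Integrable (fun y => 1 / e ^ 2 * (1 + Real.exp (2 * x / 3 * min y (2 * x / 3)))) ρ :=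
      ((integrable_const 1).add ih).const_mul _
    have i1 : Integrable (fun y => 1 / e ^ 2 * (1 + Real.exp (2 * x / 3 * min y (2 * x / 3))) +
        normalCdf (-x)) ρ := i0.add (integrable_const _)
    have iγ : Integrable γ ρ := by
      simpa using integrable_comp_monotone (ρ := ρ) E.mono E.nonneg E.le_one 0
    refine (integral_mono iγ i1 fun y => ?_).trans ?_
    · have := E.le_add_exp_mul_min y hx0
      rwa [es2, ee'] at this
    · rw [integral_add i0 (integrable_const _),
        integral_const_mul, integral_add (integrable_const 1) ih]
      simp only [integral_const, probReal_univ, one_smul]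
      rw [← truncMgf]
      have : 1 / e ^ 2 * (1 + truncMgf ρ (2 * x / 3) (2 * x / 3)) ≤ 1 / e ^ 2 * (1 + 1.51 * e) := by
        gcongr
      refine (add_le_add_left this _).trans (le_of_eq ?_)
      field_simp
  · have im : Integrable (fun y => max y 0) ρ := h.integrable_law.sup (integrable_const 0)
    have i1 := (integrable_mul_exp_mul_min hb (2 * x / 3) im).const_mul (1 / e ^ 2)
    have i2 := im.const_mul (normalCdf (-x))
    refine (integral_mono (integrable_posPart_mul h.integrable_law E.mono E.nonneg E.le_one _)
      (i1.add i2) fun y => ?_).trans ?_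
    · rcases le_total 0 y with hy | hy
      · have := E.shift_le_exp_mul_min hy
        rw [es2, ee'] at this
        simp only [Pi.add_apply]
        rw [max_eq_left hy]
        nlinarith
      · simp [max_eq_right hy]
    · simp only [Pi.add_apply]
      rw [integral_add i1 i2, integral_const_mul, integral_const_mul]
      have h1 := h.integral_pos_mul_exp_le hb
      have h2 : ∫ y, max y 0 ∂ρ ≤ 1 :=
        (integral_mono im h.integrable_law.abs fun y => max_le (le_abs_self y) (abs_nonneg y)).trans
          h.integral_abs_law_le_one
      have h3 : 1 / e ^ 2 * ∫ y, max y 0 * Real.exp (2 * x / 3 * min y (2 * x / 3)) ∂ρ ≤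
          1 / e ^ 2 * (1.0912 * x * e + 1) := by gcongr; linarith
      have h4 : 1 / e ^ 2 * (1.0912 * x * e + 1) = 1.0912 * x * (1 / e) + 1 / e ^ 2 := by field_simp
      have h5 := mul_le_mul_of_nonneg_left h2 hQ0
      linarith
end IsCenteredShot

namespace IsCenteredShot

variable {η ρ : Measure ℝ} [IsFiniteMeasure η] [IsProbabilityMeasure ρ] {L : ℝ}

theorem integral_neg_mul_exp_mul_min_le (h : IsCenteredShot η ρ L) (b : ℝ) {u : ℝ}
    (hu : 0 ≤ u) :
    ∫ y, -y * Real.exp (u * min (-y) b) ∂ρ ≤ u * ∫ y, Real.exp (u * min (-y) b) ∂ρ := by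
  have hbd : ∀ y, |-Real.exp (u * min (-y) b)| ≤ Real.exp (u * b) := fun y => by
    rw [abs_neg, abs_of_pos (Real.exp_pos _)]; exact exp_mul_min_le hu b (-y)
  have e : ∫ y, -y * Real.exp (u * min (-y) b) ∂ρ = ∫ y, y * -Real.exp (u * min (-y) b) ∂ρ := by
    congr 1; ext y; ring
  rw [e, h.mecke (fun y => -Real.exp (u * min (-y) b)) (by fun_prop) ⟨_, hbd⟩]
  have hM : ∀ t, Integrable (fun y => Real.exp (u * min (-(y + t)) b)) ρ := fun t =>
    Integrable.of_bound (by fun_prop) (Real.exp (u * b)) (ae_of_all _ fun y => by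
      rw [Real.norm_eq_abs, abs_of_pos (Real.exp_pos _)]; exact exp_mul_min_le hu b _)
  have hM0 : Integrable (fun y => Real.exp (u * min (-y) b)) ρ := by simpa using hM 0
  set φ := ∫ y, Real.exp (u * min (-y) b) ∂ρ with hφ
  have hle : ∀ᵐ t ∂η, ∫ y, (-Real.exp (u * min (-(y + t)) b) - -Real.exp (u * min (-y) b)) ∂ρ ≤
      φ * u * t := by
    filter_upwards [h.nonneg] with t ht
    rw [hφ, mul_assoc, ← integral_mul_const]
    refine integral_mono ((hM t).neg.sub hM0.neg) (hM0.mul_const _) fun y => ?_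
    beta_reduce
    have h1 : Real.exp (u * min (-y) b) * Real.exp (-(u * t)) ≤ Real.exp (u * min (-(y + t)) b) := by
      rw [← Real.exp_add, ← mul_neg, ← mul_add]
      refine Real.exp_le_exp.2 (mul_le_mul_of_nonneg_left (le_min ?_ ?_) hu)
      · linarith [min_le_left (-y) b]
      · linarith [min_le_right (-y) b]
    have h2 := Real.add_one_le_exp (-(u * t))
    nlinarith [Real.exp_pos (u * min (-y) b)]
  have hge : ∀ᵐ t ∂η, 0 ≤
      ∫ y, (-Real.exp (u * min (-(y + t)) b) - -Real.exp (u * min (-y) b)) ∂ρ := by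
    filter_upwards [h.nonneg] with t ht
    refine integral_nonneg fun y => ?_
    have : Real.exp (u * min (-(y + t)) b) ≤ Real.exp (u * min (-y) b) :=
      Real.exp_le_exp.2 (mul_le_mul_of_nonneg_left (min_le_min_right b (by linarith)) hu)
    simp only [Pi.zero_apply]
    linarith
  refine (integral_mono_of_nonneg hge (h.integrable_id.const_mul (φ * u)) hle).trans ?_
  rw [integral_const_mul, h.integral_id]
  linarith

theorem truncMgf_map_neg (b u : ℝ) :
    truncMgf (ρ.map fun y => -y) b u = ∫ y, Real.exp (u * min (-y) b) ∂ρ := by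
  rw [truncMgf, integral_map measurable_neg.aemeasurable (by fun_prop : Measurable _).aestronglyMeasurable]

theorem truncMgf_map_neg_le (h : IsCenteredShot η ρ L) {b s : ℝ} (hb : 0 ≤ b) (hs : 0 ≤ s) :
    truncMgf (ρ.map fun y => -y) b s ≤ Real.exp (s ^ 2 / 2) := by
  have : IsProbabilityMeasure (ρ.map fun y => -y) :=
    Measure.isProbabilityMeasure_map measurable_neg.aemeasurable
  have hi : Integrable (fun y => y) (ρ.map fun y => -y) := by
    rw [integrable_map_measure (by fun_prop) measurable_neg.aemeasurable]
    exact h.integrable_law.neg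
  have hd : ∀ u, 0 < u → HasDerivAt
      (fun u => truncMgf (ρ.map fun y => -y) b u * Real.exp (-(u ^ 2 / 2)))
      (((∫ y, min y b * Real.exp (u * min y b) ∂(ρ.map fun y => -y)) -
        u * truncMgf (ρ.map fun y => -y) b u) * Real.exp (-(u ^ 2 / 2))) u := fun u hu =>
    ((hasDerivAt_truncMgf hi hb hu).mul ((hasDerivAt_pow 2 u).div_const 2).neg.exp).congr_deriv
      (by simp; ring)
  have hm : AntitoneOn (fun u => truncMgf (ρ.map fun y => -y) b u * Real.exp (-(u ^ 2 / 2)))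
      (Set.Icc 0 s) := by
    refine antitoneOn_of_deriv_nonpos (convex_Icc 0 s) ?_ ?_ ?_
    · exact (continuousOn_truncMgf _ hb s).mul (by fun_prop : Continuous _).continuousOn
    · intro u hu
      rw [interior_Icc] at hu
      exact (hd u hu.1).differentiableAt.differentiableWithinAt
    · intro u hu
      rw [interior_Icc] at hu
      rw [(hd u hu.1).deriv]
      refine mul_nonpos_of_nonpos_of_nonneg ?_ (Real.exp_pos _).le
      have h1 := h.integral_neg_mul_exp_mul_min_le b hu.1.le
      rw [← truncMgf_map_neg] at h1
      have h2 : ∫ y, y * Real.exp (u * min y b) ∂(ρ.map fun y => -y) =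
          ∫ y, -y * Real.exp (u * min (-y) b) ∂ρ :=
        integral_map measurable_neg.aemeasurable (by fun_prop : Measurable _).aestronglyMeasurable
      have h3 : ∫ y, min y b * Real.exp (u * min y b) ∂(ρ.map fun y => -y) ≤
          ∫ y, y * Real.exp (u * min y b) ∂(ρ.map fun y => -y) := by
        refine integral_mono (integrable_mul_exp_mul_min hu.1.le b (hi.inf (integrable_const b)))
          (integrable_mul_exp_mul_min hu.1.le b hi) fun y => ?_
        exact mul_le_mul_of_nonneg_right (min_le_left _ _) (Real.exp_pos _).le
      linarith
  have h0 := hm (Set.left_mem_Icc.2 hs) (Set.right_mem_Icc.2 hs) hs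
  have e0 : truncMgf (ρ.map fun y => -y) b 0 = 1 := by simp [truncMgf]
  beta_reduce at h0
  rw [e0, Real.exp_neg, ← div_eq_mul_inv, div_le_iff₀ (Real.exp_pos _)] at h0
  simpa using h0

theorem measureReal_Iic_neg_le (h : IsCenteredShot η ρ L) {x : ℝ} (hx : 0 ≤ x) :
    ρ.real (Set.Iic (-x)) ≤ Real.exp (-x ^ 2 / 2) := by
  have : IsProbabilityMeasure (ρ.map fun y => -y) :=
    Measure.isProbabilityMeasure_map measurable_neg.aemeasurable
  have h1 := measureReal_Ici_le_truncMgf (ρ.map fun y => -y) hx x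
  rw [map_measureReal_apply measurable_neg measurableSet_Ici] at h1
  have e : (fun y : ℝ => -y) ⁻¹' Set.Ici x = Set.Iic (-x) := by
    ext y; simp only [Set.mem_preimage, Set.mem_Ici, Set.mem_Iic]; exact le_neg
  rw [e] at h1
  refine h1.trans ((mul_le_mul_of_nonneg_left (h.truncMgf_map_neg_le hx hx)
    (Real.exp_pos _).le).trans (le_of_eq ?_))
  rw [← Real.exp_add]; ring_nf

theorem integral_pos_neg_mul_exp_le (h : IsCenteredShot η ρ L) {b : ℝ} (hb : 0 ≤ b) :
    ∫ y, max (-y) 0 * Real.exp (b * min (-y) b) ∂ρ ≤ b * Real.exp (b ^ 2 / 2) + 1 := by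
  have ib : ∀ f : ℝ → ℝ, Integrable f ρ → Integrable (fun y => f y * Real.exp (b * min (-y) b)) ρ :=
    fun f hf => hf.mul_bdd (c := Real.exp (b * b)) (by fun_prop) (ae_of_all _ fun y => by
      rw [Real.norm_eq_abs, abs_of_pos (Real.exp_pos _)]; exact exp_mul_min_le hb b _)
  have iy : Integrable (fun y => -y * Real.exp (b * min (-y) b)) ρ := ib _ h.integrable_law.neg
  have h1 : ∫ y, max (-y) 0 * Real.exp (b * min (-y) b) ∂ρ ≤
      ∫ y, (-y * Real.exp (b * min (-y) b) + |y|) ∂ρ := by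
    refine integral_mono (ib _ (h.integrable_law.neg.sup (integrable_const 0)))
      (iy.add h.integrable_law.abs) fun y => ?_
    beta_reduce
    rcases le_total 0 (-y) with hy | hy
    · rw [max_eq_left hy]; linarith [abs_nonneg y]
    · rw [max_eq_right hy, abs_of_nonneg (by linarith), zero_mul]
      have h2 : Real.exp (b * min (-y) b) ≤ 1 := by
        rw [Real.exp_le_one_iff, min_eq_left (hy.trans hb)]
        exact mul_nonpos_of_nonneg_of_nonpos hb hy
      nlinarith
  rw [integral_add iy h.integrable_law.abs] at h1
  have h2 := h.integral_neg_mul_exp_mul_min_le b hb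
  have h3 := h.truncMgf_map_neg_le hb hb
  rw [truncMgf_map_neg] at h3
  have h4 := mul_le_mul_of_nonneg_left h3 hb
  linarith [h.integral_abs_law_le_one]

theorem abs_sub_neg_le_of_small (h : IsCenteredShot η ρ L) {x : ℝ} (hx : 4 ≤ x) (hL : L ≤ x / 3) :
    |ρ.real (Set.Iic (-x)) - normalCdf (-x)| ≤ 31.4 * (L / x ^ 3) := by
  have hx0 : 0 < x := by linarith
  have hLp := h.pos
  obtain ⟨s, hs⟩ : ∃ s, s = 2 * x ^ 2 / 9 := ⟨_, rfl⟩
  obtain ⟨-, -, p3, p4⟩ := exp_bounds_of_small (s := s) (l := 0) (by rw [hs]; nlinarith) le_rfl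
    (by positivity)
  have es2 : 2 * x / 3 * (2 * x / 3) = 2 * s := by rw [hs]; ring
  have es3 : (2 * x / 3) ^ 2 / 2 = s := by rw [hs]; ring
  set e := Real.exp s with he
  have he0 : 0 < e := Real.exp_pos s
  have ee : Real.exp (2 * s) = e ^ 2 := by rw [he, ← Real.exp_nat_mul]; norm_num
  have ee' : Real.exp (-(2 * s)) = 1 / e ^ 2 := by rw [Real.exp_neg, ee, one_div]
  have hQ0 := normalCdf_nonneg (-x)
  have hQ : normalCdf (-x) ≤ 0.1 * (1 / e ^ 2) := by
    refine (normalCdf_neg_le_exp hx).trans ?_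
    rw [← ee']
    gcongr
    rw [hs]; nlinarith
  have hb : 0 ≤ 2 * x / 3 := by positivity
  have key := h.abs_sub_normalCdf_neg_le_of_envelope hx0 hL
    (W := 1.0912 * x * (1 / e) + 1 / e ^ 2 + normalCdf (-x)) (fun γ E => ?_)
  · refine key.trans ?_
    have h1 := stein_numeric_bound hx hs p3 p4 hQ
    have h2 : 0 ≤ 3 * (1 / e ^ 2 + 1.51 * (1 / e) + normalCdf (-x)) / x + 9 / x ^ 3 := by positivity
    have h3 : 2 * (1.0912 * x * (1 / e) + 1 / e ^ 2 + normalCdf (-x)) ≤ 31.4 / x ^ 3 := by linarith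
    calc _ = L * (2 * (1.0912 * x * (1 / e) + 1 / e ^ 2 + normalCdf (-x))) := by ring
      _ ≤ L * (31.4 / x ^ 3) := by gcongr
      _ = _ := by ring
  · have im : Integrable (fun y => max (-y) 0) ρ := h.integrable_law.neg.sup (integrable_const 0)
    have i1 : Integrable (fun y => 1 / e ^ 2 * (max (-y) 0 *
        Real.exp (2 * x / 3 * min (-y) (2 * x / 3)))) ρ :=
      (im.mul_bdd (c := Real.exp (2 * x / 3 * (2 * x / 3))) (by fun_prop) (ae_of_all _ fun y => by
        rw [Real.norm_eq_abs, abs_of_pos (Real.exp_pos _)]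
        exact exp_mul_min_le hb _ _)).const_mul _
    have i2 : Integrable (fun y => normalCdf (-x) * max (-y) 0) ρ := im.const_mul _
    have hp : ∀ y, max (-y) 0 * γ (-y + x / 3) ≤ 1 / e ^ 2 * (max (-y) 0 *
        Real.exp (2 * x / 3 * min (-y) (2 * x / 3))) + normalCdf (-x) * max (-y) 0 := by
      intro y
      rcases le_total 0 (-y) with hy | hy
      · have h1 := E.shift_le_exp_mul_min hy
        rw [es2, ee'] at h1
        have h2 := mul_le_mul_of_nonneg_left h1 hy
        rw [max_eq_left hy]
        linarith
      · simp [max_eq_right hy]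
    refine (integral_mono_of_nonneg (ae_of_all _ fun y =>
      mul_nonneg (le_max_right _ _) (E.nonneg _)) (i1.add i2) (ae_of_all _ hp)).trans ?_
    simp only [Pi.add_apply]
    rw [integral_add i1 i2, integral_const_mul, integral_const_mul]
    have h1 := h.integral_pos_neg_mul_exp_le hb
    rw [es3, ← he] at h1
    have h2 : ∫ y, max (-y) 0 ∂ρ ≤ 1 :=
      (integral_mono im h.integrable_law.abs fun y => max_le (neg_le_abs y) (abs_nonneg y)).trans
        h.integral_abs_law_le_one
    have h3 : 1 / e ^ 2 * ∫ y, max (-y) 0 * Real.exp (2 * x / 3 * min (-y) (2 * x / 3)) ∂ρ ≤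
        1 / e ^ 2 * (1.0912 * x * e + 1) := by
      have : 0 < x * e := by positivity
      gcongr; linarith
    have h4 : 1 / e ^ 2 * (1.0912 * x * e + 1) = 1.0912 * x * (1 / e) + 1 / e ^ 2 := by field_simp
    have h5 := mul_le_mul_of_nonneg_left h2 hQ0
    linarith

theorem abs_sub_neg_le (h : IsCenteredShot η ρ L) {x : ℝ} (hx : 4 ≤ x) :
    |ρ.real (Set.Iic (-x)) - normalCdf (-x)| ≤ 31.4 * (L / x ^ 3) := by
  rcases le_or_gt L (x / 3) with hL | hL
  · exact h.abs_sub_neg_le_of_small hx hL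
  · have h1 := h.measureReal_Iic_neg_le (x := x) (by linarith)
    have h2 := normalCdf_neg_le_exp hx
    have h3 := normalCdf_nonneg (-x)
    have h4 : 0 ≤ ρ.real (Set.Iic (-x)) := measureReal_nonneg
    have h5 : Real.exp (-x ^ 2 / 2) ≤ 31.4 * (L / x ^ 3) := by
      have h6 := Real.add_one_le_exp (x ^ 2 / 2)
      rw [neg_div, Real.exp_neg]
      have h7 : 1 / (3 * x ^ 2) ≤ L / x ^ 3 := by
        rw [div_le_div_iff₀ (by positivity) (by positivity)]
        nlinarith [pow_pos (by linarith : 0 < x) 2]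
      have h8 : (Real.exp (x ^ 2 / 2))⁻¹ ≤ (x ^ 2 / 2)⁻¹ :=
        inv_anti₀ (by positivity) (by linarith)
      have h9 : (x ^ 2 / 2)⁻¹ = 6 * (1 / (3 * x ^ 2)) := by field_simp; norm_num
      have : 0 < 1 / (3 * x ^ 2) := by positivity
      linarith
    rw [abs_le]
    have := Real.exp_pos (-x ^ 2 / 2)
    constructor <;> linarith

theorem abs_sub_normalCdf_le_div_cube (h : IsCenteredShot η ρ L) {x : ℝ} (hx : 4 ≤ |x|) :
    |ρ.real (Set.Iic x) - normalCdf x| ≤ 31.935 / (1 + |x| ^ 3) * L := by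
  have hLp := h.pos
  have hc : 31.4 * (L / |x| ^ 3) ≤ 31.935 / (1 + |x| ^ 3) * L := by
    have h1 : (4:ℝ) ^ 3 ≤ |x| ^ 3 := pow_le_pow_left₀ (by norm_num) hx 3
    have h2 : 31.4 / |x| ^ 3 ≤ 31.935 / (1 + |x| ^ 3) := by
      rw [div_le_div_iff₀ (by linarith) (by linarith)]; linarith
    calc _ = 31.4 / |x| ^ 3 * L := by ring
      _ ≤ _ := by gcongr
  refine le_trans ?_ hc
  rcases le_total 0 x with h0 | h0
  · rw [abs_of_nonneg h0] at hx ⊢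
    have e : L = L / x ^ 3 * x ^ 3 := by
      have : 0 < x := by linarith
      field_simp
    rcases le_total (L / x ^ 3) (0.0877 * Real.exp (-(0.42 * x ^ 2))) with hl | hl
    · exact h.abs_sub_le_of_stein hx e hl
    · exact h.abs_sub_le_of_moderate hx e hl
  · rw [abs_of_nonpos h0] at hx ⊢
    simpa using h.abs_sub_neg_le hx

theorem abs_sub_normalCdf_le_min (h : IsCenteredShot η ρ L) (x : ℝ) :
    |ρ.real (Set.Iic x) - normalCdf x| ≤ min 0.4785 (31.935 / (1 + |x| ^ 3)) * L := by
  have hLp := h.pos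
  have hu := h.abs_sub_normalCdf_le x
  rcases le_total (0.4785 : ℝ) (31.935 / (1 + |x| ^ 3)) with hm | hm
  · rwa [min_eq_left hm]
  · rw [min_eq_right hm]
    refine h.abs_sub_normalCdf_le_div_cube ?_
    by_contra! hx
    have h1 : |x| ^ 3 < 4 ^ 3 := pow_lt_pow_left₀ hx (abs_nonneg x) (by norm_num)
    have h0 : 0 ≤ |x| ^ 3 := by positivity
    rw [div_le_iff₀ (by linarith)] at hm
    norm_num at hm h1
    linarith
end IsCenteredShot

theorem hasSum_charFun_of_abs_le_one {A : Measure ℝ} [IsFiniteMeasure A] (hA : ∀ᵐ z ∂A, |z| ≤ 1)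
    (t : ℝ) :
    HasSum (fun n : ℕ => ((t : ℂ) * Complex.I) ^ n / n.factorial * ((∫ z, z ^ n ∂A : ℝ) : ℂ))
      (charFun A t) := by
  have hint : ∀ n : ℕ, Integrable (fun z : ℝ => z ^ n) A := fun n =>
    Integrable.of_bound (by fun_prop) 1 (hA.mono fun z hz => by
      rw [norm_pow]; exact pow_le_one₀ (norm_nonneg _) hz)
  have hF : ∀ n : ℕ, Integrable
      (fun z : ℝ => ((t : ℂ) * Complex.I) ^ n / n.factorial * ((z ^ n : ℝ) : ℂ)) A := fun n =>
    ((hint n).ofReal).const_mul _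
  have hs : Summable fun n : ℕ =>
      ∫ z : ℝ, ‖((t : ℂ) * Complex.I) ^ n / n.factorial * ((z ^ n : ℝ) : ℂ)‖ ∂A := by
    refine Summable.of_nonneg_of_le (fun n => integral_nonneg fun z => norm_nonneg _) (fun n => ?_)
      ((Real.summable_pow_div_factorial |t|).mul_right (A.real Set.univ))
    have h1 : ∀ᵐ z : ℝ ∂A, ‖((t : ℂ) * Complex.I) ^ n / n.factorial * ((z ^ n : ℝ) : ℂ)‖ ≤
        |t| ^ n / n.factorial := by
      filter_upwards [hA] with z hz
      have h2 : |z| ^ n ≤ 1 := pow_le_one₀ (abs_nonneg z) hz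
      have h3 : 0 ≤ |t| ^ n / n.factorial := by positivity
      simp only [norm_mul, norm_div, norm_pow, Complex.norm_real, Complex.norm_I, mul_one,
        Complex.norm_natCast, Real.norm_eq_abs]
      nlinarith
    refine (integral_mono_ae (hF n).norm (integrable_const _) h1).trans (le_of_eq ?_)
    rw [integral_const, smul_eq_mul, mul_comm]
  have h := hasSum_integral_of_summable_integral_norm hF hs
  have e1 : ∀ n : ℕ, ∫ z : ℝ, ((t : ℂ) * Complex.I) ^ n / n.factorial * ((z ^ n : ℝ) : ℂ) ∂A =
      ((t : ℂ) * Complex.I) ^ n / n.factorial * ((∫ z, z ^ n ∂A : ℝ) : ℂ) := fun n => by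
    rw [integral_const_mul, integral_complex_ofReal]
  have e2 : ∫ z : ℝ, ∑' n : ℕ, ((t : ℂ) * Complex.I) ^ n / n.factorial * ((z ^ n : ℝ) : ℂ) ∂A =
      charFun A t := by
    rw [charFun_apply_real]
    congr 1
    ext z
    rw [Complex.exp_eq_exp_ℂ, NormedSpace.exp_eq_tsum_div]
    congr 1
    ext n
    push_cast
    rw [mul_right_comm, mul_pow]
    ring
  simp only [e1, e2] at h
  exact h

theorem measure_ext_of_moments {A B : Measure ℝ} [IsFiniteMeasure A] [IsFiniteMeasure B]
    (hA : ∀ᵐ z ∂A, |z| ≤ 1) (hB : ∀ᵐ z ∂B, |z| ≤ 1)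
    (h : ∀ n : ℕ, ∫ z, z ^ n ∂A = ∫ z, z ^ n ∂B) : A = B := by
  refine MeasureTheory.Measure.ext_of_charFun (funext fun t => ?_)
  have h1 := hasSum_charFun_of_abs_le_one hA t
  simp only [h] at h1
  exact h1.unique (hasSum_charFun_of_abs_le_one hB t)

theorem measure_ext_of_laplace {A B : Measure ℝ} [IsFiniteMeasure A] [IsFiniteMeasure B]
    (hA : ∀ᵐ y ∂A, 0 ≤ y) (hB : ∀ᵐ y ∂B, 0 ≤ y)
    (h : ∀ n : ℕ, ∫ y, Real.exp (-(n * y)) ∂A = ∫ y, Real.exp (-(n * y)) ∂B) : A = B := by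
  have hm : Measurable fun y : ℝ => Real.exp (-y) := by fun_prop
  have ha : ∀ C : Measure ℝ, (∀ᵐ y ∂C, 0 ≤ y) → ∀ᵐ z ∂(C.map fun y => Real.exp (-y)), |z| ≤ 1 := by
    intro C hC
    rw [ae_map_iff hm.aemeasurable (measurableSet_le (by fun_prop) (by fun_prop))]
    filter_upwards [hC] with y hy
    rw [abs_of_pos (Real.exp_pos _), Real.exp_le_one_iff]
    linarith
  have hmom : ∀ (C : Measure ℝ) (n : ℕ), ∫ z, z ^ n ∂(C.map fun y => Real.exp (-y)) =
      ∫ y, Real.exp (-(n * y)) ∂C := by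
    intro C n
    rw [integral_map hm.aemeasurable (by fun_prop)]
    congr 1
    ext y
    rw [← Real.exp_nat_mul]; ring_nf
  have hback : ∀ C : Measure ℝ, (C.map fun y => Real.exp (-y)).map (fun z => -Real.log z) = C := by
    intro C
    rw [Measure.map_map (by fun_prop) hm]
    have : ((fun z => -Real.log z) ∘ fun y => Real.exp (-y)) = id := by
      ext y; simp
    rw [this, Measure.map_id]
  have e : (A.map fun y => Real.exp (-y)) = B.map fun y => Real.exp (-y) :=
    measure_ext_of_moments (ha A hA) (ha B hB) fun n => by rw [hmom, hmom, h]
  rw [← hback A, e, hback B]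

theorem lintegral_mecke {P η : Measure ℝ} [IsProbabilityMeasure P] [IsFiniteMeasure η]
    (hP : ∀ᵐ y ∂P, 0 ≤ y) (hη : ∀ᵐ x ∂η, 0 ≤ x)
    (hlap : ∀ s : ℝ, 0 < s → ∫ y, y * Real.exp (-(s * y)) ∂P =
      (∫ y, Real.exp (-(s * y)) ∂P) * ∫ x, Real.exp (-(s * x)) ∂η)
    {f : ℝ → ℝ≥0∞} (hf : Measurable f) :
    ∫⁻ y, ENNReal.ofReal y * f y ∂P = ∫⁻ x, ∫⁻ y, f (y + x) ∂P ∂η := by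
  have hsum : Measurable fun p : ℝ × ℝ => p.2 + p.1 := by fun_prop
  set S := (η.prod P).map fun p => p.2 + p.1 with hS
  have hS0 : ∀ᵐ y ∂S, 0 ≤ y := by
    rw [hS, ae_map_iff hsum.aemeasurable measurableSet_Ici]
    filter_upwards [Measure.quasiMeasurePreserving_fst.ae hη,
      Measure.quasiMeasurePreserving_snd.ae hP] with p h1 h2
    exact add_nonneg h2 h1
  have iA : Integrable (fun y => y * Real.exp (-y)) P := by
    refine Integrable.of_bound (by fun_prop) 1 (hP.mono fun y hy => ?_)
    rw [Real.norm_eq_abs, abs_of_nonneg (by positivity), Real.exp_neg, ← div_eq_mul_inv,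
      div_le_one (Real.exp_pos _)]
    linarith [Real.add_one_le_exp y]
  have iB : Integrable (fun y => Real.exp (-y)) S := by
    refine Integrable.of_bound (by fun_prop) 1 (hS0.mono fun y hy => ?_)
    rw [Real.norm_eq_abs, abs_of_nonneg (by positivity), Real.exp_le_one_iff]
    linarith
  have e : P.withDensity (fun y => ENNReal.ofReal (y * Real.exp (-y))) =
      S.withDensity (fun y => ENNReal.ofReal (Real.exp (-y))) := by
    have := isFiniteMeasure_withDensity_ofReal iA.2
    have := isFiniteMeasure_withDensity_ofReal iB.2
    refine measure_ext_of_laplace ((withDensity_absolutelyContinuous _ _).ae_le hP)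
      ((withDensity_absolutelyContinuous _ _).ae_le hS0) fun n => ?_
    rw [integral_withDensity_eq_integral_toReal_smul (by fun_prop) (by simp),
      integral_withDensity_eq_integral_toReal_smul (by fun_prop) (by simp)]
    have e1 : ∫ y, (ENNReal.ofReal (y * Real.exp (-y))).toReal • Real.exp (-(n * y)) ∂P =
        ∫ y, y * Real.exp (-((n + 1) * y)) ∂P := by
      refine integral_congr_ae (hP.mono fun y hy => ?_)
      beta_reduce
      rw [ENNReal.toReal_ofReal (by positivity), smul_eq_mul, mul_assoc, ← Real.exp_add]
      ring_nf
    have e2 : ∫ y, (ENNReal.ofReal (Real.exp (-y))).toReal • Real.exp (-(n * y)) ∂S =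
        (∫ x, Real.exp (-((n + 1) * x)) ∂η) * ∫ y, Real.exp (-((n + 1) * y)) ∂P := by
      rw [hS, integral_map hsum.aemeasurable (by fun_prop), ← integral_prod_mul]
      congr 1
      ext p
      rw [ENNReal.toReal_ofReal (by positivity), smul_eq_mul, ← Real.exp_add, ← Real.exp_add]
      ring_nf
    rw [e1, e2, hlap _ (by positivity), mul_comm]
  have hm : Measurable fun y => f y * ENNReal.ofReal (Real.exp y) := by fun_prop
  have h1 : ∫⁻ y, f y * ENNReal.ofReal (Real.exp y)
      ∂(P.withDensity fun y => ENNReal.ofReal (y * Real.exp (-y))) =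
      ∫⁻ y, ENNReal.ofReal y * f y ∂P := by
    rw [lintegral_withDensity_eq_lintegral_mul _ (by fun_prop) hm]
    refine lintegral_congr_ae (hP.mono fun y hy => ?_)
    simp only [Pi.mul_apply]
    rw [ENNReal.ofReal_mul hy, mul_assoc, mul_left_comm (ENNReal.ofReal (Real.exp (-y))),
      ← ENNReal.ofReal_mul (Real.exp_pos _).le, ← Real.exp_add]
    simp
  have h2 : ∫⁻ y, f y * ENNReal.ofReal (Real.exp y)
      ∂(S.withDensity fun y => ENNReal.ofReal (Real.exp (-y))) =
      ∫⁻ x, ∫⁻ y, f (y + x) ∂P ∂η := by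
    rw [lintegral_withDensity_eq_lintegral_mul _ (by fun_prop) hm]
    have : ∀ y, ((fun y => ENNReal.ofReal (Real.exp (-y))) * fun y =>
        f y * ENNReal.ofReal (Real.exp y)) y = f y := by
      intro y
      simp only [Pi.mul_apply]
      rw [mul_left_comm, ← ENNReal.ofReal_mul (Real.exp_pos _).le, ← Real.exp_add]
      simp
    simp only [this]
    rw [hS, lintegral_map hf hsum, lintegral_prod _ (by fun_prop)]
  rw [← h1, e, h2]

theorem withDensity_eq_map_add {P η : Measure ℝ} [IsProbabilityMeasure P] [IsFiniteMeasure η]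
    (hP : ∀ᵐ y ∂P, 0 ≤ y) (hη : ∀ᵐ x ∂η, 0 ≤ x)
    (hlap : ∀ s : ℝ, 0 < s → ∫ y, y * Real.exp (-(s * y)) ∂P =
      (∫ y, Real.exp (-(s * y)) ∂P) * ∫ x, Real.exp (-(s * x)) ∂η) :
    P.withDensity ENNReal.ofReal = (η.prod P).map fun p => p.2 + p.1 := by
  have hsum : Measurable fun p : ℝ × ℝ => p.2 + p.1 := by fun_prop
  refine Measure.ext fun s hs => ?_
  have hf : Measurable (s.indicator (1 : ℝ → ℝ≥0∞)) := measurable_one.indicator hs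
  rw [← lintegral_indicator_one hs, ← lintegral_indicator_one hs, lintegral_map hf hsum,
    lintegral_prod (fun p : ℝ × ℝ => s.indicator (1 : ℝ → ℝ≥0∞) (p.2 + p.1))
      (hf.comp hsum).aemeasurable,
    lintegral_withDensity_eq_lintegral_mul _ ENNReal.measurable_ofReal hf]
  exact lintegral_mecke hP hη hlap hf

section

variable {P η : Measure ℝ} [IsProbabilityMeasure P] [IsFiniteMeasure η]

theorem integral_mul_eq_of_withDensity (hP : ∀ᵐ y ∂P, 0 ≤ y)
    (hS : P.withDensity ENNReal.ofReal = (η.prod P).map fun p => p.2 + p.1) {g : ℝ → ℝ}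
    (hg : Measurable g) (hi : Integrable (fun p : ℝ × ℝ => g (p.2 + p.1)) (η.prod P)) :
    Integrable (fun y => y * g y) P ∧ ∫ y, y * g y ∂P = ∫ x, ∫ y, g (y + x) ∂P ∂η := by
  have hsum : Measurable fun p : ℝ × ℝ => p.2 + p.1 := by fun_prop
  have e : (fun y => (ENNReal.ofReal y).toReal • g y) =ᵐ[P] fun y => y * g y :=
    hP.mono fun y hy => by simp [ENNReal.toReal_ofReal hy]
  constructor
  · have h1 : Integrable g (P.withDensity ENNReal.ofReal) := by
      rw [hS, integrable_map_measure hg.aestronglyMeasurable hsum.aemeasurable]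
      exact hi
    rw [integrable_withDensity_iff_integrable_smul' ENNReal.measurable_ofReal (by simp)] at h1
    exact h1.congr e
  · rw [← integral_congr_ae e,
      ← integral_withDensity_eq_integral_toReal_smul ENNReal.measurable_ofReal (by simp), hS,
      integral_map hsum.aemeasurable hg.aestronglyMeasurable, integral_prod _ hi]

theorem integrable_prod_of_bounded {g : ℝ → ℝ} (hg : Measurable g) {C : ℝ} (hC : ∀ y, |g y| ≤ C) :
    Integrable (fun p : ℝ × ℝ => g (p.2 + p.1)) (η.prod P) :=
  Integrable.of_bound (hg.comp (by fun_prop)).aestronglyMeasurable C (ae_of_all _ fun _ => hC _)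

theorem integral_law_eq (hP : ∀ᵐ y ∂P, 0 ≤ y)
    (hS : P.withDensity ENNReal.ofReal = (η.prod P).map fun p => p.2 + p.1) :
    Integrable (fun y => y) P ∧ ∫ y, y ∂P = η.real Set.univ := by
  have := integral_mul_eq_of_withDensity hP hS (g := fun _ => 1) measurable_const
    (integrable_const _)
  simpa using this

theorem integral_sq_law_eq (hP : ∀ᵐ y ∂P, 0 ≤ y)
    (hS : P.withDensity ENNReal.ofReal = (η.prod P).map fun p => p.2 + p.1)
    (hx : Integrable (fun x => x) η) :
    Integrable (fun y => y ^ 2) P ∧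
      ∫ y, y ^ 2 ∂P = (∫ y, y ∂P) ^ 2 + ∫ x, x ∂η := by
  obtain ⟨iy, ey⟩ := integral_law_eq hP hS
  have h := integral_mul_eq_of_withDensity hP hS (g := fun y => y) measurable_id
    ((iy.comp_snd η).add (hx.comp_fst P))
  simp only [← sq] at h
  refine ⟨h.1, ?_⟩
  rw [h.2]
  have e : ∀ x, ∫ y, (y + x) ∂P = ∫ y, y ∂P + x := fun x => by
    rw [integral_add iy (integrable_const _)]; simp
  simp only [e]
  rw [integral_add (integrable_const _) hx, integral_const, smul_eq_mul, ← ey, sq]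

/-- The standardised law of a positive shot noise is a centred shot noise. -/
theorem isCenteredShot_of_withDensity (hP : ∀ᵐ y ∂P, 0 ≤ y) (hη : ∀ᵐ x ∂η, 0 ≤ x)
    (hS : P.withDensity ENNReal.ofReal = (η.prod P).map fun p => p.2 + p.1)
    (hx : Integrable (fun x => x) η) (hx2 : Integrable (fun x => x ^ 2) η) {m σ : ℝ}
    (hm : m = ∫ y, y ∂P) (hσ : 0 < σ) (hσ2 : σ ^ 2 = ∫ x, x ∂η) :
    IsCenteredShot (ENNReal.ofReal (1 / σ) • η.map fun x => x / σ) (P.map fun y => (y - m) / σ)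
      ((∫ x, x ^ 2 ∂η) / σ ^ 3) := by
  obtain ⟨iy, ey⟩ := integral_law_eq hP hS
  obtain ⟨iy2, ey2⟩ := integral_sq_law_eq hP hS hx
  have mη : Measurable fun x : ℝ => x / σ := by fun_prop
  have mP : Measurable fun y : ℝ => (y - m) / σ := by fun_prop
  have hc : (ENNReal.ofReal (1 / σ)).toReal = 1 / σ := ENNReal.toReal_ofReal (by positivity)
  have ib : Integrable (fun y => y ^ 2 - 2 * m * y) P := iy2.sub (iy.const_mul (2 * m))
  have ic : Integrable (fun y => y ^ 2 - 2 * m * y + m ^ 2) P := ib.add (integrable_const _)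
  refine ⟨?_, ?_, ?_, ?_, ?_, ?_, ?_, fun g hg hgb => ?_⟩
  · refine Measure.ae_smul_measure ?_ _
    rw [ae_map_iff mη.aemeasurable measurableSet_Ici]
    filter_upwards [hη] with x hx
    positivity
  · refine Integrable.smul_measure ?_ (by simp)
    rw [integrable_map_measure (by fun_prop) mη.aemeasurable]
    exact hx.div_const σ
  · refine Integrable.smul_measure ?_ (by simp)
    rw [integrable_map_measure (by fun_prop) mη.aemeasurable]
    exact (hx2.div_const (σ ^ 2)).congr (ae_of_all _ fun x => by simp [div_pow])
  · rw [integral_smul_measure, integral_map mη.aemeasurable (by fun_prop), integral_div, ← hσ2, hc,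
      smul_eq_mul]
    field_simp
  · rw [integral_smul_measure, integral_map mη.aemeasurable (by fun_prop), hc, smul_eq_mul]
    simp only [div_pow]
    rw [integral_div]
    field_simp
  · rw [integrable_map_measure (by fun_prop) mP.aemeasurable]
    exact (ic.div_const (σ ^ 2)).congr (ae_of_all _ fun y => by simp [div_pow]; ring)
  · rw [integral_map mP.aemeasurable (by fun_prop)]
    have e : ∀ y, ((y - m) / σ) ^ 2 = (y ^ 2 - 2 * m * y + m ^ 2) / σ ^ 2 := fun y => by
      rw [div_pow]; ring
    simp only [e]
    rw [integral_div, integral_add ib (integrable_const _),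
      integral_sub iy2 (iy.const_mul _), integral_const_mul, ey2, ← hσ2, ← hm]
    simp only [integral_const, probReal_univ, one_smul]
    field_simp
    ring
  · obtain ⟨C, hC⟩ := hgb
    set g' : ℝ → ℝ := fun y => g ((y - m) / σ) with hg'
    have mg' : Measurable g' := hg.comp mP
    have hC' : ∀ y, |g' y| ≤ C := fun y => hC _
    have hp := integrable_prod_of_bounded (P := P) (η := η) mg' hC'
    obtain ⟨i1, e1⟩ := integral_mul_eq_of_withDensity hP hS mg' hp
    have ig : Integrable g' P := Integrable.of_bound mg'.aestronglyMeasurable C (ae_of_all _ hC')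
    have igx : ∀ x, Integrable (fun y => g' (y + x)) P := fun x =>
      Integrable.of_bound (mg'.comp (by fun_prop)).aestronglyMeasurable C (ae_of_all _ fun _ => hC' _)
    have hmeas : ∀ c, Measurable fun w => g (w + c) - g w := fun c =>
      (hg.comp (measurable_id.add_const c)).sub hg
    have hinner : ∀ x, ∫ w, (g (w + x / σ) - g w) ∂(P.map fun y => (y - m) / σ) =
        ∫ y, g' (y + x) ∂P - ∫ y, g' y ∂P := by
      intro x
      have e : ∀ y, g ((y - m) / σ + x / σ) = g' (y + x) := fun y => by
        rw [hg']; beta_reduce; congr 1; ring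
      rw [integral_map mP.aemeasurable (hmeas _).aestronglyMeasurable,
        ← integral_sub (igx x) ig]
      simp only [e, hg']
    have hsm : StronglyMeasurable fun t => ∫ w, (g (w + t) - g w) ∂(P.map fun y => (y - m) / σ) := by
      have : IsProbabilityMeasure (P.map fun y => (y - m) / σ) :=
        Measure.isProbabilityMeasure_map mP.aemeasurable
      have h2 : Measurable fun p : ℝ × ℝ => g (p.2 + p.1) - g p.2 :=
        (hg.comp (by fun_prop)).sub (hg.comp measurable_snd)
      exact h2.stronglyMeasurable.integral_prod_right
    rw [integral_map mP.aemeasurable (by fun_prop), integral_smul_measure,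
      integral_map mη.aemeasurable hsm.aestronglyMeasurable, hc, smul_eq_mul]
    simp only [hinner]
    rw [integral_sub hp.integral_prod_left (integrable_const _), ← e1, integral_const, smul_eq_mul,
      ← ey, ← hm]
    have e2 : ∀ y, (y - m) / σ * g ((y - m) / σ) = 1 / σ * (y * g' y - m * g' y) := fun y => by
      rw [hg']; ring
    simp only [e2]
    rw [integral_const_mul, integral_sub i1 (ig.const_mul m), integral_const_mul]

end

theorem hasDerivAt_laplace {P : Measure ℝ} [IsFiniteMeasure P] (hP : ∀ᵐ y ∂P, 0 ≤ y) {s : ℝ}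
    (hs : 0 < s) :
    HasDerivAt (fun s => ∫ y, Real.exp (-(s * y)) ∂P) (∫ y, -(y * Real.exp (-(s * y))) ∂P) s := by
  refine (hasDerivAt_integral_of_dominated_loc_of_deriv_le (μ := P) (x₀ := s)
    (F := fun s y => Real.exp (-(s * y))) (F' := fun s y => -(y * Real.exp (-(s * y))))
    (s := Set.Ioi (s / 2)) (bound := fun _ => 2 / s) (Ioi_mem_nhds (by linarith))
    (Eventually.of_forall fun v => (by fun_prop : Measurable _).aestronglyMeasurable) ?_
    (by fun_prop) (hP.mono fun y hy v hv => ?_) (integrable_const _)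
    (ae_of_all _ fun y v _ => ?_)).2
  · refine Integrable.of_bound (by fun_prop) 1 (hP.mono fun y hy => ?_)
    rw [Real.norm_eq_abs, abs_of_nonneg (by positivity), Real.exp_le_one_iff]
    nlinarith
  · have h1 := Real.add_one_le_exp (s / 2 * y)
    have h2 : Real.exp (-(v * y)) ≤ Real.exp (-(s / 2 * y)) :=
      Real.exp_le_exp.2 (neg_le_neg (mul_le_mul_of_nonneg_right (Set.mem_Ioi.1 hv).le hy))
    rw [norm_neg, Real.norm_eq_abs, abs_of_nonneg (by positivity)]
    refine (mul_le_mul_of_nonneg_left h2 hy).trans ?_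
    rw [Real.exp_neg, ← div_eq_mul_inv, div_le_div_iff₀ (Real.exp_pos _) hs]
    linarith
  · have h1 : HasDerivAt (fun v => -(v * y)) (-y) v := by
      simpa using (hasDerivAt_id v).mul_const (-y)
    exact h1.exp.congr_deriv (by ring)

theorem integral_mul_exp_neg_eq {P : Measure ℝ} [IsFiniteMeasure P] (hP : ∀ᵐ y ∂P, 0 ≤ y)
    {ψ : ℝ → ℝ} {s N : ℝ} (hs : 0 < s) (hψ : HasDerivAt ψ N s)
    (hlap : ∀ s : ℝ, 0 < s → ∫ y, Real.exp (-(s * y)) ∂P = Real.exp (-ψ s)) :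
    ∫ y, y * Real.exp (-(s * y)) ∂P = (∫ y, Real.exp (-(s * y)) ∂P) * N := by
  have h1 := hasDerivAt_laplace hP hs
  have h2 : HasDerivAt (fun s => ∫ y, Real.exp (-(s * y)) ∂P) (Real.exp (-ψ s) * -N) s :=
    hψ.neg.exp.congr_of_eventuallyEq ((eventually_gt_nhds hs).mono fun v hv => hlap v hv)
  have h3 := h1.unique h2
  rw [integral_neg] at h3
  rw [hlap s hs]
  linarith

section

variable {E : Type*} [MeasurableSpace E] {κ : Measure E} {X w : E → ℝ}

theorem hasDerivAt_levyExponent (hX : Measurable X) (hw : Measurable w) (hX0 : ∀ᵐ z ∂κ, 0 ≤ X z)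
    (hw0 : ∀ᵐ z ∂κ, 0 ≤ w z) (hi : Integrable (fun z => X z * w z) κ) {s : ℝ} (hs : 0 < s) :
    HasDerivAt (fun s => ∫ z, (1 - Real.exp (-(s * X z))) * w z ∂κ)
      (∫ z, Real.exp (-(s * X z)) * (X z * w z) ∂κ) s := by
  refine (hasDerivAt_integral_of_dominated_loc_of_deriv_le (μ := κ) (x₀ := s)
    (F := fun s z => (1 - Real.exp (-(s * X z))) * w z)
    (F' := fun s z => Real.exp (-(s * X z)) * (X z * w z))
    (s := Set.Ioi 0) (bound := fun z => X z * w z) (Ioi_mem_nhds hs)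
    (Eventually.of_forall fun v => (by fun_prop : Measurable _).aestronglyMeasurable) ?_
    (by fun_prop) ?_ hi (ae_of_all _ fun z v _ => ?_)).2
  · refine (hi.const_mul s).mono' (by fun_prop : Measurable _).aestronglyMeasurable ?_
    filter_upwards [hX0, hw0] with z h1 h2
    have h3 := Real.add_one_le_exp (-(s * X z))
    have h4 : Real.exp (-(s * X z)) ≤ 1 := by
      rw [Real.exp_le_one_iff]; nlinarith
    rw [Real.norm_eq_abs, abs_of_nonneg (mul_nonneg (by linarith) h2)]
    nlinarith
  · filter_upwards [hX0, hw0] with z h1 h2 v hv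
    have h4 : Real.exp (-(v * X z)) ≤ 1 := by
      rw [Real.exp_le_one_iff]; nlinarith [Set.mem_Ioi.1 hv]
    rw [Real.norm_eq_abs, abs_of_nonneg (by positivity)]
    exact mul_le_of_le_one_left (by positivity) h4
  · have h1 : HasDerivAt (fun v => -(v * X z)) (-X z) v := by
      simpa using (hasDerivAt_id v).mul_const (-X z)
    exact ((h1.exp.const_sub 1).mul_const (w z)).congr_deriv (by ring)

theorem integral_sizeBiased (hX : Measurable X) (hw : Measurable w) (hX0 : ∀ᵐ z ∂κ, 0 ≤ X z)
    (hw0 : ∀ᵐ z ∂κ, 0 ≤ w z) {f : ℝ → ℝ} (hf : Measurable f) :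
    ∫ x, f x ∂((κ.withDensity fun z => ENNReal.ofReal (X z * w z)).map X) =
      ∫ z, f (X z) * (X z * w z) ∂κ := by
  rw [integral_map hX.aemeasurable hf.aestronglyMeasurable,
    integral_withDensity_eq_integral_toReal_smul (by fun_prop) (by simp)]
  refine integral_congr_ae ?_
  filter_upwards [hX0, hw0] with z h1 h2
  rw [ENNReal.toReal_ofReal (mul_nonneg h1 h2), smul_eq_mul, mul_comm]

theorem integrable_sizeBiased (hX : Measurable X) (hw : Measurable w) (hX0 : ∀ᵐ z ∂κ, 0 ≤ X z)
    (hw0 : ∀ᵐ z ∂κ, 0 ≤ w z) {f : ℝ → ℝ} (hf : Measurable f)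
    (hi : Integrable (fun z => f (X z) * (X z * w z)) κ) :
    Integrable f ((κ.withDensity fun z => ENNReal.ofReal (X z * w z)).map X) := by
  rw [integrable_map_measure hf.aestronglyMeasurable hX.aemeasurable,
    integrable_withDensity_iff_integrable_smul' (by fun_prop) (by simp)]
  refine hi.congr ?_
  filter_upwards [hX0, hw0] with z h1 h2
  rw [ENNReal.toReal_ofReal (mul_nonneg h1 h2), smul_eq_mul, mul_comm, Function.comp_apply]

/-- A positive infinitely divisible law without drift, given by its Laplace transform, becomes a
centred shot noise after standardisation. -/
theorem exists_isCenteredShot_of_laplace {P : Measure ℝ} [IsProbabilityMeasure P]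
    (hP : ∀ᵐ y ∂P, 0 ≤ y) (hX : Measurable X) (hw : Measurable w) (hX0 : ∀ᵐ z ∂κ, 0 ≤ X z)
    (hw0 : ∀ᵐ z ∂κ, 0 ≤ w z) (h1 : Integrable (fun z => X z * w z) κ)
    (h2 : Integrable (fun z => X z ^ 2 * w z) κ) (h3 : Integrable (fun z => X z ^ 3 * w z) κ)
    (hpos : 0 < ∫ z, X z ^ 2 * w z ∂κ)
    (hlap : ∀ s : ℝ, 0 < s → ∫ y, Real.exp (-(s * y)) ∂P =
      Real.exp (-∫ z, (1 - Real.exp (-(s * X z))) * w z ∂κ)) :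
    Integrable (fun y => y ^ 2) P ∧
    ∫ y, y ^ 2 ∂P = (∫ y, y ∂P) ^ 2 + ∫ z, X z ^ 2 * w z ∂κ ∧
    ∃ η : Measure ℝ, IsFiniteMeasure η ∧ IsCenteredShot η
      (P.map fun y => (y - ∫ y, y ∂P) / √(∫ z, X z ^ 2 * w z ∂κ))
      ((∫ z, X z ^ 3 * w z ∂κ) / √(∫ z, X z ^ 2 * w z ∂κ) ^ 3) := by
  set η := (κ.withDensity fun z => ENNReal.ofReal (X z * w z)).map X with hη
  have : IsFiniteMeasure (κ.withDensity fun z => ENNReal.ofReal (X z * w z)) :=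
    isFiniteMeasure_withDensity_ofReal h1.2
  have hη0 : ∀ᵐ x ∂η, 0 ≤ x := by
    rw [hη, ae_map_iff hX.aemeasurable measurableSet_Ici]
    exact (withDensity_absolutelyContinuous _ _).ae_le hX0
  have hS := withDensity_eq_map_add hP hη0 fun s hs => by
    rw [hη, integral_sizeBiased hX hw hX0 hw0 (f := fun x => Real.exp (-(s * x))) (by fun_prop)]
    exact integral_mul_exp_neg_eq hP hs (hasDerivAt_levyExponent hX hw hX0 hw0 h1 hs) hlap
  have e2 : ∫ x, x ∂η = ∫ z, X z ^ 2 * w z ∂κ := by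
    rw [hη, integral_sizeBiased hX hw hX0 hw0 (f := fun x => x) measurable_id]
    congr 1; ext z; ring
  have e3 : ∫ x, x ^ 2 ∂η = ∫ z, X z ^ 3 * w z ∂κ := by
    rw [hη, integral_sizeBiased hX hw hX0 hw0 (f := fun x => x ^ 2) (by fun_prop)]
    congr 1; ext z; ring
  have i2 : Integrable (fun x => x) η :=
    integrable_sizeBiased hX hw hX0 hw0 measurable_id (h2.congr (ae_of_all _ fun z => by
      ring))
  have i3 : Integrable (fun x => x ^ 2) η :=
    integrable_sizeBiased hX hw hX0 hw0 (by fun_prop) (h3.congr (ae_of_all _ fun z => by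
      beta_reduce; ring))
  obtain ⟨j1, j2⟩ := integral_sq_law_eq hP hS i2
  refine ⟨j1, by rw [j2, e2], _, ?_, e3 ▸ isCenteredShot_of_withDensity hP hη0 hS i2 i3 rfl
    (Real.sqrt_pos.2 hpos) (by rw [Real.sq_sqrt hpos.le, e2])⟩
  exact Measure.smul_finite _ ENNReal.ofReal_ne_top

end

theorem integrableOn_pathLoss_pow {α r : ℝ} (hα : 2 < α) (hr : 0 < r) {G : ℝ → ℝ}
    (hGm : Measurable G) (hG0 : ∀ t, 0 ≤ t → 0 ≤ G t) (hGb : ∃ C : ℝ, ∀ t, 0 ≤ t → G t ≤ C)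
    (hGt : ∃ K > (0 : ℝ), ∃ B > (0 : ℝ), ∀ t ≥ B, G t ≤ K * t ^ (-α)) (k : ℕ) :
    IntegrableOn (fun t => G t ^ (k + 1) * (1 / t)) (Set.Ioi r) := by
  obtain ⟨C, hC⟩ := hGb
  obtain ⟨K, hK, B, hB, hKB⟩ := hGt
  have hC0 : 0 ≤ C := (hG0 0 le_rfl).trans (hC 0 le_rfl)
  have hm : AEStronglyMeasurable (fun t => G t ^ (k + 1) * (1 / t)) :=
    (by fun_prop : Measurable _).aestronglyMeasurable
  have hle : Set.Ioi r ⊆ Set.Ioc r (max r B) ∪ Set.Ioi (max r B) := fun t ht => by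
    rcases le_or_gt t (max r B) with h | h
    exacts [Or.inl ⟨ht, h⟩, Or.inr h]
  refine IntegrableOn.mono_set (IntegrableOn.union ?_ ?_) hle
  · refine Measure.integrableOn_of_bounded (M := C ^ (k + 1) * (1 / r)) (by simp) hm ?_
    filter_upwards [ae_restrict_mem measurableSet_Ioc] with t ht
    have h0 : 0 < t := hr.trans ht.1
    have h1 := hG0 t h0.le
    have h2 := hC t h0.le
    rw [Real.norm_eq_abs, abs_of_nonneg (by positivity)]
    have h3 := ht.1.le
    gcongr
  · have hM : 0 < max r B := lt_max_of_lt_left hr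
    refine ((integrableOn_Ioi_rpow_of_lt (by linarith : -α < -1) hM).const_mul
      (C ^ k * K * (1 / r))).mono' hm.restrict ?_
    filter_upwards [ae_restrict_mem measurableSet_Ioi] with t ht
    have hrt : r ≤ t := (le_max_left _ _).trans (Set.mem_Ioi.1 ht).le
    have h0 : 0 < t := hr.trans_le hrt
    have h1 := hG0 t h0.le
    have h2 := hC t h0.le
    have h3 := hKB t ((le_max_right _ _).trans (Set.mem_Ioi.1 ht).le)
    rw [Real.norm_eq_abs, abs_of_nonneg (by positivity), pow_succ]
    calc G t ^ k * G t * (1 / t) ≤ C ^ k * (K * t ^ (-α)) * (1 / r) := by gcongr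
      _ = _ := by ring

theorem integral_sq_mul_pos {q : ℝ → ℝ} (hq0 : ∀ h, 0 ≤ q h)
    (hq : 0 < ∫ h in Set.Ioi (0 : ℝ), q h)
    (hq2 : IntegrableOn (fun h => h ^ 2 * q h) (Set.Ioi 0)) :
    0 < ∫ h in Set.Ioi (0 : ℝ), h ^ 2 * q h := by
  have hnn : ∀ h, 0 ≤ h ^ 2 * q h := fun h => mul_nonneg (sq_nonneg h) (hq0 h)
  refine (integral_nonneg hnn).lt_of_ne fun h => hq.ne' ?_
  refine integral_eq_zero_of_ae ?_
  filter_upwards [(integral_eq_zero_iff_of_nonneg hnn hq2).1 h.symm,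
    ae_restrict_mem measurableSet_Ioi] with t h1 h2
  exact (mul_eq_zero.1 h1).resolve_left (pow_ne_zero 2 (ne_of_gt h2))

section

variable {lam P r : ℝ} {G q : ℝ → ℝ}

theorem shotWeight_eq (k : ℕ) (z : ℝ × ℝ) :
    (P * z.1 * G z.2) ^ k * (lam * q z.1 * (2 * Real.pi / z.2)) =
      lam * (2 * Real.pi) * P ^ k * ((z.1 ^ k * q z.1) * (G z.2 ^ k * (1 / z.2))) := by
  ring

theorem integrable_shotWeight {k : ℕ}
    (hq : IntegrableOn (fun h => h ^ k * q h) (Set.Ioi 0))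
    (hG : IntegrableOn (fun t => G t ^ k * (1 / t)) (Set.Ioi r)) :
    Integrable (fun z : ℝ × ℝ => (P * z.1 * G z.2) ^ k * (lam * q z.1 * (2 * Real.pi / z.2)))
      ((volume.restrict (Set.Ioi 0)).prod (volume.restrict (Set.Ioi r))) := by
  simp only [shotWeight_eq]
  exact (Integrable.mul_prod hq hG).const_mul _

theorem integral_shotWeight (k : ℕ) :
    ∫ z : ℝ × ℝ, (P * z.1 * G z.2) ^ k * (lam * q z.1 * (2 * Real.pi / z.2))
      ∂((volume.restrict (Set.Ioi 0)).prod (volume.restrict (Set.Ioi r))) =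
    lam * (2 * Real.pi) * P ^ k * ((∫ h in Set.Ioi (0 : ℝ), h ^ k * q h) *
      ∫ t in Set.Ioi r, G t ^ k * (1 / t)) := by
  simp only [shotWeight_eq]
  rw [integral_const_mul, integral_prod_mul (fun h => h ^ k * q h) (fun t => G t ^ k * (1 / t))]

end

theorem rpow_three_halves {x : ℝ} (hx : 0 ≤ x) : x ^ (3 / 2 : ℝ) = √x ^ 3 := by
  rw [Real.sqrt_eq_rpow, ← Real.rpow_natCast, ← Real.rpow_mul hx]
  norm_num

theorem lyapunovRatio_eq {lam P m2 m3 J2 J3 : ℝ} (hlam : 0 < lam) (hP : 0 < P) (hm : 0 < m2)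
    (hJ : 0 < J2) :
    lam * (2 * Real.pi) * P ^ 3 * (m3 * J3) / √(lam * (2 * Real.pi) * P ^ 2 * (m2 * J2)) ^ 3 =
      1 / √(2 * Real.pi) * (m3 / m2 ^ (3 / 2 : ℝ)) * (J3 / J2 ^ (3 / 2 : ℝ)) / √lam := by
  have hpi : 0 < 2 * Real.pi := by positivity
  rw [rpow_three_halves hm.le, rpow_three_halves hJ.le,
    Real.sqrt_mul (by positivity), Real.sqrt_mul (by positivity), Real.sqrt_mul hlam.le,
    Real.sqrt_sq hP.le, Real.sqrt_mul hm.le]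
  have s1 := Real.sqrt_pos.2 hlam
  have s2 := Real.sqrt_pos.2 hpi
  have s3 := Real.sqrt_pos.2 hm
  have s4 := Real.sqrt_pos.2 hJ
  have t1 := Real.sq_sqrt hlam.le
  have t2 := Real.sq_sqrt hpi.le
  generalize √lam = a at *
  generalize √(2 * Real.pi) = b at *
  rw [← t1, ← t2]
  field_simp

theorem gaussian_approximation_nonstationary
    {α lam P : ℝ} (hα : 2 < α) (hlam : 0 < lam) (hP : 0 < P)
    (G q : ℝ → ℝ)
    (hG_meas : Measurable G)
    (hG_nonneg : ∀ t, 0 ≤ t → 0 ≤ G t)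
    (hG_bdd : ∃ C : ℝ, ∀ t, 0 ≤ t → G t ≤ C)
    (hG_anti : AntitoneOn G (Set.Ici 0))
    (hG_tail : ∃ K > (0:ℝ), ∃ B > (0:ℝ), ∀ t ≥ B, G t ≤ K * t ^ (-α))
    (hq_meas : Measurable q) (hq_nonneg : ∀ h, 0 ≤ q h)
    (hq_prob : ∫ h in Set.Ioi (0:ℝ), q h = 1)
    (hq_m1 : IntegrableOn (fun h => h * q h) (Set.Ioi 0))
    (hq_m2 : IntegrableOn (fun h => h ^ 2 * q h) (Set.Ioi 0))
    (hq_m3 : IntegrableOn (fun h => h ^ 3 * q h) (Set.Ioi 0))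
    {Ω : Type*} [MeasurableSpace Ω] (μ : Measure Ω) [IsProbabilityMeasure μ]
    (r : ℝ) (hr : 0 < r)
    (I : Ω → ℝ) (hI_meas : Measurable I) (hI_nonneg : ∀ ω, 0 ≤ I ω)
    (hI_laplace : ∀ s : ℝ, 0 ≤ s →
      ∫ ω, Real.exp (-(s * I ω)) ∂μ =
        Real.exp (-(lam * ∫ h in Set.Ioi (0:ℝ), ∫ t in Set.Ioi r,
          (1 - Real.exp (-(s * P * h * G t))) * q h * (2 * Real.pi / t))))
    (hG2_pos : 0 < ∫ t in Set.Ioi r, G t ^ 2 * (1 / t)) :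
    ∀ x : ℝ,
      |(μ {ω | (I ω - ∫ ω', I ω' ∂μ) / Real.sqrt (variance I μ) ≤ x}).toReal -
          (∫ t in Set.Iic (x), Real.exp (-t ^ 2 / 2)) / Real.sqrt (2 * Real.pi)| ≤
        ((1 / Real.sqrt (2 * Real.pi)) *
          ((∫ h in Set.Ioi (0:ℝ), h ^ 3 * q h) /
            (∫ h in Set.Ioi (0:ℝ), h ^ 2 * q h) ^ (3/2 : ℝ)) *
          ((∫ t in Set.Ioi r, G t ^ 3 * (1 / t)) /
            (∫ t in Set.Ioi r, G t ^ 2 * (1 / t)) ^ (3/2 : ℝ)) *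
          min 0.4785 (31.935 / (1 + |x| ^ 3))) / Real.sqrt lam := by
  intro x
  set κ : Measure (ℝ × ℝ) :=
    (volume.restrict (Set.Ioi 0)).prod (volume.restrict (Set.Ioi r)) with hκ
  have hm2 := integral_sq_mul_pos hq_nonneg (by rw [hq_prob]; exact one_pos) hq_m2
  have hJ := integrableOn_pathLoss_pow hα hr hG_meas hG_nonneg hG_bdd hG_tail
  have h1 : Integrable (fun z : ℝ × ℝ =>
      P * z.1 * G z.2 * (lam * q z.1 * (2 * Real.pi / z.2))) κ := by
    simpa using integrable_shotWeight (P := P) (lam := lam) (k := 1) (by simpa using hq_m1) (hJ 0)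
  have h2 := integrable_shotWeight (P := P) (lam := lam) hq_m2 (hJ 1)
  have h3 := integrable_shotWeight (P := P) (lam := lam) hq_m3 (hJ 2)
  have hκmem : ∀ᵐ z ∂κ, 0 < z.1 ∧ 0 < z.2 := by
    rw [hκ, Measure.prod_restrict]
    filter_upwards [ae_restrict_mem (measurableSet_Ioi.prod measurableSet_Ioi)] with z hz
    exact ⟨hz.1, hr.trans hz.2⟩
  have hX0 : ∀ᵐ z ∂κ, 0 ≤ P * z.1 * G z.2 := hκmem.mono fun z hz =>
    mul_nonneg (mul_nonneg hP.le hz.1.le) (hG_nonneg _ hz.2.le)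
  have hw0 : ∀ᵐ z ∂κ, 0 ≤ lam * q z.1 * (2 * Real.pi / z.2) := hκmem.mono fun z hz =>
    mul_nonneg (mul_nonneg hlam.le (hq_nonneg _)) (div_nonneg (by positivity) hz.2.le)
  have hpos : 0 < ∫ z : ℝ × ℝ, (P * z.1 * G z.2) ^ 2 *
      (lam * q z.1 * (2 * Real.pi / z.2)) ∂κ := by
    rw [hκ, integral_shotWeight]
    have := Real.pi_pos
    positivity
  have : IsProbabilityMeasure (μ.map I) :=
    Measure.isProbabilityMeasure_map hI_meas.aemeasurable
  have hlap : ∀ s : ℝ, 0 < s → ∫ y, Real.exp (-(s * y)) ∂(μ.map I) =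
      Real.exp (-∫ z : ℝ × ℝ, (1 - Real.exp (-(s * (P * z.1 * G z.2)))) *
        (lam * q z.1 * (2 * Real.pi / z.2)) ∂κ) := fun s hs => by
    have hi : Integrable (fun z : ℝ × ℝ => (1 - Real.exp (-(s * (P * z.1 * G z.2)))) *
        (lam * q z.1 * (2 * Real.pi / z.2))) κ := by
      refine (h1.const_mul s).mono' (by fun_prop : Measurable _).aestronglyMeasurable ?_
      filter_upwards [hX0, hw0] with z h4 h5
      have h6 := Real.add_one_le_exp (-(s * (P * z.1 * G z.2)))
      have h7 : Real.exp (-(s * (P * z.1 * G z.2))) ≤ 1 :=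
        Real.exp_le_one_iff.2 (neg_nonpos.2 (mul_nonneg hs.le h4))
      rw [Real.norm_eq_abs, abs_of_nonneg (mul_nonneg (by linarith) h5)]
      exact (mul_le_mul_of_nonneg_right (by linarith) h5).trans_eq (mul_assoc _ _ _)
    rw [integral_map hI_meas.aemeasurable (by fun_prop), hI_laplace s hs.le, hκ,
      integral_prod _ hi, ← integral_const_mul]
    simp only [← integral_const_mul]
    refine congrArg (fun c => Real.exp (-c)) (congrArg _ (funext fun h => congrArg _
      (funext fun t => ?_)))
    rw [show s * P * h * G t = s * (P * h * G t) by ring]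
    ring
  obtain ⟨k1, k2, η, hη, hS⟩ := exists_isCenteredShot_of_laplace
    ((ae_map_iff hI_meas.aemeasurable measurableSet_Ici).2 (ae_of_all _ hI_nonneg))
    (by fun_prop) (by fun_prop) hX0 hw0 h1 h2 h3 hpos hlap
  rw [hκ, integral_shotWeight, integral_shotWeight, lyapunovRatio_eq hlam hP hm2 hG2_pos,
    ← integral_shotWeight, ← hκ] at hS
  have hmean : ∫ y, y ∂(μ.map I) = ∫ ω, I ω ∂μ :=
    integral_map hI_meas.aemeasurable measurable_id.aestronglyMeasurable
  have hvar : variance I μ = ∫ z : ℝ × ℝ, (P * z.1 * G z.2) ^ 2 *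
      (lam * q z.1 * (2 * Real.pi / z.2)) ∂κ := by
    have hL : MemLp I 2 μ := (memLp_two_iff_integrable_sq hI_meas.aestronglyMeasurable).2
      ((integrable_map_measure (by fun_prop) hI_meas.aemeasurable).1 k1)
    rw [integral_map hI_meas.aemeasurable (by fun_prop), hmean] at k2
    rw [variance_eq_sub hL]
    simp only [Pi.pow_apply]
    linarith
  rw [hmean, ← hvar, Measure.map_map (by fun_prop) hI_meas] at hS
  have : IsProbabilityMeasure
      (μ.map ((fun y => (y - ∫ ω, I ω ∂μ) / √(variance I μ)) ∘ I)) :=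
    Measure.isProbabilityMeasure_map (by fun_prop)
  have key := hS.abs_sub_normalCdf_le_min x
  rw [measureReal_def, Measure.map_apply (by fun_prop) measurableSet_Iic] at key
  refine (Eq.le ?_).trans (key.trans (Eq.le ?_))
  · rfl
  · ring
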